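/- Let Z ⊂ ℂ^{n+1} be an irreducible hypersurface defined by an irreducible polynomial p ∈ ℂ[X, Y₁,…,Yₙ] satisfying ∂p/∂X ≠ 0 and ∂p/∂Yₙ ≠ 0, and suppose Z is not definable over C_j. Then (unconditionally) for every finitely generated field K over which Z can be defined, there is z ∈ ℍₙ such that (z, j(z), j₂(z),…,jₙ(z)) ∈ Z and this point is generic in Z over K. -/

import Mathlib

noncomputable section

namespace ModularJPaper

/-! ### Basic objects: the upper half-plane, Möbius actions, the modular `j`-function -/

/-- The complex upper half-plane, as a subset of `ℂ`. -/
def HH : Set ℂ := {z : ℂ | 0 < z.im}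

/-- The Möbius action of a complex 2×2 matrix on `ℂ`. -/
def moeb (g : Matrix (Fin 2) (Fin 2) ℂ) (z : ℂ) : ℂ :=
  (g 0 0 * z + g 0 1) / (g 1 0 * z + g 1 1)

/-- A rational 2×2 matrix viewed as a complex one. -/
def qmat (g : Matrix (Fin 2) (Fin 2) ℚ) : Matrix (Fin 2) (Fin 2) ℂ :=
  g.map (fun a => (a : ℂ))

/-- An integer 2×2 matrix viewed as a complex one. -/
def zmat (g : Matrix (Fin 2) (Fin 2) ℤ) : Matrix (Fin 2) (Fin 2) ℂ :=
  g.map (fun a => (a : ℂ))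

/-- `IsModularJ j` says that `j : ℂ → ℂ` restricts on the upper half-plane to *the*
modular `j`-function: it is holomorphic on `ℍ`, invariant under `SL₂(ℤ)`, and has a
Fourier expansion `j(z) = q⁻¹ + 744 + ∑_{k ≥ 1} a_k q^k` with `q = exp(2πiz)`.
(These properties determine `j` uniquely on `ℍ`.) -/
structure IsModularJ (j : ℂ → ℂ) : Prop where
  holo : DifferentiableOn ℂ j HH
  invariant : ∀ g : Matrix (Fin 2) (Fin 2) ℤ, g.det = 1 → ∀ z ∈ HH, j (moeb (zmat g) z) = j z
  fourier : ∃ a : ℕ → ℂ, ∀ z ∈ HH,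
    HasSum (fun k : ℕ => a k * Complex.exp (2 * (Real.pi : ℂ) * Complex.I * z) ^ (k + 1))
      (j z - (Complex.exp (2 * (Real.pi : ℂ) * Complex.I * z))⁻¹ - 744)

/-! ### Algebraic sets, Zariski closure, irreducibility, dimension -/

/-- `V` is an algebraic subset of `ℂ^ι` (the common zero set of a family of polynomials). -/
def IsAlgSet {ι : Type*} (V : Set (ι → ℂ)) : Prop :=
  ∃ P : Set (MvPolynomial ι ℂ), V = {x | ∀ p ∈ P, MvPolynomial.eval x p = 0}

/-- `V` is an algebraic subset of `ℂ^ι` defined by polynomials with coefficients in `L`. -/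
def IsAlgSetOver {ι : Type*} (L : Set ℂ) (V : Set (ι → ℂ)) : Prop :=
  ∃ P : Set (MvPolynomial ι ℂ),
    (∀ p ∈ P, ∀ m : ι →₀ ℕ, MvPolynomial.coeff m p ∈ L) ∧
    V = {x | ∀ p ∈ P, MvPolynomial.eval x p = 0}

/-- The Zariski closure of a subset of `ℂ^ι`. -/
def zcl {ι : Type*} (S : Set (ι → ℂ)) : Set (ι → ℂ) :=
  ⋂₀ {T | IsAlgSet T ∧ S ⊆ T}

/-- Irreducibility (in the Zariski topology) of a subset of `ℂ^ι`. -/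
def IsIrr {ι : Type*} (S : Set (ι → ℂ)) : Prop :=
  S.Nonempty ∧ ∀ V W : Set (ι → ℂ), IsAlgSet V → IsAlgSet W → S ⊆ V ∪ W → S ⊆ V ∨ S ⊆ W

/-- The dimension of (the Zariski closure of) a subset of `ℂ^ι`: the supremum of the
lengths of strictly increasing chains of irreducible algebraic subsets of its closure. -/
def adim {ι : Type*} (S : Set (ι → ℂ)) : ℕ :=
  sSup {k : ℕ | ∃ c : Fin (k + 1) → Set (ι → ℂ), StrictMono c ∧
    ∀ i, IsAlgSet (c i) ∧ IsIrr (c i) ∧ c i ⊆ zcl S}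

/-- `X` is an irreducible component of (the Zariski closure of) the set `A`. -/
def IsIrrCompOf {ι : Type*} (X A : Set (ι → ℂ)) : Prop :=
  IsAlgSet X ∧ IsIrr X ∧ X ⊆ zcl A ∧
    ∀ Y : Set (ι → ℂ), IsAlgSet Y → IsIrr Y → Y ⊆ zcl A → X ⊆ Y → X = Y

/-- Constructible subsets of `ℂ^ι`: finite unions of differences of algebraic sets. -/
def IsConstr {ι : Type*} (S : Set (ι → ℂ)) : Prop :=
  ∃ (k : ℕ) (A B : Fin k → Set (ι → ℂ)),
    (∀ i, IsAlgSet (A i) ∧ IsAlgSet (B i)) ∧ S = ⋃ i, A i \ B i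

/-- No coordinate is constant on `V`. -/
def NoConstCoord {ι : Type*} (V : Set (ι → ℂ)) : Prop :=
  ∀ (i : ι) (c : ℂ), ∃ v ∈ V, v i ≠ c

/-- The fibre of a parametric family `F ⊆ ℂ^ι × ℂ^κ` over the parameter `q`. -/
def fib {ι κ : Type*} (F : Set ((ι ⊕ κ) → ℂ)) (q : κ → ℂ) : Set (ι → ℂ) :=
  {s | Sum.elim s q ∈ F}

/-! ### Transcendence degree and finitely generated subfields of `ℂ` -/

/-- The transcendence degree `tr.deg_K K(v)` of the field generated over `K` by the
coordinates of the tuple `v`: the maximal size of a subfamily of `v` that is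
algebraically independent over `K`. -/
def trdegF (K : Subfield ℂ) {ι : Type*} (v : ι → ℂ) : ℕ :=
  sSup {k : ℕ | ∃ t : Finset ι, t.card = k ∧ AlgebraicIndependent K (fun i : t => v i.1)}

/-- `K` is a finitely generated subfield of `ℂ`. -/
def FGField (K : Subfield ℂ) : Prop :=
  ∃ s : Finset ℂ, K = Subfield.closure ↑s

/-! ### The set Σ of quadratic points, `GL₂⁺(ℚ)`-orbits, special points -/

/-- `Σ`: the quadratic points of the upper half-plane. -/
def SigmaSet : Set ℂ := {z | z ∈ HH ∧ (minpoly ℚ z).natDegree = 2}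

/-- `x` and `y` are related by the Möbius action of an element of `G = GL₂⁺(ℚ)`. -/
def GRel (x y : ℂ) : Prop :=
  ∃ g : Matrix (Fin 2) (Fin 2) ℚ, 0 < g.det ∧ moeb (qmat g) x = y

/-- The `GL₂⁺(ℚ)`-orbit of `x`. -/
def Gorb (x : ℂ) : Set ℂ := {y | GRel x y}

/-- `dim_G(z | C)`: the number of distinct `G`-orbits of coordinates of the tuple `z`
which contain no element of `C`. -/
def dimG {ι : Type*} (z : ι → ℂ) (C : Set ℂ) : ℕ :=
  Set.ncard {S : Set ℂ | ∃ i : ι, S = Gorb (z i) ∧ ∀ c ∈ C, ¬ GRel (z i) c}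

/-- `w` is a special point (singular modulus): `w = j(τ)` for a quadratic `τ ∈ ℍ`. -/
def IsSpecialPt (j : ℂ → ℂ) (w : ℂ) : Prop := ∃ τ ∈ SigmaSet, w = j τ

/-- The zero set of the modular polynomial `Φ_N`, described via the modular
correspondence: `Φ_N(x,y) = 0` iff `x = j(z)` and `y = j(gz)` for some `z ∈ ℍ` and
some primitive integer matrix `g` of determinant `N`. -/
def PhiRel (j : ℂ → ℂ) (N : ℕ) (x y : ℂ) : Prop :=
  ∃ z ∈ HH, ∃ g : Matrix (Fin 2) (Fin 2) ℤ, g.det = (N : ℤ) ∧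
    Nat.gcd (Int.gcd (g 0 0) (g 0 1)) (Int.gcd (g 1 0) (g 1 1)) = 1 ∧
    x = j z ∧ y = j (moeb (zmat g) z)

/-! ### Special, weakly special and Möbius subvarieties -/

/-- An algebraic set cut out by modular relations `Φ_N(Y_i, Y_k) = 0` and by equations
`Y_i = τ` with `τ` a special point. -/
def IsSpecialBase {ι : Type*} (j : ℂ → ℂ) (B : Set (ι → ℂ)) : Prop :=
  ∃ (R : Set (ι × ι × ℕ)) (E : Set (ι × ℂ)),
    (∀ r ∈ R, 1 ≤ r.2.2) ∧ (∀ e ∈ E, IsSpecialPt j e.2) ∧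
    B = {y | (∀ r ∈ R, PhiRel j r.2.2 (y r.1) (y r.2.1)) ∧ ∀ e ∈ E, y e.1 = e.2}

/-- A special subvariety of `Y(1)^ι`: an irreducible component of an algebraic set cut
out by modular relations and special-point constant equations. -/
def IsSpecial {ι : Type*} (j : ℂ → ℂ) (T : Set (ι → ℂ)) : Prop :=
  ∃ B, IsSpecialBase j B ∧ IsIrrCompOf T B

/-- A weakly special subvariety of `Y(1)^ι`: an irreducible component of an algebraic
set cut out by modular relations and arbitrary constant equations. -/
def IsWSpecial {ι : Type*} (j : ℂ → ℂ) (T : Set (ι → ℂ)) : Prop :=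
  ∃ (R : Set (ι × ι × ℕ)) (E : Set (ι × ℂ)), (∀ r ∈ R, 1 ≤ r.2.2) ∧
    IsIrrCompOf T {y | (∀ r ∈ R, PhiRel j r.2.2 (y r.1) (y r.2.1)) ∧ ∀ e ∈ E, y e.1 = e.2}

/-- A weakly special subvariety of complexity at most `N`: only modular polynomials
`Φ_M` with `M ≤ N` are needed to define it. -/
def IsWSpecialLE {ι : Type*} (j : ℂ → ℂ) (N : ℕ) (T : Set (ι → ℂ)) : Prop :=
  ∃ (R : Set (ι × ι × ℕ)) (E : Set (ι × ℂ)), (∀ r ∈ R, 1 ≤ r.2.2 ∧ r.2.2 ≤ N) ∧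
    IsIrrCompOf T {y | (∀ r ∈ R, PhiRel j r.2.2 (y r.1) (y r.2.1)) ∧ ∀ e ∈ E, y e.1 = e.2}

/-- A basic special subvariety: a special subvariety with no constant coordinates. -/
def IsBasicSpecial {ι : Type*} (j : ℂ → ℂ) (T : Set (ι → ℂ)) : Prop :=
  IsSpecial j T ∧ NoConstCoord T

/-- The special closure of `X`: the smallest special subvariety containing `X`. -/
def spcl {ι : Type*} (j : ℂ → ℂ) (X : Set (ι → ℂ)) : Set (ι → ℂ) :=
  ⋂₀ {T | IsSpecial j T ∧ X ⊆ T}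

/-- The weakly special closure of `X`. -/
def wspcl {ι : Type*} (j : ℂ → ℂ) (X : Set (ι → ℂ)) : Set (ι → ℂ) :=
  ⋂₀ {T | IsWSpecial j T ∧ X ⊆ T}

/-- The Möbius relation `M_g(x,y) = y(cx+d) - (ax+b) = 0` attached to a 2×2 matrix. -/
def MrelC (g : Matrix (Fin 2) (Fin 2) ℂ) (x y : ℂ) : Prop :=
  y * (g 1 0 * x + g 1 1) - (g 0 0 * x + g 0 1) = 0

/-- A 2×2 matrix is non-scalar. -/
def NonScalar (g : Matrix (Fin 2) (Fin 2) ℂ) : Prop :=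
  ¬ (g 0 1 = 0 ∧ g 1 0 = 0 ∧ g 0 0 = g 1 1)

/-- A Möbius subvariety of `ℂ^ι`: cut out by finitely many relations `M_g(X_i, X_k) = 0`
with `g` non-scalar in `GL₂(ℂ)`. -/
def IsMoebius {ι : Type*} (M : Set (ι → ℂ)) : Prop :=
  ∃ (D : Finset (ι × ι)) (f : ι × ι → Matrix (Fin 2) (Fin 2) ℂ),
    (∀ p ∈ D, (f p).det ≠ 0 ∧ NonScalar (f p)) ∧
    M = {x | ∀ p ∈ D, MrelC (f p) (x p.1) (x p.2)}

/-- A Möbius subvariety of `ℂ^ι` defined by matrices in `G = GL₂⁺(ℚ)`. -/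
def IsMoebiusQpos {ι : Type*} (M : Set (ι → ℂ)) : Prop :=
  ∃ (D : Finset (ι × ι)) (f : ι × ι → Matrix (Fin 2) (Fin 2) ℚ),
    (∀ p ∈ D, 0 < (f p).det ∧ NonScalar (qmat (f p))) ∧
    M = {x | ∀ p ∈ D, MrelC (qmat (f p)) (x p.1) (x p.2)}

/-- A Möbius subvariety of `ℂ^ι` defined over `ℚ` (rational invertible non-scalar
matrices). -/
def IsMoebiusRat {ι : Type*} (M : Set (ι → ℂ)) : Prop :=
  ∃ (D : Finset (ι × ι)) (f : ι × ι → Matrix (Fin 2) (Fin 2) ℚ),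
    (∀ p ∈ D, (f p).det ≠ 0 ∧ NonScalar (qmat (f p))) ∧
    M = {x | ∀ p ∈ D, MrelC (qmat (f p)) (x p.1) (x p.2)}

/-! ### The two-sorted space `ℂⁿ × Y(1)ⁿ`, broadness, freeness, (EC) -/

/-- The coordinate projection `Pr_i : ℂⁿ × Y(1)ⁿ → ℂ^ℓ × Y(1)^ℓ` attached to a tuple
`i₁ < ⋯ < i_ℓ`. -/
def prSum {n ℓ : ℕ} (i : Fin ℓ → Fin n) (v : (Fin n ⊕ Fin n) → ℂ) : (Fin ℓ ⊕ Fin ℓ) → ℂ :=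
  Sum.elim (fun k => v (Sum.inl (i k))) (fun k => v (Sum.inr (i k)))

/-- `V ⊆ ℂⁿ × Y(1)ⁿ` is broad: `dim Pr_i(V) ≥ ℓ` for every tuple `i₁ < ⋯ < i_ℓ`. -/
def Broad {n : ℕ} (V : Set ((Fin n ⊕ Fin n) → ℂ)) : Prop :=
  ∀ (ℓ : ℕ) (i : Fin ℓ → Fin n), 1 ≤ ℓ → StrictMono i → ℓ ≤ adim (prSum i '' V)

/-- `V ⊆ ℂⁿ × Y(1)ⁿ` is modularly free: `V` is not contained in `ℂⁿ × T` for any proper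
special subvariety `T` of `Y(1)ⁿ`. -/
def ModularlyFree {n : ℕ} (j : ℂ → ℂ) (V : Set ((Fin n ⊕ Fin n) → ℂ)) : Prop :=
  ∀ T : Set (Fin n → ℂ), IsSpecial j T → T ≠ Set.univ →
    ¬ V ⊆ {v | (fun k => v (Sum.inr k)) ∈ T}

/-- `V ⊆ ℂⁿ × Y(1)ⁿ` is free. -/
def Free {n : ℕ} (j : ℂ → ℂ) (V : Set ((Fin n ⊕ Fin n) → ℂ)) : Prop :=
  NoConstCoord V ∧
  (∀ M : Set (Fin n → ℂ), IsMoebiusQpos M → M ≠ Set.univ →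
    ¬ V ⊆ {v | (fun k => v (Sum.inl k)) ∈ M}) ∧
  ModularlyFree j V

/-- The graph `E_jⁿ ⊆ ℂⁿ × Y(1)ⁿ` of the `j`-function. -/
def Ej (j : ℂ → ℂ) (n : ℕ) : Set ((Fin n ⊕ Fin n) → ℂ) :=
  {v | (∀ k, v (Sum.inl k) ∈ HH) ∧ ∀ k, v (Sum.inr k) = j (v (Sum.inl k))}

/-- `V` satisfies (EC): `V ∩ E_jⁿ` is Zariski dense in `V`. -/
def SatisfiesEC {n : ℕ} (j : ℂ → ℂ) (V : Set ((Fin n ⊕ Fin n) → ℂ)) : Prop :=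
  V ⊆ zcl (V ∩ Ej j n)

/-! ### MSCD and MZP -/

/-- The modular Schanuel conjecture with derivatives. -/
def MSCD (j : ℂ → ℂ) : Prop :=
  ∀ (n : ℕ) (z : Fin n → ℂ), (∀ i, z i ∈ HH) →
    3 * dimG z SigmaSet ≤
      trdegF ⊥ (fun p : Fin 4 × Fin n =>
        ![z, j ∘ z, deriv j ∘ z, deriv (deriv j) ∘ z] p.1 p.2)

/-- `X` is an atypical component of `W ⊆ Y(1)ⁿ`: an irreducible component of `W ∩ T`,
for some special subvariety `T`, with `dim X > dim W + dim T − n`. -/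
def IsAtypComp {n : ℕ} (j : ℂ → ℂ) (W X : Set (Fin n → ℂ)) : Prop :=
  ∃ T, IsSpecial j T ∧ IsIrrCompOf X (W ∩ T) ∧
    (adim W : ℤ) + (adim T : ℤ) - (n : ℤ) < (adim X : ℤ)

/-- The modular Zilber–Pink conjecture: every subvariety of `Y(1)ⁿ` has finitely many
maximal atypical components. -/
def MZP (j : ℂ → ℂ) : Prop :=
  ∀ (n : ℕ) (W : Set (Fin n → ℂ)), IsAlgSet W →
    {X | IsAtypComp j W X ∧ ∀ X', IsAtypComp j W X' → X ⊆ X' → X = X'}.Finite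

/-! ### `j`-derivations, `jcl`, `C_j`, `dim^j` -/

/-- A `j`-derivation on `ℂ`. -/
def IsJDeriv (j : ℂ → ℂ) (D : ℂ → ℂ) : Prop :=
  (∀ a b : ℂ, D (a + b) = D a + D b) ∧
  (∀ a b : ℂ, D (a * b) = a * D b + b * D a) ∧
  (∀ z ∈ HH, ∀ k : ℕ, D (deriv^[k] j z) = deriv^[k + 1] j z * D z)

/-- The `j`-closure of a subset of `ℂ`. -/
def jcl (j : ℂ → ℂ) (A : Set ℂ) : Set ℂ :=
  {x | ∀ D : ℂ → ℂ, IsJDeriv j D → (∀ a ∈ A, D a = 0) → D x = 0}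

/-- `C_j = jcl(∅)`. -/
def Cj (j : ℂ → ℂ) : Set ℂ := jcl j ∅

/-- `dim^j(A|B) ≥ n`. -/
def dimjGE (j : ℂ → ℂ) (A B : Set ℂ) (n : ℕ) : Prop :=
  ∃ (a : Fin n → ℂ) (D : Fin n → ℂ → ℂ),
    (∀ i, a i ∈ jcl j A) ∧
    (∀ i, IsJDeriv j (D i) ∧ ∀ b ∈ B, D i b = 0) ∧
    (∀ i k, D i (a k) = if i = k then 1 else 0)

/-- `dim^j(A|B)`, the relative dimension in the pregeometry `jcl`. -/
def dimj (j : ℂ → ℂ) (A B : Set ℂ) : ℕ := sSup {n | dimjGE j A B n}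

/-- `V ⊆ ℂⁿ × Y(1)ⁿ` (broad) has no `C_j`-factors. -/
def NoCjFactors {n : ℕ} (j : ℂ → ℂ) (V : Set ((Fin n ⊕ Fin n) → ℂ)) : Prop :=
  ∀ (ℓ : ℕ) (i : Fin ℓ → Fin n), 1 ≤ ℓ → StrictMono i →
    ℓ < adim (prSum i '' V) ∨
    (adim (prSum i '' V) = ℓ ∧ ¬ IsAlgSetOver (Cj j) (zcl (prSum i '' V)))

/-- A tuple `t ∈ ℍ^m` is convenient for `j`:
`tr.deg_ℚ ℚ(t, J(t)) = 3 dim_G(t|Σ) + dim^j(t)`. -/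
def ConvenientTuple (j : ℂ → ℂ) {m : ℕ} (t : Fin m → ℂ) : Prop :=
  (∀ i, t i ∈ HH) ∧
  trdegF ⊥ (fun p : Fin 4 × Fin m =>
      ![t, j ∘ t, deriv j ∘ t, deriv (deriv j) ∘ t] p.1 p.2)
    = 3 * dimG t SigmaSet + dimj j (Set.range t) ∅

/-! ### Iterates of `j` -/

/-- The iterates of `j`: `jIt j 0 = id`, `jIt j (n+1) = j ∘ jIt j n`; so `j_n = jIt j n`
for `n ≥ 1`. -/
def jIt (j : ℂ → ℂ) : ℕ → ℂ → ℂ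
  | 0 => id
  | n + 1 => j ∘ jIt j n

/-- The domain `ℍ_n` of `j_n`: `ℍ₁ = ℍ`, `ℍ_{n+1} = {z ∈ ℍ_n : j_n(z) ∈ ℍ}`. -/
def HHn (j : ℂ → ℂ) : ℕ → Set ℂ
  | 0 => Set.univ
  | n + 1 => {z ∈ HHn j n | jIt j n z ∈ HH}

/-! ### The space `ℂⁿ × Y₂(1)ⁿ` with derivatives -/

/-- The projection `PR_i : ℂⁿ × Y₂(1)ⁿ → ℂ^ℓ × Y₂(1)^ℓ`. -/
def prJ {n ℓ : ℕ} (i : Fin ℓ → Fin n) (v : (Fin n ⊕ Fin n × Fin 3) → ℂ) :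
    (Fin ℓ ⊕ Fin ℓ × Fin 3) → ℂ :=
  Sum.elim (fun k => v (Sum.inl (i k))) (fun p => v (Sum.inr (i p.1, p.2)))

/-- `V ⊆ ℂⁿ × Y₂(1)ⁿ` is `J`-broad: `dim PR_i(V) ≥ 3ℓ` for all `i`. -/
def JBroad {n : ℕ} (V : Set ((Fin n ⊕ Fin n × Fin 3) → ℂ)) : Prop :=
  ∀ (ℓ : ℕ) (i : Fin ℓ → Fin n), 1 ≤ ℓ → StrictMono i → 3 * ℓ ≤ adim (prJ i '' V)

/-- `V ⊆ ℂⁿ × Y₂(1)ⁿ` is `J`-free. -/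
def JFree {n : ℕ} (j : ℂ → ℂ) (V : Set ((Fin n ⊕ Fin n × Fin 3) → ℂ)) : Prop :=
  NoConstCoord V ∧
  (∀ M : Set (Fin n → ℂ), IsMoebiusRat M → M ≠ Set.univ →
    ¬ V ⊆ {v | (fun k => v (Sum.inl k)) ∈ M}) ∧
  (∀ T : Set (Fin n → ℂ), IsSpecial j T → T ≠ Set.univ →
    ¬ V ⊆ {v | (fun k => v (Sum.inr (k, 0))) ∈ T})

/-- The graph `E_Jⁿ ⊆ ℂⁿ × Y₂(1)ⁿ` of `J = (j, j′, j″)`. -/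
def EJ (j : ℂ → ℂ) (n : ℕ) : Set ((Fin n ⊕ Fin n × Fin 3) → ℂ) :=
  {v | (∀ k, v (Sum.inl k) ∈ HH) ∧ ∀ k : Fin n,
      v (Sum.inr (k, 0)) = j (v (Sum.inl k)) ∧
      v (Sum.inr (k, 1)) = deriv j (v (Sum.inl k)) ∧
      v (Sum.inr (k, 2)) = deriv (deriv j) (v (Sum.inl k))}

/-- `V ⊆ ℂⁿ × Y₂(1)ⁿ` (J-broad) has no `C_j`-factors. -/
def NoCjFactorsJ {n : ℕ} (j : ℂ → ℂ) (V : Set ((Fin n ⊕ Fin n × Fin 3) → ℂ)) : Prop :=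
  ∀ (ℓ : ℕ) (i : Fin ℓ → Fin n), 1 ≤ ℓ → StrictMono i →
    3 * ℓ < adim (prJ i '' V) ∨
    (adim (prJ i '' V) = 3 * ℓ ∧ ¬ IsAlgSetOver (Cj j) (zcl (prJ i '' V)))

set_option linter.unusedSectionVars false

/-! ### Extending derivations -/

open scoped TensorProduct in
/-- Derivations extend along formally étale algebras. -/
theorem exists_derivation_extend {R S T M : Type*} [CommRing R] [CommRing S] [CommRing T]
    [Algebra R S] [Algebra R T] [Algebra S T] [IsScalarTower R S T] [Algebra.FormallyEtale S T]
    [AddCommGroup M] [Module T M] [Module S M] [Module R M] [IsScalarTower S T M]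
    [IsScalarTower R S M] [IsScalarTower R T M] (d : Derivation R S M) :
    ∃ d' : Derivation R T M, ∀ s, d' (algebraMap S T s) = d s := by
  let e := KaehlerDifferential.tensorKaehlerEquivOfFormallyEtale R S T
  let l : T ⊗[S] KaehlerDifferential R S →ₗ[T] M :=
    LinearMap.liftBaseChange T d.liftKaehlerDifferential
  refine ⟨(l.comp e.symm.toLinearMap).compDer (KaehlerDifferential.D R T), fun s => ?_⟩
  simp [e, l, KaehlerDifferential.tensorKaehlerEquivOfFormallyEtale_symm_D_algebraMap]

section ext
variable {k E : Type*} [Field k] [Field E] [Algebra k E] [CharZero E]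

open scoped IntermediateField.algebraAdjoinAdjoin in
theorem exists_derivation_of_isTranscendenceBasis {ι : Type*} {x : ι → E}
    (hx : IsTranscendenceBasis k x) (c : ι → E) :
    ∃ δ : Derivation k E E, ∀ i, δ (x i) = c i := by
  have hk : CharZero k := (algebraMap k E).charZero
  let A := Algebra.adjoin k (Set.range x)
  let L := IntermediateField.adjoin k (Set.range x)
  let P := MvPolynomial ι k
  let e : P ≃ₐ[k] A := hx.1.aevalEquiv
  let : Algebra P E := (MvPolynomial.aeval x).toAlgebra
  have : IsScalarTower k P E := IsScalarTower.of_algHom (MvPolynomial.aeval x)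
  let : Algebra P A := e.toAlgHom.toAlgebra
  have : IsScalarTower P A E := IsScalarTower.of_algebraMap_eq fun p => by
    change MvPolynomial.aeval x p = (e p : E)
    exact (hx.1.algebraMap_aevalEquiv p).symm
  have : Algebra.FormallyEtale P A :=
    Algebra.FormallyEtale.of_equiv (AlgEquiv.ofBijective (Algebra.ofId P A) e.bijective)
  have : Algebra.IsAlgebraic L E := hx.isAlgebraic_field
  have : Algebra.FormallyEtale L E := Algebra.FormallyEtale.of_isSeparable L E
  have : Algebra.FormallyEtale A L := .of_isLocalization (nonZeroDivisors _)
  have : Algebra.FormallyEtale A E := .comp A L E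
  have : Algebra.FormallyEtale P E := .comp P A E
  obtain ⟨d, hd⟩ := exists_derivation_extend (T := E)
    (MvPolynomial.mkDerivation k c : Derivation k P E)
  refine ⟨d, fun i => ?_⟩
  have := hd (MvPolynomial.X i)
  rw [MvPolynomial.mkDerivation_X] at this
  rw [← this]
  congr 1
  exact (MvPolynomial.aeval_X x i).symm

/-- An algebraically independent family can be given arbitrary derivatives. -/
theorem exists_derivation_of_algebraicIndependent {ι : Type*} {x : ι → E}
    (hx : AlgebraicIndependent k x) (c : ι → E) :
    ∃ δ : Derivation k E E, ∀ i, δ (x i) = c i := by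
  obtain ⟨t, ht, hb⟩ := exists_isTranscendenceBasis_superset (s := Set.range x) hx.coe_range
  obtain ⟨δ, hδ⟩ := exists_derivation_of_isTranscendenceBasis hb
    (fun y => (Function.extend x c 0) y)
  refine ⟨δ, fun i => ?_⟩
  rw [hδ ⟨x i, ht ⟨i, rfl⟩⟩, Function.Injective.extend_apply hx.injective]

/-- An element killed by all derivations killing `S` is algebraic over `k(S)`. -/
theorem isAlgebraic_adjoin_of_derivation (S : Set E) (y : E)
    (h : ∀ δ : Derivation k E E, (∀ s ∈ S, δ s = 0) → δ y = 0) :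
    IsAlgebraic (IntermediateField.adjoin k S) y := by
  by_contra hy
  have hi : AlgebraicIndependent (IntermediateField.adjoin k S) ![y] := by
    rw [algebraicIndependent_unique_type_iff]; exact hy
  obtain ⟨δ, hδ⟩ := exists_derivation_of_algebraicIndependent hi 1
  have := h (δ.restrictScalars k) fun s hs => by
    have := δ.map_algebraMap ⟨s, IntermediateField.subset_adjoin k S hs⟩
    simpa using this
  have h1 := hδ 0
  simp at h1 this
  simp [this] at h1

/-- The field of constants of a derivation. -/
def constField (δ : Derivation k E E) : IntermediateField k E where
  carrier := {x | δ x = 0}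
  mul_mem' {a b} ha hb := by
    simp only [Set.mem_ofPred_eq] at *
    simp [ha, hb]
  add_mem' {a b} ha hb := by
    simp only [Set.mem_ofPred_eq] at *
    simp [ha, hb]
  algebraMap_mem' r := δ.map_algebraMap r
  inv_mem' a ha := by
    simp only [Set.mem_ofPred_eq] at *
    simp [Derivation.leibniz_inv, ha]

/-- A derivation regarded as linear over its field of constants. -/
def overConst (δ : Derivation k E E) : Derivation (constField δ) E E where
  toFun := δ
  map_add' := δ.map_add
  map_smul' c x := by
    rw [Algebra.smul_def, δ.leibniz]
    have h : δ (c : E) = 0 := c.2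
    simp [h, Algebra.smul_def]
  map_one_eq_zero' := δ.map_one_eq_zero
  leibniz' := δ.leibniz

theorem derivation_eq_zero_of_isAlgebraic {δ : Derivation k E E} {x : E}
    (hx : IsAlgebraic k x) : δ x = 0 := by
  have hk : CharZero k := (algebraMap k E).charZero
  have h := (hx.isIntegral)
  have hs : (minpoly k x).Separable := (minpoly.irreducible h).separable
  have h1 : δ (Polynomial.aeval x (minpoly k x)) =
      Polynomial.aeval x (Polynomial.derivative (minpoly k x)) * δ x := by
    rw [δ.map_aeval]; rfl
  rw [minpoly.aeval, map_zero] at h1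
  exact (mul_eq_zero.1 h1.symm).resolve_left (hs.aeval_derivative_ne_zero (minpoly.aeval k x))

theorem derivation_eq_zero_of_isAlgebraic_of_le {δ : Derivation k E E} {x : E}
    {L : IntermediateField k E} (hL : L ≤ constField δ) (hx : IsAlgebraic L x) : δ x = 0 := by
  have h : IsAlgebraic (constField δ) x := by
    obtain ⟨p, hp, h0⟩ := hx
    refine ⟨p.map (IntermediateField.inclusion hL).toRingHom, ?_, ?_⟩
    · exact (Polynomial.map_ne_zero_iff (IntermediateField.inclusion hL).injective).2 hp
    · rw [Polynomial.aeval_def, Polynomial.eval₂_map]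
      exact h0
  exact derivation_eq_zero_of_isAlgebraic (δ := overConst δ) h

theorem derivation_eq_zero_of_isAlgebraic_adjoin {δ : Derivation k E E} {x : E} {S : Set E}
    (hS : ∀ s ∈ S, δ s = 0) (hx : IsAlgebraic (IntermediateField.adjoin k S) x) : δ x = 0 :=
  derivation_eq_zero_of_isAlgebraic_of_le (IntermediateField.adjoin_le_iff.2 hS) hx

end ext

section datum
variable {k E : Type*} [Field k] [Field E] [Algebra k E] [CharZero E]

theorem der_mul (δ : Derivation k E E) (a b : E) : δ (a * b) = a * δ b + b * δ a := by
  simp [δ.leibniz]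

theorem der_inv (δ : Derivation k E E) (a : E) : δ a⁻¹ = -(δ a) / a ^ 2 := by
  rw [δ.leibniz_inv, smul_eq_mul, inv_pow]; ring

theorem der_div (δ : Derivation k E E) (a : E) {b : E} (hb : b ≠ 0) :
    δ (a / b) = δ a / b - a * δ b / b ^ 2 := by
  rw [δ.leibniz_div]; simp only [smul_eq_mul]; field_simp

theorem der_pow (δ : Derivation k E E) (a : E) (n : ℕ) :
    δ (a ^ n) = n * a ^ (n - 1) * δ a := by
  rw [δ.leibniz_pow]; simp [mul_assoc]

theorem der_ofNat (δ : Derivation k E E) (n : ℕ) [n.AtLeastTwo] :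
    δ (ofNat(n) : E) = 0 := by
  have := δ.map_natCast n
  exact this

theorem der_algebraMap (δ : Derivation k E E) (c : k) : δ (algebraMap k E c) = 0 :=
  δ.map_algebraMap c

/-- The rational function in the Schwarzian equation of `j`. -/
def schwR (c0 c1 w : E) : E :=
  4 / (9 * (w - c0) ^ 2) + 3 / (8 * (w - c1) ^ 2) - 23 / (72 * ((w - c0) * (w - c1)))

/-- The derivative of `schwR` in `w`. -/
def schwR' (c0 c1 w : E) : E :=
  -8 / (9 * (w - c0) ^ 3) - 3 / (4 * (w - c1) ^ 3)
    + 23 * ((w - c0) + (w - c1)) / (72 * ((w - c0) ^ 2 * (w - c1) ^ 2))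

theorem der_schwR (δ : Derivation k E E) {c0 c1 w : E} (h0 : δ c0 = 0) (h1 : δ c1 = 0)
    (hw0 : w ≠ c0) (hw1 : w ≠ c1) : δ (schwR c0 c1 w) = schwR' c0 c1 w * δ w := by
  have a0 := sub_ne_zero.2 hw0
  have a1 := sub_ne_zero.2 hw1
  unfold schwR schwR'
  rw [map_sub, map_add, der_div δ _ (by simp [a0]), der_div δ _ (by simp [a1]),
    der_div δ _ (by simp [a0, a1])]
  simp only [der_mul, der_pow, map_sub, h0, h1, der_ofNat]
  field_simp
  ring

/-- A point with second order jet. -/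
structure Datum (E : Type*) where
  /-- the point -/
  z : E
  /-- the value -/
  w : E
  /-- the first derivative -/
  w1 : E
  /-- the second derivative -/
  w2 : E

/-- The third derivative prescribed by the Schwarzian equation. -/
def Datum.w3 (c0 c1 : E) (a : Datum E) : E :=
  3 / 2 * a.w2 ^ 2 / a.w1 - schwR c0 c1 a.w * a.w1 ^ 3

/-- The datum `a` is a nonconstant solution of the Schwarzian equation for `D`. -/
structure IsDatum (c0 c1 : E) (D : Derivation k E E) (a : Datum E) : Prop where
  dw : D a.w = a.w1 * D a.z
  dw1 : D a.w1 = a.w2 * D a.z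
  dw2 : D a.w2 = a.w3 c0 c1 * D a.z
  dz_ne : D a.z ≠ 0
  w1_ne : a.w1 ≠ 0
  w_ne0 : a.w ≠ c0
  w_ne1 : a.w ≠ c1

/-- The Schwarzian of `x` with respect to the derivation `D`. -/
def schw (D : Derivation k E E) (x : E) : E :=
  D (D (D x)) / D x - 3 / 2 * (D (D x) / D x) ^ 2

namespace Datum
variable (c0 c1 : E) (a : Datum E)

/-- The normalised derivative of `w`. -/
def e : Derivation k E E →ₗ[E] E where
  toFun δ := δ a.w / a.w1
  map_add' x y := by simp [add_div]
  map_smul' c x := by simp [mul_div_assoc]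

theorem e_apply (δ : Derivation k E E) : a.e δ = δ a.w / a.w1 := rfl

/-- value at `z` of the infinitesimal Möbius transformation -/
def p0 (δ : Derivation k E E) : E := a.e δ - δ a.z
/-- first derivative at `z` of the infinitesimal Möbius transformation -/
def p1 (δ : Derivation k E E) : E := (δ a.w1 - a.w2 * a.e δ) / a.w1
/-- second derivative of the infinitesimal Möbius transformation -/
def p2 (δ : Derivation k E E) : E := (δ a.w2 - a.w3 c0 c1 * a.e δ - 2 * a.w2 * a.p1 δ) / a.w1

/-- The infinitesimal Möbius transformation attached to a derivation: the coefficients of a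
quadratic polynomial. -/
def v : Derivation k E E →ₗ[E] (Fin 3 → E) where
  toFun δ := ![a.p0 δ - a.z * a.p1 δ + a.z ^ 2 * a.p2 c0 c1 δ / 2, a.p1 δ - a.z * a.p2 c0 c1 δ,
    a.p2 c0 c1 δ / 2]
  map_add' x y := by
    ext i; fin_cases i <;> simp [p0, p1, p2] <;> ring
  map_smul' c x := by
    ext i; fin_cases i <;> simp [p0, p1, p2] <;> ring

variable {c0 c1 a} {D δ : Derivation k E E}

theorem der_z (δ : Derivation k E E) :
    δ a.z = a.e δ - (a.v c0 c1 δ 0 + a.v c0 c1 δ 1 * a.z + a.v c0 c1 δ 2 * a.z ^ 2) := by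
  simp [v, p0]; ring

theorem der_w (h : a.w1 ≠ 0) (δ : Derivation k E E) : δ a.w = a.w1 * a.e δ := by
  simp [e]; field_simp

theorem der_w1 (h : a.w1 ≠ 0) (δ : Derivation k E E) :
    δ a.w1 = a.w2 * a.e δ + a.w1 * (a.v c0 c1 δ 1 + 2 * a.v c0 c1 δ 2 * a.z) := by
  have : a.v c0 c1 δ 1 + 2 * a.v c0 c1 δ 2 * a.z = a.p1 δ := by simp [v]; ring
  rw [this, p1]; field_simp; ring

theorem der_w2 (h : a.w1 ≠ 0) (δ : Derivation k E E) :
    δ a.w2 = a.w3 c0 c1 * a.e δ + 2 * a.w2 * (a.v c0 c1 δ 1 + 2 * a.v c0 c1 δ 2 * a.z)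
      + 2 * a.w1 * a.v c0 c1 δ 2 := by
  have : a.v c0 c1 δ 1 + 2 * a.v c0 c1 δ 2 * a.z = a.p1 δ := by simp [v]; ring
  have h2 : 2 * a.v c0 c1 δ 2 = a.p2 c0 c1 δ := by simp [v]; ring
  rw [this, mul_assoc 2 a.w1, mul_left_comm 2 a.w1, h2, p2]; field_simp; ring

theorem v_unique (h : a.w1 ≠ 0) {e : E} {p : Fin 3 → E} (hw : δ a.w = a.w1 * e)
    (hz : δ a.z = e - (p 0 + p 1 * a.z + p 2 * a.z ^ 2))
    (h1 : δ a.w1 = a.w2 * e + a.w1 * (p 1 + 2 * p 2 * a.z))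
    (h2 : δ a.w2 = a.w3 c0 c1 * e + 2 * a.w2 * (p 1 + 2 * p 2 * a.z) + 2 * a.w1 * p 2) :
    a.e δ = e ∧ a.v c0 c1 δ = p := by
  have he : a.e δ = e := by rw [e_apply, hw]; field_simp
  have hp1 : a.p1 δ = p 1 + 2 * p 2 * a.z := by rw [p1, he, h1]; field_simp; ring
  have hp2 : a.p2 c0 c1 δ = 2 * p 2 := by rw [p2, he, hp1, h2]; field_simp; ring
  refine ⟨he, ?_⟩
  ext i; fin_cases i <;> simp [v, p0, hp1, hp2, he, hz] <;> ring

theorem v_self (h : IsDatum c0 c1 D a) : a.e D = D a.z ∧ a.v c0 c1 D = 0 := by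
  apply v_unique h.w1_ne
  · exact h.dw
  · simp
  · simp [h.dw1]
  · simp [h.dw2]

end Datum

/-- The bracket of quadratic vector fields. -/
def qbr (p q : Fin 3 → E) : Fin 3 → E :=
  ![p 0 * q 1 - p 1 * q 0, 2 * (p 0 * q 2 - p 2 * q 0), p 1 * q 2 - p 2 * q 1]

theorem Datum.der_w3 {c0 c1 : E} {a : Datum E} (h : a.w1 ≠ 0) (hw0 : a.w ≠ c0) (hw1 : a.w ≠ c1)
    (δ : Derivation k E E) (hc0 : δ c0 = 0) (hc1 : δ c1 = 0) :
    δ (a.w3 c0 c1) = (3 * a.w2 / a.w1 * a.w3 c0 c1 - 3 / 2 * a.w2 ^ 3 / a.w1 ^ 2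
        - schwR' c0 c1 a.w * a.w1 ^ 4 - 3 * schwR c0 c1 a.w * a.w1 ^ 2 * a.w2) * a.e δ
      + 3 * a.w3 c0 c1 * (a.v c0 c1 δ 1 + 2 * a.v c0 c1 δ 2 * a.z)
      + 6 * a.w2 * a.v c0 c1 δ 2 := by
  have hh : δ (a.w3 c0 c1) = 3 * a.w2 / a.w1 * δ a.w2 - 3 / 2 * a.w2 ^ 2 / a.w1 ^ 2 * δ a.w1
      - schwR' c0 c1 a.w * δ a.w * a.w1 ^ 3 - 3 * schwR c0 c1 a.w * a.w1 ^ 2 * δ a.w1 := by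
    rw [Datum.w3, map_sub, der_div δ _ h, der_mul δ (schwR c0 c1 a.w),
      der_schwR δ hc0 hc1 hw0 hw1, der_mul, der_pow, der_pow, der_div δ _ two_ne_zero]
    simp only [der_ofNat]
    field_simp
    ring
  rw [hh, Datum.der_w2 h, Datum.der_w1 (c0 := c0) (c1 := c1) h, Datum.der_w h]
  simp only [Datum.w3]
  field_simp
  ring

theorem Datum.v_lie {c0 c1 : k} {a : Datum E} (h : a.w1 ≠ 0)
    (hw0 : a.w ≠ algebraMap k E c0) (hw1 : a.w ≠ algebraMap k E c1) (δ ε : Derivation k E E) :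
    a.v (algebraMap k E c0) (algebraMap k E c1) ⁅δ, ε⁆ =
      (fun i => δ (a.v (algebraMap k E c0) (algebraMap k E c1) ε i)) -
      (fun i => ε (a.v (algebraMap k E c0) (algebraMap k E c1) δ i)) -
      qbr (a.v (algebraMap k E c0) (algebraMap k E c1) δ)
        (a.v (algebraMap k E c0) (algebraMap k E c1) ε) := by
  set d0 := algebraMap k E c0
  set d1 := algebraMap k E c1
  have k0 (δ : Derivation k E E) : δ d0 = 0 := δ.map_algebraMap _
  have k1 (δ : Derivation k E E) : δ d1 = 0 := δ.map_algebraMap _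
  have z1 := der_z (a := a) (c0 := d0) (c1 := d1) δ
  have z2 := der_z (a := a) (c0 := d0) (c1 := d1) ε
  have x1 := der_w h δ
  have x2 := der_w h ε
  have y1 := der_w1 h δ (c0 := d0) (c1 := d1)
  have y2 := der_w1 h ε (c0 := d0) (c1 := d1)
  have u1 := der_w2 h δ (c0 := d0) (c1 := d1)
  have u2 := der_w2 h ε (c0 := d0) (c1 := d1)
  have t1 := der_w3 h hw0 hw1 δ (k0 δ) (k1 δ)
  have t2 := der_w3 h hw0 hw1 ε (k0 ε) (k1 ε)
  generalize a.v d0 d1 δ = p at *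
  generalize a.v d0 d1 ε = q at *
  generalize a.e δ = f at *
  generalize a.e ε = g at *
  refine (v_unique h (e := δ g - ε f + f * (-(q 1 + 2 * q 2 * a.z)) + g * (p 1 + 2 * p 2 * a.z))
    ?_ ?_ ?_ ?_).2
  · rw [Derivation.commutator_apply, x1, x2, der_mul, der_mul, y1, y2]; ring
  · rw [Derivation.commutator_apply, z1, z2]
    simp only [map_sub, map_add, der_mul, der_pow, z1, z2, qbr, Pi.sub_apply, Matrix.cons_val]
    ring
  · rw [Derivation.commutator_apply, y1, y2]
    simp only [map_add, der_mul, der_ofNat, z1, z2, y1, y2, u1, u2, qbr, Pi.sub_apply,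
      Matrix.cons_val]
    ring
  · rw [Derivation.commutator_apply, u1, u2]
    simp only [map_add, der_mul, der_ofNat, z1, z2, y1, y2, u1, u2, t1, t2, qbr, Pi.sub_apply,
      Matrix.cons_val]
    ring

end datum

section moebius
variable {k E : Type*} [Field k] [Field E] [Algebra k E] [CharZero E]

theorem schw_smul_add (D : Derivation k E E) {x α β : E} (hα : α ≠ 0) (h1 : D α = 0)
    (h2 : D β = 0) : schw D (α * x + β) = schw D x := by
  have e1 : D (α * x + β) = α * D x := by simp [h1, h2]
  have e2 : D (α * D x) = α * D (D x) := by simp [h1]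
  have e3 : D (α * D (D x)) = α * D (D (D x)) := by simp [h1]
  rw [schw, schw, e1, e2, e3, mul_div_mul_left _ _ hα, mul_div_mul_left _ _ hα]

theorem schw_inv (D : Derivation k E E) {x : E} (hx : D x ≠ 0) :
    schw D (-x⁻¹) = schw D x := by
  have x0 : x ≠ 0 := by rintro rfl; simp at hx
  have e1 : D (-x⁻¹) = D x / x ^ 2 := by simp [der_inv, neg_div]
  have e2 : D (D x / x ^ 2) = D (D x) / x ^ 2 - 2 * (D x) ^ 2 / x ^ 3 := by
    rw [der_div _ _ (by positivity), der_pow]; field_simp; ring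
  have e3 : D (D (D x) / x ^ 2 - 2 * (D x) ^ 2 / x ^ 3) =
      D (D (D x)) / x ^ 2 - 6 * D x * D (D x) / x ^ 3 + 6 * (D x) ^ 3 / x ^ 4 := by
    rw [map_sub, der_div _ _ (by positivity), der_div _ _ (by positivity), der_mul, der_pow,
      der_pow, der_pow, der_ofNat]; field_simp; ring
  rw [schw, schw, e1, e2, e3]; field_simp; ring

theorem IsDatum.schw_z {c0 c1 : E} {D : Derivation k E E} {a : Datum E} (h : IsDatum c0 c1 D a) :
    schw D a.z = schw D a.w + schwR c0 c1 a.w * (D a.w) ^ 2 := by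
  have hz := h.dz_ne
  have hw := h.w1_ne
  have e1 := h.dw
  have e2 : D (D a.w) = a.w2 * (D a.z) ^ 2 + a.w1 * D (D a.z) := by
    rw [e1, der_mul, h.dw1]; ring
  have e3 : D (D (D a.w)) = a.w3 c0 c1 * (D a.z) ^ 3 + 3 * a.w2 * D a.z * D (D a.z)
      + a.w1 * D (D (D a.z)) := by
    rw [e2, map_add, der_mul, der_mul, der_pow, h.dw1, h.dw2]; ring
  rw [schw, schw, e3, e2, e1, Datum.w3]; field_simp; ring

namespace Datum
variable {c0 c1 : E} {a : Datum E}

/-- Affine change of the coordinate `z`. -/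
def aff (a : Datum E) (α β : E) : Datum E := ⟨α * a.z + β, a.w, a.w1 / α, a.w2 / α ^ 2⟩

theorem aff_w3 {α β : E} (hα : α ≠ 0) (h : a.w1 ≠ 0) :
    (a.aff α β).w3 c0 c1 = a.w3 c0 c1 / α ^ 3 := by
  simp only [w3, aff]; field_simp

theorem aff_v {α β : E} (hα : α ≠ 0) (h : a.w1 ≠ 0) (δ : Derivation k E E) (h1 : δ α = 0)
    (h2 : δ β = 0) : (a.aff α β).e δ = α * a.e δ ∧ (a.aff α β).v c0 c1 δ =
      ![α * a.v c0 c1 δ 0 - β * a.v c0 c1 δ 1 + β ^ 2 / α * a.v c0 c1 δ 2,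
        a.v c0 c1 δ 1 - 2 * β / α * a.v c0 c1 δ 2, a.v c0 c1 δ 2 / α] := by
  have z1 := der_z (a := a) (c0 := c0) (c1 := c1) δ
  have x1 := der_w h δ
  have y1 := der_w1 h δ (c0 := c0) (c1 := c1)
  have u1 := der_w2 h δ (c0 := c0) (c1 := c1)
  apply v_unique
  · simp [aff, h, hα]
  · simp only [aff, x1]; field_simp
  · simp only [aff, map_add, der_mul, h1, h2, z1, Matrix.cons_val]; field_simp; ring
  · simp only [aff, der_div _ _ hα, h1, y1, Matrix.cons_val]; field_simp; ring
  · simp only [aff_w3 hα h, Matrix.cons_val]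
    simp only [aff, der_div _ _ (pow_ne_zero 2 hα), der_pow, h1, u1]; field_simp; ring

theorem aff_isDatum {α β : E} (hα : α ≠ 0) {D : Derivation k E E} (h : IsDatum c0 c1 D a)
    (h1 : D α = 0) (h2 : D β = 0) : IsDatum c0 c1 D (a.aff α β) := by
  obtain ⟨b1, b2, b3, b4, b5, b6, b7⟩ := h
  have hz : D (α * a.z + β) = α * D a.z := by simp [h1, h2]
  refine ⟨?_, ?_, ?_, ?_, by simp [aff, b5, hα], b6, b7⟩
  · simp only [aff, b1, hz]; field_simp
  · simp only [aff, hz, der_div _ _ hα, b2, h1]; field_simp; ring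
  · rw [aff_w3 hα b5]
    simp only [aff, hz, der_div _ _ (pow_ne_zero 2 hα), b3, der_pow, h1]; field_simp; ring
  · simp only [aff, hz]; exact mul_ne_zero hα b4

/-- Inversion of the coordinate `z` at `r`. -/
def inv (a : Datum E) (r : E) : Datum E :=
  ⟨-(a.z - r)⁻¹, a.w, a.w1 * (a.z - r) ^ 2, a.w2 * (a.z - r) ^ 4 + 2 * a.w1 * (a.z - r) ^ 3⟩

theorem inv_w3 {r : E} (hr : a.z ≠ r) (h : a.w1 ≠ 0) :
    (a.inv r).w3 c0 c1 = a.w3 c0 c1 * (a.z - r) ^ 6 + 6 * a.w2 * (a.z - r) ^ 5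
      + 6 * a.w1 * (a.z - r) ^ 4 := by
  have := sub_ne_zero.2 hr
  simp only [w3, inv]; field_simp; ring

theorem inv_v {r : E} (hr : a.z ≠ r) (h : a.w1 ≠ 0) (δ : Derivation k E E) (h1 : δ r = 0) :
    (a.inv r).e δ = a.e δ / (a.z - r) ^ 2 ∧ (a.inv r).v c0 c1 δ =
      ![a.v c0 c1 δ 2, -(a.v c0 c1 δ 1 + 2 * r * a.v c0 c1 δ 2),
        a.v c0 c1 δ 0 + r * a.v c0 c1 δ 1 + r ^ 2 * a.v c0 c1 δ 2] := by
  have z1 := der_z (a := a) (c0 := c0) (c1 := c1) δ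
  have x1 := der_w h δ
  have y1 := der_w1 h δ (c0 := c0) (c1 := c1)
  have u1 := der_w2 h δ (c0 := c0) (c1 := c1)
  have hr' := sub_ne_zero.2 hr
  apply v_unique
  · simp [inv, h, hr']
  · simp only [inv, x1]; field_simp
  · simp only [inv, map_neg, der_inv, map_sub, h1, z1, Matrix.cons_val]; field_simp; ring
  · simp only [inv, der_mul, der_pow, map_sub, h1, y1, z1, Matrix.cons_val]; field_simp; ring
  · simp only [inv_w3 hr h, Matrix.cons_val]
    simp only [inv, map_add, der_mul, der_pow, map_sub, der_ofNat, h1, u1, y1, z1]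
    field_simp; push_cast; ring

theorem inv_isDatum {r : E} (hr : a.z ≠ r) {D : Derivation k E E} (h : IsDatum c0 c1 D a)
    (h1 : D r = 0) : IsDatum c0 c1 D (a.inv r) := by
  obtain ⟨b1, b2, b3, b4, b5, b6, b7⟩ := h
  have hr' := sub_ne_zero.2 hr
  have hz : D (-(a.z - r)⁻¹) = D a.z / (a.z - r) ^ 2 := by simp [der_inv, h1, neg_div]
  refine ⟨?_, ?_, ?_, ?_, by simp [inv, b5, hr'], b6, b7⟩
  · simp only [inv, b1, hz]; field_simp
  · simp only [inv, hz, der_mul, der_pow, map_sub, b2, h1]; field_simp; ring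
  · rw [inv_w3 hr b5]
    simp only [inv, hz, map_add, der_mul, der_pow, map_sub, der_ofNat, b2, b3, h1]
    field_simp; push_cast; ring
  · simp only [inv, hz]; exact div_ne_zero b4 (pow_ne_zero 2 hr')

end Datum
end moebius

section linalg
variable {k E : Type*} [Field k] [Field E] [Algebra k E] [CharZero E]

/-- A finite-dimensional coordinate subspace stable under a derivation with smallest possible field
of constants is stable under all derivations. -/
theorem der_stable_of_stable {J : Type*} [Finite J] (D : Derivation k E E)
    (hD : ∀ x, D x = 0 → ∀ δ : Derivation k E E, δ x = 0) (V : Submodule E (J → E))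
    (hV : ∀ x ∈ V, (fun j => D (x j)) ∈ V) (δ : Derivation k E E) {x : J → E} (hx : x ∈ V) :
    (fun j => δ (x j)) ∈ V := by
  have key : ∀ n : ℕ, ∀ x ∈ V, x ≠ 0 → (Function.support x).ncard ≤ n → ∃ u ∈ V, ∃ i, u i = 1 ∧
      x i ≠ 0 ∧ (∀ j, D (u j) = 0) ∧ Function.support u ⊆ Function.support x := by
    intro n
    induction n with
    | zero =>
      intro x _ hx0 hn
      exact absurd ((Set.ncard_eq_zero (Set.toFinite _)).1 (Nat.le_zero.1 hn))
        (by simpa [Function.support_eq_empty_iff] using hx0)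
    | succ n ih =>
      intro x hx hx0 hn
      obtain ⟨i, hi⟩ := Function.ne_iff.1 hx0
      let u : J → E := (x i)⁻¹ • x
      have hu : u ∈ V := V.smul_mem _ hx
      have hi' : x i ≠ 0 := hi
      have hui : u i = 1 := by simp [u, hi']
      have hus : Function.support u ⊆ Function.support x := by
        intro j hj hj'
        exact hj (by simp [u, hj'])
      by_cases hdu : (fun j => D (u j)) = 0
      · exact ⟨u, hu, i, hui, hi', fun j => congrFun hdu j, hus⟩
      · have hs : Function.support (fun j => D (u j)) ⊆ Function.support u := by
          intro j hj hj'
          exact hj (by simp [hj'])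
        have hlt : (Function.support (fun j => D (u j))).ncard <
            (Function.support x).ncard := by
          apply Set.ncard_lt_ncard _ (Set.toFinite _)
          refine (Set.ssubset_iff_of_subset (hs.trans hus)).2 ⟨i, hi, ?_⟩
          simp [hui]
        obtain ⟨u', h1, i', h2, h3, h4, h5⟩ := ih _ (hV u hu) hdu (by omega)
        exact ⟨u', h1, i', h2, fun h => (hs.trans hus) (show D (u i') ≠ 0 from h3) h, h4,
          h5.trans (hs.trans hus)⟩
  have main : ∀ n : ℕ, ∀ x ∈ V, (Function.support x).ncard ≤ n → (fun j => δ (x j)) ∈ V := by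
    intro n
    induction n with
    | zero =>
      intro x _ hn
      have : x = 0 := by
        simpa using (Set.ncard_eq_zero (Set.toFinite _)).1 (Nat.le_zero.1 hn)
      subst this
      have h0 : (fun j => δ ((0 : J → E) j)) = 0 := by ext; simp
      rw [h0]; exact V.zero_mem
    | succ n ih =>
      intro x hx hn
      by_cases hx0 : x = 0
      · subst hx0
        have h0 : (fun j => δ ((0 : J → E) j)) = 0 := by ext; simp
        rw [h0]; exact V.zero_mem
      obtain ⟨u, hu, i, hui, hxi, hdu, hsu⟩ := key _ x hx hx0 le_rfl
      have h1 : (fun j => δ ((x - x i • u) j)) ∈ V := by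
        apply ih _ (V.sub_mem hx (V.smul_mem _ hu))
        have hlt : (Function.support (x - x i • u)).ncard < (Function.support x).ncard := by
          apply Set.ncard_lt_ncard _ (Set.toFinite _)
          refine (Set.ssubset_iff_of_subset ?_).2 ⟨i, hxi, by simp [hui]⟩
          intro j hj hj'
          have : u j = 0 := by
            by_contra h
            exact hsu h hj'
          exact hj (by simp [hj', this])
        omega
      have h2 : (fun j => δ (x j)) = (fun j => δ ((x - x i • u) j)) + δ (x i) • u := by
        ext j
        have := hD _ (hdu j) δ
        simp [this]
        ring
      rw [h2]
      exact V.add_mem h1 (V.smul_mem _ hu)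
  exact main _ x hx le_rfl

/-- `sl₂` is simple. -/
theorem qbr_ideal_eq_top (N : Submodule E (Fin 3 → E)) (h : ∀ y, ∀ q ∈ N, qbr y q ∈ N)
    {q : Fin 3 → E} (hq : q ∈ N) (hq0 : q ≠ 0) : N = ⊤ := by
  have of_const : ∀ c : E, c ≠ 0 → ![c, 0, 0] ∈ N → N = ⊤ := by
    intro c hc h1
    have e0 : ![1, 0, 0] ∈ N := by
      convert! N.smul_mem c⁻¹ h1 using 1
      ext i; fin_cases i <;> simp [hc]
    have e1 := h ![0, 0, 1] _ e0
    have e2 := h ![0, 0, 1] _ e1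
    rw [eq_top_iff]
    rintro x -
    have : x = x 0 • ![1, 0, 0] + (-x 1 / 2) • qbr ![0, 0, 1] ![1, 0, 0]
        + (x 2 / 2) • qbr ![0, 0, 1] (qbr ![0, 0, 1] ![1, 0, 0]) := by
      ext i; fin_cases i <;> simp [qbr]
    rw [this]
    exact N.add_mem (N.add_mem (N.smul_mem _ e0) (N.smul_mem _ e1)) (N.smul_mem _ e2)
  have g1 := h ![1, 0, 0] q hq
  have g2 := h ![1, 0, 0] _ g1
  by_cases h2 : q 2 = 0
  · by_cases h1 : q 1 = 0
    · refine of_const (q 0) (fun h0 => hq0 ?_) ?_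
      · ext i; fin_cases i <;> simp [*]
      · convert! hq using 1
        ext i; fin_cases i <;> simp [*]
    · refine of_const (q 1) h1 ?_
      convert! g1 using 1
      ext i; fin_cases i <;> simp [*, qbr]
  · refine of_const (2 * q 2) (by simp [h2]) ?_
    convert! g2 using 1
    ext i; fin_cases i <;> simp [qbr]

variable {I : Type*} (V : Submodule E (I → Fin 3 → E))

theorem lie_pair_dichotomy (hbr : ∀ x ∈ V, ∀ y ∈ V, (fun i => qbr (x i) (y i)) ∈ V)
    (hs : ∀ a p, ∃ x ∈ V, x a = p) (a b : I)
    (h : ¬ ∀ p q, ∃ x ∈ V, x a = p ∧ x b = q) : ∀ x ∈ V, x a = 0 → x b = 0 := by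
  intro x hx hxa
  by_contra hxb
  apply h
  let N : Submodule E (Fin 3 → E) :=
    (V ⊓ LinearMap.ker (LinearMap.proj a : (I → Fin 3 → E) →ₗ[E] _)).map (LinearMap.proj b)
  have hN : N = ⊤ := by
    refine qbr_ideal_eq_top N ?_ (q := x b) ⟨x, ⟨hx, hxa⟩, rfl⟩ hxb
    rintro y _ ⟨q, ⟨hq, hqa⟩, rfl⟩
    obtain ⟨z, hz, hzy⟩ := hs b y
    refine ⟨fun i => qbr (z i) (q i), ⟨hbr z hz q hq, ?_⟩, ?_⟩
    · have : q a = 0 := hqa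
      change qbr (z a) (q a) = 0
      rw [this]
      ext i; fin_cases i <;> simp [qbr]
    · change qbr (z b) (q b) = qbr y (q b)
      rw [hzy]
  intro p q
  obtain ⟨z, hz, hza⟩ := hs a p
  have : q - z b ∈ N := by rw [hN]; trivial
  obtain ⟨t, ⟨ht, hta⟩, htb⟩ := this
  have hta' : t a = 0 := hta
  have htb' : t b = q - z b := htb
  exact ⟨z + t, V.add_mem hz ht, by simp [hza, hta'], by simp [htb']⟩

theorem lie_eq_top [Finite I] (hbr : ∀ x ∈ V, ∀ y ∈ V, (fun i => qbr (x i) (y i)) ∈ V)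
    (hs : ∀ a p, ∃ x ∈ V, x a = p)
    (hp : ∀ a b, a ≠ b → ∀ p q, ∃ x ∈ V, x a = p ∧ x b = q) : V = ⊤ := by
  classical
  have key : ∀ S : Finset I, ∀ a ∉ S, ∀ p, ∃ x ∈ V, x a = p ∧ ∀ b ∈ S, x b = 0 := by
    intro S
    induction S using Finset.induction_on with
    | empty =>
      intro a _ p
      obtain ⟨x, hx, h⟩ := hs a p
      exact ⟨x, hx, h, by simp⟩
    | insert b S hb ih =>
      intro a ha p
      rw [Finset.mem_insert, not_or] at ha
      have hbrk : ∀ p q, ∃ x ∈ V, x a = qbr p q ∧ ∀ b' ∈ insert b S, x b' = 0 := by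
        intro p q
        obtain ⟨x, hx, hxa, hxS⟩ := ih a ha.2 p
        obtain ⟨y, hy, hya, hyb⟩ := hp a b ha.1 q 0
        refine ⟨fun i => qbr (x i) (y i), hbr x hx y hy, by beta_reduce; rw [hxa, hya], ?_⟩
        intro b' hb'
        rcases Finset.mem_insert.1 hb' with rfl | hb'
        · beta_reduce; rw [hyb]; ext i; fin_cases i <;> simp [qbr]
        · beta_reduce; rw [hxS b' hb']; ext i; fin_cases i <;> simp [qbr]
      obtain ⟨x0, hx0, h0, h0'⟩ := hbrk ![1, 0, 0] ![0, 1, 0]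
      obtain ⟨x1, hx1, h1, h1'⟩ := hbrk ![1, 0, 0] ![0, 0, 1]
      obtain ⟨x2, hx2, h2, h2'⟩ := hbrk ![0, 1, 0] ![0, 0, 1]
      refine ⟨p 0 • x0 + (p 1 / 2) • x1 + p 2 • x2, V.add_mem (V.add_mem (V.smul_mem _ hx0)
        (V.smul_mem _ hx1)) (V.smul_mem _ hx2), ?_, ?_⟩
      · simp only [Pi.add_apply, Pi.smul_apply, h0, h1, h2]
        ext i; fin_cases i <;> simp [qbr]
      · intro b' hb'
        simp [h0' b' hb', h1' b' hb', h2' b' hb']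
  rw [eq_top_iff]
  rintro x -
  cases nonempty_fintype I
  choose y hy hya hy0 using fun a : I => key (Finset.univ.erase a) a (by simp) (x a)
  have : x = ∑ a, y a := by
    ext b i
    rw [Finset.sum_apply, Finset.sum_eq_single b]
    · rw [hya]
    · intro a _ hab
      exact hy0 a b (by simp [hab.symm])
    · simp
  rw [this]
  exact V.sum_mem fun a _ => hy a

end linalg

section place
open WithZero
variable {κ L : Type*} [Field κ] [Field L] [Algebra κ L] [CharZero L]

/-- A discrete valuation trivial on `κ`, with residue field `κ` and uniformizer `s`. -/
structure IsPlace (κ : Type*) {L : Type*} [Field κ] [Field L] [Algebra κ L]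
    (v : Valuation L ℤᵐ⁰) (s : L) : Prop where
  unif : v s = exp (-1)
  const : ∀ c : κ, c ≠ 0 → v (algebraMap κ L c) = 1
  digit : ∀ f, v f ≤ 1 → ∃ c : κ, v (f - algebraMap κ L c) < 1

theorem exists_isPlace_of_pid [IsAlgClosed κ] (A K : Type*) [CommRing A] [IsDomain A]
    [IsPrincipalIdealRing A] [Field K] [Algebra A K] [IsFractionRing A K] [Algebra A L]
    [Algebra K L] [IsScalarTower A K L] [FiniteDimensional K L] [CharZero K]
    [Algebra κ A] [IsScalarTower κ A L] (t : A) (ht0 : t ≠ 0) (ht : ¬ IsUnit t)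
    (hA : ∀ a : A, ∃ (c : κ) (b : A), a = algebraMap κ A c + t * b)
    (hder : ∀ (δ : Derivation κ L L) (a : A), ∃ b : A,
      δ (algebraMap A L a) = algebraMap A L b * δ (algebraMap A L t)) :
    ∃ (v : Valuation L ℤᵐ⁰) (s : L), IsPlace κ v s ∧ v (algebraMap A L t) < 1 ∧
      ∀ δ : Derivation κ L L, ∃ M : ℤᵐ⁰, ∀ f, v f ≤ 1 → v (δ f) ≤ M := by
  have hinj : Function.Injective (algebraMap A L) := by
    rw [IsScalarTower.algebraMap_eq A K L]
    exact (algebraMap K L).injective.comp (IsFractionRing.injective A K)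
  let B := integralClosure A L
  have : IsDedekindDomain B := integralClosure.isDedekindDomain A K L
  have : IsFractionRing B L := integralClosure.isFractionRing_of_finite_extension K L
  have hBfin : Module.Finite A B := IsIntegralClosure.finite A K L B
  have hBinj : Function.Injective (algebraMap A B) := by
    intro a b h
    exact hinj (congrArg (algebraMap B L) h)
  have hnu : ¬ IsUnit (algebraMap A B t) := by
    intro hu
    exact ht (((algebraMap_isIntegral_iff.2 (inferInstance : Algebra.IsIntegral A B)).isLocalHom
      hBinj).map_nonunit _ hu)
  obtain ⟨P, hPmax, hPt⟩ := exists_max_ideal_of_mem_nonunits (a := algebraMap A B t) hnu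
  have hPne : P ≠ ⊥ := by
    rintro rfl
    exact ht0 (hBinj (by simpa using hPt))
  let w : IsDedekindDomain.HeightOneSpectrum B := ⟨P, hPmax.isPrime, hPne⟩
  let v := w.valuation L
  obtain ⟨s, hs⟩ := w.valuation_exists_uniformizer L
  have hmem : ∀ b : B, v (algebraMap B L b) < 1 ↔ b ∈ P := fun b => w.valuation_lt_one_iff_mem b
  have hunit : ∀ b : B, b ∉ P → v (algebraMap B L b) = 1 := fun b hb =>
    (w.valuation_eq_one_iff_notMem (K := L)).2 hb
  have hle : ∀ b : B, v (algebraMap B L b) ≤ 1 := fun b => w.valuation_le_one b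
  have hconst : ∀ c : κ, c ≠ 0 → v (algebraMap κ L c) = 1 := by
    intro c hc
    have h1 : IsUnit (algebraMap A B (algebraMap κ A c)) := by
      have : IsUnit c := isUnit_iff_ne_zero.2 hc
      exact (this.map _).map _
    rw [IsScalarTower.algebraMap_apply κ A L, IsScalarTower.algebraMap_apply A B L]
    exact hunit _ fun h => hPmax.ne_top (Ideal.eq_top_of_isUnit_mem _ h h1)
  have hres : ∀ b : B, ∃ c : κ, b - algebraMap A B (algebraMap κ A c) ∈ P := by
    intro b
    have : IsDomain (B ⧸ P) := Ideal.Quotient.isDomain P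
    have : Nontrivial (B ⧸ P) := Ideal.Quotient.nontrivial_iff.2 hPmax.ne_top
    let φ : κ →+* B ⧸ P := (Ideal.Quotient.mk P).comp ((algebraMap A B).comp (algebraMap κ A))
    have hφ : ∀ a : A, ∃ c : κ, φ c = Ideal.Quotient.mk P (algebraMap A B a) := by
      intro a
      obtain ⟨c, a', rfl⟩ := hA a
      refine ⟨c, ?_⟩
      have : Ideal.Quotient.mk P (algebraMap A B t) = 0 := Ideal.Quotient.eq_zero_iff_mem.2 hPt
      simp [φ, this]
    obtain ⟨f, hf, hfb⟩ := (Algebra.IsIntegral.isIntegral (R := A) b)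
    have hlift : f.map ((Ideal.Quotient.mk P).comp (algebraMap A B)) ∈ Polynomial.lifts φ := by
      rw [Polynomial.lifts_iff_coeff_lifts]
      intro n
      obtain ⟨c, hc⟩ := hφ (f.coeff n)
      exact ⟨c, by simpa using hc⟩
    obtain ⟨q, hq, -, hqm⟩ := Polynomial.lifts_and_degree_eq_and_monic hlift (hf.map _)
    have h_integral : φ.IsIntegralElem (Ideal.Quotient.mk P b) := by
      refine ⟨q, hqm, ?_⟩
      rw [← Polynomial.eval_map, hq, Polynomial.eval_map, ← Polynomial.hom_eval₂, hfb, map_zero]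
    let _ := φ.toAlgebra
    have h_integral' : IsIntegral κ (Ideal.Quotient.mk P b) := h_integral
    have hdeg := (IsAlgClosed.degree_eq_one_of_irreducible κ (minpoly.irreducible h_integral'))
    obtain ⟨c, hc⟩ := minpoly.mem_range_of_degree_eq_one κ _ hdeg
    refine ⟨c, ?_⟩
    rw [← Ideal.Quotient.eq_zero_iff_mem, map_sub, ← hc]
    simp [φ, RingHom.algebraMap_toAlgebra]
  refine ⟨v, s, ⟨hs, hconst, ?_⟩, ?_, ?_⟩
  · intro f hf
    obtain ⟨n, ⟨d, hd⟩, hnd⟩ := w.exists_primeCompl_mul_eq_of_integer f hf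
    have hd' : d ∉ P := hd
    obtain ⟨cn, hn⟩ := hres n
    obtain ⟨cd, hcd⟩ := hres d
    have hcd0 : cd ≠ 0 := by
      rintro rfl
      exact hd' (by simpa using hcd)
    refine ⟨cn / cd, ?_⟩
    have h1 := (hmem _).2 hn
    have h2 := (hmem _).2 hcd
    have hv1 : v (algebraMap κ L cd) = 1 := hconst cd hcd0
    have hvd : v (algebraMap B L d) = 1 := hunit d hd'
    have hkey : (f - algebraMap κ L (cn / cd)) * (algebraMap B L d * algebraMap κ L cd) =
        algebraMap B L (n - algebraMap A B (algebraMap κ A cn)) * algebraMap κ L cd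
        - algebraMap κ L cn * algebraMap B L (d - algebraMap A B (algebraMap κ A cd)) := by
      have hcd1 : algebraMap κ L cd ≠ 0 := by simpa using hcd0
      have e1 : ∀ c : κ, algebraMap B L (algebraMap A B (algebraMap κ A c)) = algebraMap κ L c := by
        intro c
        rw [IsScalarTower.algebraMap_apply κ A L, IsScalarTower.algebraMap_apply A B L]
      have hnd' : f * algebraMap B L d = algebraMap B L n := hnd
      rw [map_sub, map_sub, e1, e1, map_div₀, ← hnd']
      field_simp
      ring
    have hlt : v (algebraMap B L (n - algebraMap A B (algebraMap κ A cn)) * algebraMap κ L cd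
        - algebraMap κ L cn * algebraMap B L (d - algebraMap A B (algebraMap κ A cd))) < 1 := by
      refine v.map_sub_lt (by rw [map_mul, hv1, mul_one]; exact h1) ?_
      rw [map_mul]
      by_cases h : cn = 0
      · simp [h]
      · rw [hconst _ h, one_mul]; exact h2
    rw [← hkey, map_mul, map_mul, hvd, hv1, mul_one, mul_one] at hlt
    exact hlt
  · rw [IsScalarTower.algebraMap_apply A B L]
    exact (hmem _).2 hPt
  · intro δ
    obtain ⟨S, hS⟩ := hBfin.fg_top
    classical
    let M : ℤᵐ⁰ := (S.sup fun b => v (δ (algebraMap B L b))) ⊔ v (δ (algebraMap A L t))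
    have hAv : ∀ a : A, v (algebraMap A L a) ≤ 1 := by
      intro a
      rw [IsScalarTower.algebraMap_apply A B L]
      exact hle _
    have hM : ∀ b : B, v (δ (algebraMap B L b)) ≤ M := by
      intro b
      have hb : b ∈ Submodule.span A (S : Set B) := by rw [hS]; trivial
      induction hb using Submodule.span_induction with
      | mem x hx =>
        exact le_sup_of_le_left (Finset.le_sup (f := fun b => v (δ (algebraMap B L b))) hx)
      | zero => simp
      | add x y _ _ hx hy => rw [map_add, map_add]; exact v.map_add_le hx hy
      | smul a x _ hx =>
        rw [Algebra.smul_def, map_mul, der_mul, ← IsScalarTower.algebraMap_apply A B L]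
        refine v.map_add_le ?_ ?_
        · rw [map_mul]
          calc _ ≤ 1 * M := mul_le_mul' (hAv a) hx
            _ = M := one_mul _
        · obtain ⟨b, hb⟩ := hder δ a
          rw [hb, map_mul, map_mul]
          calc _ ≤ 1 * (1 * M) := mul_le_mul' (hle x) (mul_le_mul' (hAv b) le_sup_right)
            _ = M := by simp
    refine ⟨M, fun f hf => ?_⟩
    obtain ⟨n, ⟨d, hd⟩, hnd⟩ := w.exists_primeCompl_mul_eq_of_integer f hf
    have hvd : v (algebraMap B L d) = 1 := hunit d hd
    have hnd' : f * algebraMap B L d = algebraMap B L n := hnd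
    have h1 : δ f * algebraMap B L d = δ (algebraMap B L n) - f * δ (algebraMap B L d) := by
      rw [← hnd', der_mul]; ring
    have h2 : v (δ f) = v (δ f * algebraMap B L d) := by rw [map_mul, hvd, mul_one]
    rw [h2, h1]
    refine v.map_sub_le (hM n) ?_
    rw [map_mul]
    calc _ ≤ 1 * M := mul_le_mul' hf (hM d)
      _ = M := one_mul _

open scoped IntermediateField.algebraAdjoinAdjoin in
theorem exists_isPlace [IsAlgClosed κ] [CharZero κ] (t : L) (ht : Transcendental κ t)
    (hfin : FiniteDimensional (IntermediateField.adjoin κ {t}) L) :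
    ∃ (v : Valuation L ℤᵐ⁰) (s : L), IsPlace κ v s ∧ v t < 1 ∧
      ∀ δ : Derivation κ L L, ∃ M : ℤᵐ⁰, ∀ f, v f ≤ 1 → v (δ f) ≤ M := by
  let t' : Algebra.adjoin κ {t} := ⟨t, Algebra.subset_adjoin (by simp)⟩
  have htr : Transcendental κ t' := by
    intro h
    exact ht (h.algebraMap (A := L))
  have hsurj : Function.Surjective (Polynomial.aeval (R := κ) t') := by
    rintro ⟨a, ha⟩
    have := ha
    rw [Algebra.adjoin_singleton_eq_range_aeval] at this
    obtain ⟨q, hq⟩ := this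
    refine ⟨q, Subtype.ext ?_⟩
    exact (Polynomial.aeval_algHom_apply (Algebra.adjoin κ {t}).val t' q).symm.trans hq
  have hPID : IsPrincipalIdealRing (Algebra.adjoin κ {t}) :=
    IsPrincipalIdealRing.of_surjective (Polynomial.aeval (R := κ) t').toRingHom hsurj
  have : CharZero (IntermediateField.adjoin κ {t}) :=
    charZero_of_injective_algebraMap (algebraMap κ (IntermediateField.adjoin κ {t})).injective
  refine exists_isPlace_of_pid (Algebra.adjoin κ {t}) (IntermediateField.adjoin κ {t}) t' ?_ ?_
    ?_ ?_
  · intro h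
    exact htr (h ▸ isAlgebraic_zero)
  · intro h
    obtain ⟨b, hb⟩ := h.exists_right_inv
    obtain ⟨q, rfl⟩ := hsurj b
    have h1 : Polynomial.aeval t' (Polynomial.X * q - 1) = 0 := by simp [hb]
    have h2 : Polynomial.X * q - 1 = 0 := by
      by_contra h
      exact htr ⟨_, h, h1⟩
    have := congrArg (Polynomial.eval 0) h2
    simp at this
  · intro a
    obtain ⟨q, rfl⟩ := hsurj a
    refine ⟨q.coeff 0, Polynomial.aeval t' q.divX, ?_⟩
    have := congrArg (Polynomial.aeval t') (Polynomial.divX_mul_X_add q)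
    simp only [map_add, map_mul, Polynomial.aeval_X, Polynomial.aeval_C] at this
    rw [← this]; ring
  · intro δ a
    obtain ⟨q, rfl⟩ := hsurj a
    refine ⟨Polynomial.aeval t' (Polynomial.derivative q), ?_⟩
    have e : ∀ q : Polynomial κ, algebraMap (Algebra.adjoin κ {t}) L (Polynomial.aeval t' q) =
        Polynomial.aeval t q :=
      fun q => (Polynomial.aeval_algHom_apply (Algebra.adjoin κ {t}).val t' q).symm
    rw [e, e, δ.map_aeval]
    rfl

/-- A place together with the derivation with respect to a uniformizer. -/
structure IsDPlace (D : Derivation κ L L) (v : Valuation L ℤᵐ⁰) (s : L) : Prop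
    extends IsPlace κ v s where
  der_unif : D s = 1
  der_le : ∀ f, v f ≤ 1 → v (D f) ≤ 1

theorem IsPlace.unif_ne_zero {v : Valuation L ℤᵐ⁰} {s : L} (h : IsPlace κ v s) : s ≠ 0 := by
  rintro rfl
  have := h.unif
  rw [map_zero] at this
  exact exp_ne_zero this.symm

theorem IsPlace.exists_eq {v : Valuation L ℤᵐ⁰} {s : L} (h : IsPlace κ v s) {f : L}
    (hf : v f ≤ 1) : ∃ (c : κ) (g : L), v g ≤ 1 ∧ f = algebraMap κ L c + s * g := by
  obtain ⟨c, hc⟩ := h.digit f hf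
  have hs : s ≠ 0 := h.unif_ne_zero
  refine ⟨c, (f - algebraMap κ L c) / s, ?_, by field_simp; ring⟩
  rw [map_div₀, h.unif]
  by_cases h0 : v (f - algebraMap κ L c) = 0
  · simp [h0]
  · rw [div_le_one₀ (by simp), ← WithZero.exp_log h0, WithZero.exp_le_exp]
    have := (WithZero.log_lt_iff_lt_exp h0 (x := v (f - algebraMap κ L c)) (a := 0)).2
      (by simpa using hc)
    omega

theorem exists_isDPlace [IsAlgClosed κ] [CharZero κ] (y : L) (hy : Transcendental κ y)
    (hfin : FiniteDimensional (IntermediateField.adjoin κ {y}) L) :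
    ∃ (D : Derivation κ L L) (v : Valuation L ℤᵐ⁰) (s : L), IsDPlace D v s ∧ 1 < v y := by
  have hy0 : y ≠ 0 := by rintro rfl; exact hy isAlgebraic_zero
  have hty : Transcendental κ y⁻¹ := fun h => hy (by simpa using h.inv)
  have hadj : IntermediateField.adjoin κ {y⁻¹} = IntermediateField.adjoin κ {y} := by
    apply le_antisymm
    · rw [IntermediateField.adjoin_simple_le_iff]
      exact inv_mem (IntermediateField.mem_adjoin_simple_self κ y)
    · rw [IntermediateField.adjoin_simple_le_iff]
      have := inv_mem (IntermediateField.mem_adjoin_simple_self κ y⁻¹)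
      simpa using this
  obtain ⟨v, s, hp, hv, hM⟩ := exists_isPlace y⁻¹ hty (by rw [hadj]; exact hfin)
  have hs0 : s ≠ 0 := hp.unif_ne_zero
  have hs : AlgebraicIndependent κ ![s] := by
    rw [algebraicIndependent_unique_type_iff]
    intro h
    have hi : IsAlgebraic κ s := h
    obtain ⟨c, hc⟩ := minpoly.mem_range_of_degree_eq_one κ s
      (IsAlgClosed.degree_eq_one_of_irreducible κ (minpoly.irreducible hi.isIntegral))
    have h1 := hp.const c (by rintro rfl; simp at hc; exact hs0 hc.symm)
    rw [hc, hp.unif] at h1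
    simp at h1
  obtain ⟨D, hD⟩ := exists_derivation_of_algebraicIndependent hs 1
  have hDs : D s = 1 := by simpa using hD 0
  obtain ⟨M, hM⟩ := hM D
  have key : ∀ n : ℕ, ∀ f, v f ≤ 1 → v (D f) ≤ max 1 (exp (-n : ℤ) * M) := by
    intro n
    induction n with
    | zero => intro f hf; simp [hM f hf]
    | succ n ih =>
      intro f hf
      obtain ⟨c, g, hg, rfl⟩ := hp.exists_eq hf
      rw [map_add, der_algebraMap, zero_add, der_mul, hDs, mul_one]
      refine (v.map_add _ _).trans (max_le ?_ (hg.trans (le_max_left _ _)))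
      rw [map_mul, hp.unif]
      calc exp (-1) * v (D g) ≤ exp (-1) * max 1 (exp (-n : ℤ) * M) := mul_le_mul' le_rfl (ih g hg)
        _ = max (exp (-1)) (exp (-1) * (exp (-n : ℤ) * M)) := by
            rw [mul_max, mul_one]
        _ ≤ _ := by
          refine max_le_max ?_ ?_
          · rw [← exp_zero, exp_le_exp]; norm_num
          · rw [← mul_assoc, ← exp_add]
            apply le_of_eq
            congr 2
            push_cast; ring
  refine ⟨D, v, s, ⟨hp, hDs, fun f hf => ?_⟩, ?_⟩
  · by_cases hM0 : M = 0
    · exact (hM f hf).trans (by simp [hM0])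
    · refine (key (log M).toNat f hf).trans (max_le le_rfl ?_)
      have h2 : exp (-((log M).toNat : ℤ)) * M = exp (-((log M).toNat : ℤ) + log M) := by
        rw [exp_add, exp_log hM0]
      rw [h2, ← exp_zero, exp_le_exp]
      have := Int.self_le_toNat (log M)
      omega
  · rw [map_inv₀] at hv
    exact (inv_lt_one₀ (zero_lt_iff.2 (by simpa using hy0))).1 hv

end place

section
open WithZero

section lead
variable {κ L : Type*} [Field κ] [Field L] [Algebra κ L] [CharZero L]
variable {D : Derivation κ L L} {v : Valuation L ℤᵐ⁰} {s : L}

/-- `f` is `c * s ^ n` up to higher order at the place `v`; the coefficient `c` may vanish. -/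
def Lead (v : Valuation L ℤᵐ⁰) (s : L) (f : L) (n : ℤ) (c : κ) : Prop :=
  ∃ g, v g ≤ 1 ∧ f = s ^ n * (algebraMap κ L c + s * g)

theorem IsPlace.le_const (h : IsPlace κ v s) (c : κ) : v (algebraMap κ L c) ≤ 1 := by
  by_cases hc : c = 0
  · simp [hc]
  · exact (h.const c hc).le

theorem IsPlace.unif_le (h : IsPlace κ v s) : v s ≤ 1 := by
  rw [h.unif, ← exp_zero, exp_le_exp]; norm_num

theorem IsPlace.unif_lt (h : IsPlace κ v s) : v s < 1 := by
  rw [h.unif, ← exp_zero, exp_lt_exp]; norm_num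

theorem IsPlace.unif_mul_lt (h : IsPlace κ v s) {g : L} (hg : v g ≤ 1) : v (s * g) < 1 := by
  rw [map_mul]
  calc v s * v g ≤ v s * 1 := mul_le_mul' le_rfl hg
    _ < 1 := by rw [mul_one]; exact h.unif_lt

theorem IsPlace.unit_of_ne (h : IsPlace κ v s) {c : κ} (hc : c ≠ 0) {g : L} (hg : v g ≤ 1) :
    v (algebraMap κ L c + s * g) = 1 := by
  have h1 := h.const c hc
  rw [v.map_add_eq_of_lt_left (by rw [h1]; exact h.unif_mul_lt hg), h1]

theorem IsPlace.exists_lead (h : IsPlace κ v s) {f : L} (hf : f ≠ 0) :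
    ∃ n c, c ≠ 0 ∧ Lead (κ := κ) v s f n c := by
  have hs := h.unif_ne_zero
  have hv : v f ≠ 0 := by simpa using hf
  have h1 : v (f / s ^ (-log (v f))) = 1 := by
    rw [map_div₀, map_zpow₀, h.unif, ← exp_zsmul]
    simp [exp_log hv, hv]
  obtain ⟨c, g, hg, e⟩ := h.exists_eq h1.le
  refine ⟨-log (v f), c, ?_, g, hg, ?_⟩
  · rintro rfl
    rw [e, map_zero, zero_add] at h1
    exact (h.unif_mul_lt hg).ne h1
  · rw [← e]; field_simp

namespace Lead
variable {f f' : L} {n m : ℤ} {c d : κ}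

theorem mul (h : IsPlace κ v s) (hf : Lead v s f n c) (hf' : Lead v s f' m d) :
    Lead v s (f * f') (n + m) (c * d) := by
  obtain ⟨g, hg, rfl⟩ := hf
  obtain ⟨g', hg', rfl⟩ := hf'
  refine ⟨algebraMap κ L c * g' + algebraMap κ L d * g + s * (g * g'), ?_, ?_⟩
  · refine v.map_add_le (v.map_add_le ?_ ?_) ?_
    · rw [map_mul]; exact mul_le_one' (h.le_const c) hg'
    · rw [map_mul]; exact mul_le_one' (h.le_const d) hg
    · rw [map_mul, map_mul]; exact mul_le_one' h.unif_le (mul_le_one' hg hg')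
  · rw [zpow_add₀ h.unif_ne_zero, map_mul]; ring

theorem add (hf : Lead v s f n c) (hf' : Lead v s f' n d) : Lead v s (f + f') n (c + d) := by
  obtain ⟨g, hg, rfl⟩ := hf
  obtain ⟨g', hg', rfl⟩ := hf'
  exact ⟨g + g', v.map_add_le hg hg', by rw [map_add]; ring⟩

theorem const (c : κ) : Lead v s (algebraMap κ L c) 0 c := ⟨0, by simp, by simp⟩

theorem zero (n : ℤ) : Lead v s (0 : L) n (0 : κ) := ⟨0, by simp, by simp⟩

theorem smul (h : IsPlace κ v s) (a : κ) (hf : Lead v s f n c) :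
    Lead v s (algebraMap κ L a * f) n (a * c) := by
  simpa using (const a).mul h hf

theorem neg (hf : Lead v s f n c) : Lead v s (-f) n (-c) := by
  obtain ⟨g, hg, rfl⟩ := hf
  exact ⟨-g, by simpa using hg, by rw [map_neg]; ring⟩

theorem sub (hf : Lead v s f n c) (hf' : Lead v s f' n d) : Lead v s (f - f') n (c - d) := by
  simpa [sub_eq_add_neg] using hf.add hf'.neg

theorem inv (h : IsPlace κ v s) (hf : Lead v s f n c) (hc : c ≠ 0) :
    Lead v s f⁻¹ (-n) c⁻¹ := by
  obtain ⟨g, hg, rfl⟩ := hf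
  have hs := h.unif_ne_zero
  have hu := h.unit_of_ne hc hg
  have hu0 : algebraMap κ L c + s * g ≠ 0 := by
    intro h0; rw [h0, map_zero] at hu; exact zero_ne_one hu
  have hc' : algebraMap κ L c ≠ 0 := by simpa using hc
  refine ⟨-g / (algebraMap κ L c * (algebraMap κ L c + s * g)), ?_, ?_⟩
  · rw [map_div₀, map_mul, hu, h.const c hc]; simpa using hg
  · rw [map_inv₀, zpow_neg]; field_simp; ring

theorem div (h : IsPlace κ v s) (hf : Lead v s f n c) (hf' : Lead v s f' m d) (hd : d ≠ 0) :
    Lead v s (f / f') (n - m) (c / d) := by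
  simpa [div_eq_mul_inv, sub_eq_add_neg] using hf.mul h (hf'.inv h hd)

theorem pow (h : IsPlace κ v s) (hf : Lead v s f n c) (k : ℕ) :
    Lead v s (f ^ k) (k * n) (c ^ k) := by
  induction k with
  | zero => simpa using const (v := v) (s := s) (1 : κ)
  | succ k ih =>
    have := ih.mul h hf
    rw [pow_succ, pow_succ]
    convert this using 1
    push_cast; ring

theorem weaken (h : IsPlace κ v s) (hf : Lead v s f n c) (hm : m < n) : Lead v s f m (0 : κ) := by
  obtain ⟨g, hg, rfl⟩ := hf
  have hs := h.unif_ne_zero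
  refine ⟨s ^ (n - m - 1).toNat * (algebraMap κ L c + s * g), ?_, ?_⟩
  · rw [map_mul, map_pow]
    exact mul_le_one' (pow_le_one₀ zero_le h.unif_le)
      (v.map_add_le (h.le_const c) (h.unif_mul_lt hg).le)
  · rw [map_zero, zero_add, ← mul_assoc, ← mul_assoc, ← zpow_natCast, ← zpow_add_one₀ hs,
      ← zpow_add₀ hs]
    congr 2
    omega

theorem der (h : IsDPlace D v s) (hf : Lead v s f n c) : Lead v s (D f) (n - 1) (n * c) := by
  obtain ⟨g, hg, rfl⟩ := hf
  have hs := h.unif_ne_zero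
  have e : D (s ^ n) = n * s ^ (n - 1) := by
    rw [Derivation.leibniz_zpow]; simp [h.der_unif]
  refine ⟨n * g + g + s * D g, ?_, ?_⟩
  · refine v.map_add_le (v.map_add_le ?_ hg) (h.unif_mul_lt (h.der_le g hg)).le
    rw [map_mul]
    refine mul_le_one' ?_ hg
    simpa using h.toIsPlace.le_const (n : κ)
  · rw [der_mul, e, map_add, der_algebraMap, der_mul, h.der_unif, map_mul, map_intCast]
    rw [show s ^ n = s ^ (n - 1) * s by rw [← zpow_add_one₀ hs]; simp]
    ring

theorem ne_zero (h : IsPlace κ v s) (hf : Lead v s f n c) (hc : c ≠ 0) : f ≠ 0 := by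
  obtain ⟨g, hg, rfl⟩ := hf
  refine mul_ne_zero (zpow_ne_zero _ h.unif_ne_zero) ?_
  intro h0
  have := h.unit_of_ne hc hg
  rw [h0, map_zero] at this
  exact zero_ne_one this

theorem val (h : IsPlace κ v s) (hf : Lead v s f n c) (hc : c ≠ 0) : v f = exp (-n) := by
  obtain ⟨g, hg, rfl⟩ := hf
  rw [map_mul, h.unit_of_ne hc hg, map_zpow₀, h.unif, ← exp_zsmul]; simp

theorem unique_exp (h : IsPlace κ v s) (hf : Lead v s f n c) (hc : c ≠ 0)
    (hf' : Lead v s f m d) (hd : d ≠ 0) : n = m := by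
  have := (hf.val h hc).symm.trans (hf'.val h hd)
  simpa using this

theorem unique (h : IsPlace κ v s) (hf : Lead v s f n c) (hf' : Lead v s f n d) : c = d := by
  by_contra hne
  have := (hf.sub hf').ne_zero h (sub_ne_zero.2 hne)
  simp at this

end Lead
end lead

end

section
open WithZero

section local_exponents
variable {κ L : Type*} [Field κ] [Field L] [Algebra κ L] [CharZero L] [CharZero κ]
variable {D : Derivation κ L L} {v : Valuation L ℤᵐ⁰} {s : L}

theorem algebraMap_ofNat_eq (n : ℕ) [n.AtLeastTwo] :
    algebraMap κ L ofNat(n) = ofNat(n) := map_ofNat _ _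

theorem Lead.schw (h : IsDPlace D v s) {f : L} {e : ℤ} {c : κ} (hf : Lead v s (D f) (e - 1) c)
    (hc : c ≠ 0) : Lead v s (schw D f) (-2) ((1 - (e : κ) ^ 2) / 2) := by
  have h1 := (hf.der h).div h.toIsPlace hf hc
  have h2 := ((hf.der h).der h).div h.toIsPlace hf hc
  have h3 := h2.sub (by
    have := (h1.pow h.toIsPlace 2).smul h.toIsPlace (3 / 2)
    convert this using 1
    push_cast; ring)
  unfold ModularJPaper.schw
  convert h3 using 1
  · rw [map_div₀, algebraMap_ofNat_eq, algebraMap_ofNat_eq]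
  · ring
  · field_simp
    push_cast; ring

theorem exists_local_parameter (h : IsDPlace D v s) {f : L} (hf : D f ≠ 0) :
    ∃ (a : κ) (e : ℤ) (c : κ), c ≠ 0 ∧ Lead v s (f - algebraMap κ L a) e c ∧
      ((1 ≤ e ∧ ¬ 1 < v f) ∨ (e ≤ -1 ∧ a = 0)) := by
  have hf0 : f ≠ 0 := by rintro rfl; simp at hf
  obtain ⟨n, c, hc, hl⟩ := h.toIsPlace.exists_lead hf0
  by_cases hn : n < 0
  · exact ⟨0, n, c, hc, by simpa using hl, Or.inr ⟨by omega, rfl⟩⟩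
  have hv : v f ≤ 1 := by
    rw [hl.val h.toIsPlace hc, ← exp_zero, exp_le_exp]; omega
  obtain ⟨a, g, hg, e⟩ := h.toIsPlace.exists_eq hv
  have hne : f - algebraMap κ L a ≠ 0 := by
    intro h0
    rw [sub_eq_zero.1 h0, der_algebraMap] at hf
    exact hf rfl
  obtain ⟨m, c', hc', hl'⟩ := h.toIsPlace.exists_lead hne
  refine ⟨a, m, c', hc', hl', Or.inl ⟨?_, not_lt.2 hv⟩⟩
  have h1 := hl'.val h.toIsPlace hc'
  have h2 : v (f - algebraMap κ L a) < 1 := by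
    rw [e, add_sub_cancel_left]; exact h.toIsPlace.unif_mul_lt hg
  rw [h1, ← exp_zero, exp_lt_exp] at h2
  omega

theorem lead_der_of_sub (h : IsDPlace D v s) {f : L} {a : κ} {e : ℤ} {c : κ}
    (hl : Lead v s (f - algebraMap κ L a) e c) : Lead v s (D f) (e - 1) (e * c) := by
  have := hl.der h
  rwa [map_sub, der_algebraMap, sub_zero] at this

theorem exists_schw_eq (h : IsDPlace D v s) {f : L} (hf : D f ≠ 0) :
    ∃ e : ℤ, e ≠ 0 ∧ Lead v s (schw D f) (-2) ((1 - (e : κ) ^ 2) / 2) := by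
  obtain ⟨a, e, c, hc, hl, he⟩ := exists_local_parameter h hf
  have he0 : e ≠ 0 := by omega
  exact ⟨e, he0, (lead_der_of_sub h hl).schw h (mul_ne_zero (by exact_mod_cast he0) hc)⟩

theorem lead_sub_const {w : L} {a : κ} {e : ℤ} {c : κ} (h : IsDPlace D v s)
    (hl : Lead v s (w - algebraMap κ L a) e c) (b : κ)
    (hab : 1 ≤ e ∧ a ≠ b ∨ 1 ≤ e ∧ a = b ∨ e ≤ -1 ∧ a = 0) (hc : c ≠ 0) :
    ∃ (n : ℤ) (d : κ), d ≠ 0 ∧ Lead v s (w - algebraMap κ L b) n d ∧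
      (1 ≤ e ∧ a ≠ b ∧ n = 0 ∨ 1 ≤ e ∧ a = b ∧ n = e ∧ d = c ∨ e ≤ -1 ∧ n = e ∧ d = c) := by
  rcases hab with ⟨he, hab⟩ | ⟨he, rfl⟩ | ⟨he, rfl⟩
  · refine ⟨0, a - b, sub_ne_zero.2 hab, ?_, Or.inl ⟨he, hab, rfl⟩⟩
    have := (hl.weaken h.toIsPlace (m := 0) (by omega)).add (Lead.const (a - b))
    convert this using 1
    · rw [map_sub]; ring
    · simp
  · exact ⟨e, c, hc, hl, Or.inr (Or.inl ⟨he, rfl, rfl, rfl⟩)⟩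
  · refine ⟨e, c, hc, ?_, Or.inr (Or.inr ⟨he, rfl, rfl⟩)⟩
    have := hl.sub ((Lead.const b).weaken h.toIsPlace (m := e) (by omega))
    simpa using this

/-- The local exponent of the Schwarzian equation at a place. -/
theorem exists_local_exponent (h : IsDPlace D v s) {c0 c1 : κ} (h01 : c0 ≠ c1) {w : L}
    (hw : D w ≠ 0) : ∃ (A m : ℕ) (c : κ), c ≠ 0 ∧
      Lead v s (schw D w + schwR (algebraMap κ L c0) (algebraMap κ L c1) w * D w ^ 2) (-2)
        ((1 - ((A : κ) / 6) ^ 2) / 2) ∧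
      Lead v s (D w ^ 6 / ((w - algebraMap κ L c0) ^ 4 * (w - algebraMap κ L c1) ^ 3))
        (A - 6 + m) c ∧ (1 < v w → A = 0 ∧ 1 ≤ m) := by
  have hp := h.toIsPlace
  obtain ⟨a, e, c, hc, hl, he⟩ := exists_local_parameter h hw
  have he0 : (e : κ) ≠ 0 := by
    have : e ≠ 0 := by omega
    exact_mod_cast this
  have hD := lead_der_of_sub h hl
  have hec : (e : κ) * c ≠ 0 := mul_ne_zero he0 hc
  have hS := hD.schw h hec
  obtain ⟨n0, d0, hd0, hl0, k0⟩ := lead_sub_const h hl c0 (by tauto) hc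
  obtain ⟨n1, d1, hd1, hl1, k1⟩ := lead_sub_const h hl c1 (by tauto) hc
  have t0 : Lead v s (4 / (9 * (w - algebraMap κ L c0) ^ 2)) (-2 * n0) (4 / (9 * d0 ^ 2)) := by
    have := (Lead.const (v := v) (s := s) (4 : κ)).div hp ((hl0.pow hp 2).smul hp 9)
      (mul_ne_zero (by norm_num) (pow_ne_zero 2 hd0))
    convert this using 1
    · simp only [algebraMap_ofNat_eq]
    · push_cast; ring
  have t1 : Lead v s (3 / (8 * (w - algebraMap κ L c1) ^ 2)) (-2 * n1) (3 / (8 * d1 ^ 2)) := by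
    have := (Lead.const (v := v) (s := s) (3 : κ)).div hp ((hl1.pow hp 2).smul hp 8)
      (mul_ne_zero (by norm_num) (pow_ne_zero 2 hd1))
    convert this using 1
    · simp only [algebraMap_ofNat_eq]
    · push_cast; ring
  have t2 : Lead v s (23 / (72 * ((w - algebraMap κ L c0) * (w - algebraMap κ L c1)))) (-n0 - n1)
      (23 / (72 * (d0 * d1))) := by
    have := (Lead.const (v := v) (s := s) (23 : κ)).div hp ((hl0.mul hp hl1).smul hp 72)
      (mul_ne_zero (by norm_num) (mul_ne_zero hd0 hd1))
    convert this using 1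
    · simp only [algebraMap_ofNat_eq]
    · ring
  have hq := (hD.pow hp 6).div hp ((hl0.pow hp 4).mul hp (hl1.pow hp 3))
    (mul_ne_zero (pow_ne_zero 4 hd0) (pow_ne_zero 3 hd1))
  have hqc : ((e : κ) * c) ^ 6 / (d0 ^ 4 * d1 ^ 3) ≠ 0 :=
    div_ne_zero (pow_ne_zero _ hec) (mul_ne_zero (pow_ne_zero 4 hd0) (pow_ne_zero 3 hd1))
  have fin : ∀ (n : ℤ) (ρ : κ) (A m : ℕ),
      Lead v s (schwR (algebraMap κ L c0) (algebraMap κ L c1) w) n ρ →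
      n + 2 * (e - 1) = -2 → ρ * (e * c) ^ 2 + (1 - (e : κ) ^ 2) / 2 = (1 - ((A : κ) / 6) ^ 2) / 2 →
      6 * (e - 1) - (4 * n0 + 3 * n1) = A - 6 + m → (1 < v w → A = 0 ∧ 1 ≤ m) →
      ∃ (A m : ℕ) (c : κ), c ≠ 0 ∧
      Lead v s (schw D w + schwR (algebraMap κ L c0) (algebraMap κ L c1) w * D w ^ 2) (-2)
        ((1 - ((A : κ) / 6) ^ 2) / 2) ∧
      Lead v s (D w ^ 6 / ((w - algebraMap κ L c0) ^ 4 * (w - algebraMap κ L c1) ^ 3))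
        (A - 6 + m) c ∧ (1 < v w → A = 0 ∧ 1 ≤ m) := by
    intro n ρ A m hR hn hρ hm hpole
    refine ⟨A, m, _, hqc, ?_, ?_, hpole⟩
    · have := hR.mul hp (hD.pow hp 2)
      push_cast at this
      rw [hn] at this
      rw [← hρ, add_comm (ρ * _)]
      exact hS.add this
    · rw [← hm]; exact_mod_cast hq
  rcases k0 with ⟨he1, hac, hn0⟩ | ⟨he1, hac, hn0, hdc⟩ | ⟨he1, hn0, hdc⟩
  · rcases k1 with ⟨he2, hac1, hn1⟩ | ⟨he2, hac1, hn1, hdc1⟩ | ⟨he2, hn1, hdc1⟩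
    · subst hn0 hn1
      refine fin (-2 * e) 0 (6 * e.toNat) 0 ?_ (by ring) ?_ (by push_cast; omega) ?_
      · exact (((t0.add t1).sub t2).weaken hp (by omega))
      · have : ((e.toNat : ℤ) : κ) = (e : κ) := by rw [Int.toNat_of_nonneg (by omega)]
        push_cast at this ⊢
        rw [this]; field_simp; ring
      · intro hv; exfalso; rcases he with he | he
        · exact he.2 hv
        · omega
    · subst hn0 hn1 hdc1
      refine fin (-2 * n1) (3 / (8 * d1 ^ 2)) (3 * n1.toNat) 0 ?_ (by ring) ?_
          (by push_cast; omega) ?_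
      · have := (((t0.weaken hp (m := -2 * n1) (by omega)).add t1).sub
          (t2.weaken hp (m := -2 * n1) (by omega)))
        simpa [schwR] using this
      · have : ((n1.toNat : ℤ) : κ) = (n1 : κ) := by rw [Int.toNat_of_nonneg (by omega)]
        push_cast at this ⊢
        rw [this]; field_simp; ring
      · intro hv; exfalso; rcases he with he | he
        · exact he.2 hv
        · omega
    · omega
  · rcases k1 with ⟨he2, hac1, hn1⟩ | ⟨he2, hac1, hn1, hdc1⟩ | ⟨he2, hn1, hdc1⟩
    · subst hn0 hn1 hdc
      refine fin (-2 * n0) (4 / (9 * d0 ^ 2)) (2 * n0.toNat) 0 ?_ (by ring) ?_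
          (by push_cast; omega) ?_
      · have := ((t0.add (t1.weaken hp (m := -2 * n0) (by omega))).sub
          (t2.weaken hp (m := -2 * n0) (by omega)))
        simpa [schwR] using this
      · have : ((n0.toNat : ℤ) : κ) = (n0 : κ) := by rw [Int.toNat_of_nonneg (by omega)]
        push_cast at this ⊢
        rw [this]; field_simp; ring
      · intro hv; exfalso; rcases he with he | he
        · exact he.2 hv
        · omega
    · exact absurd (hac.symm.trans hac1) h01
    · omega
  · rcases k1 with ⟨he2, hac1, hn1⟩ | ⟨he2, hac1, hn1, hdc1⟩ | ⟨he2, hn1, hdc1⟩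
    · omega
    · omega
    · subst hn0 hdc hn1 hdc1
      refine fin (-2 * n1) (1 / (2 * d1 ^ 2)) 0 (-n1).toNat ?_ (by ring) ?_ (by push_cast; omega) ?_
      · have t2' := t2
        rw [show -n1 - n1 = -2 * n1 by ring] at t2'
        have := (t0.add t1).sub t2'
        unfold schwR
        convert this using 1
        field_simp; norm_num
      · field_simp; norm_num
      · intro hv; exact ⟨rfl, by omega⟩

theorem gauge_order_le (h : IsDPlace D v s) {K r r' g : L} {A B : ℕ} {n : ℤ} {c : κ}
    (hg : g = K ^ 2 - D K + r / 2)
    (hr' : r' = r - 4 * D K + 2 * K * (D g / g) + D (D g / g) - (D g / g) ^ 2 / 2)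
    (hr : Lead v s r (-2) ((1 - ((A : κ) / 6) ^ 2) / 2))
    (hrr : Lead v s r' (-2) ((1 - ((B : κ) / 6) ^ 2) / 2))
    (hn : Lead v s g n c) (hc : c ≠ 0) : 6 * n ≤ A + B - 12 := by
  have hp := h.toIsPlace
  have hG : Lead v s (D g / g) (-1) (n : κ) := by
    have := (hn.der h).div hp hn hc
    convert this using 1
    · ring
    · field_simp
  have half : ∀ {f : L} {m : ℤ} {d : κ}, Lead v s f m d → Lead v s (f / 2) m (d / 2) := by
    intro f m d hf
    have := hf.smul hp (1 / 2)
    convert this using 1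
    · simp [algebraMap_ofNat_eq]; ring
    · ring
  have main : ∀ k : κ, Lead v s K (-1) k → 6 * n ≤ A + B - 12 := by
    intro k hk
    have g1 : Lead v s g (-2) (k ^ 2 + k + (1 - ((A : κ) / 6) ^ 2) / 4) := by
      have := ((hk.pow hp 2).sub (hk.der h)).add (half hr)
      rw [hg]
      convert this using 1
      push_cast; ring
    by_cases h0 : k ^ 2 + k + (1 - ((A : κ) / 6) ^ 2) / 4 = 0
    swap
    · have := g1.unique_exp hp h0 hn hc
      omega
    have r2 : Lead v s r' (-2)
        ((1 - ((A : κ) / 6) ^ 2) / 2 + 4 * k + 2 * k * n - n - n ^ 2 / 2) := by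
      have a1 := (hk.der h).smul hp 4
      have a2 := (hk.mul hp hG).smul hp 2
      have a3 := hG.der h
      have a4 := half (hG.pow hp 2)
      have := (((hr.sub a1).add a2).add a3).sub a4
      rw [hr']
      convert this using 1
      · simp only [algebraMap_ofNat_eq]; ring
      · push_cast; ring
    have e1 := r2.unique hp hrr
    have e2 : ((6 * (n : κ) + 12) - A - B) * ((6 * (n : κ) + 12) + A + B) *
        (((6 * (n : κ) + 12) - A + B) * ((6 * (n : κ) + 12) + A - B)) = 0 := by
      have hP : (6 * (n : κ) + 12) ^ 2 + A ^ 2 - B ^ 2 = 2 * (6 * n + 12) * (12 * k + 6) := by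
        linear_combination -72 * e1
      have hσ : (12 * k + 6) ^ 2 = (A : κ) ^ 2 := by linear_combination 144 * h0
      linear_combination
          ((6 * (n : κ) + 12) ^ 2 + A ^ 2 - B ^ 2 + 2 * (6 * n + 12) * (12 * k + 6)) *
        hP + 4 * (6 * (n : κ) + 12) ^ 2 * hσ
    have e3 : ((6 * n + 12) - A - B) * ((6 * n + 12) + A + B) *
        (((6 * n + 12) - A + B) * ((6 * n + 12) + A - B)) = 0 := by exact_mod_cast e2
    rcases mul_eq_zero.1 e3 with e | e <;> rcases mul_eq_zero.1 e with e | e <;> omega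
  by_cases hK0 : K = 0
  · exact main 0 (by rw [hK0]; exact Lead.zero _)
  obtain ⟨m, k, hk0, hk⟩ := hp.exists_lead (κ := κ) hK0
  rcases lt_trichotomy m (-1) with hm | rfl | hm
  · have g1 : Lead v s g (2 * m) (k ^ 2) := by
      have := ((hk.pow hp 2).sub
          ((hk.der h).weaken hp (m := (2 : ℕ) * m) (by push_cast; omega))).add
        ((half hr).weaken hp (m := (2 : ℕ) * m) (by push_cast; omega))
      rw [hg]
      simpa using this
    have := g1.unique_exp hp (pow_ne_zero 2 hk0) hn hc
    omega
  · exact main k hk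
  · exact main 0 (hk.weaken hp hm)

end local_exponents

end

section
open WithZero

theorem exists_derivation_extend_of_formallySmooth {R S T : Type*} [CommRing R] [CommRing S]
    [Field T] [Algebra R S] [Algebra R T] [Algebra S T] [IsScalarTower R S T]
    [Algebra.FormallySmooth S T] (d : Derivation R S T) :
    ∃ d' : Derivation R T T, ∀ s, d' (algebraMap S T s) = d s := by
  have hinj : Function.Injective (KaehlerDifferential.mapBaseChange R S T) := by
    rw [injective_iff_map_eq_zero]
    intro x hx
    obtain ⟨x, rfl⟩ := (Algebra.H1Cotangent.exact_δ_mapBaseChange R S T x).mp hx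
    rw [Subsingleton.elim x 0, map_zero]
  obtain ⟨r, hr⟩ := LinearMap.exists_leftInverse_of_injective
    (KaehlerDifferential.mapBaseChange R S T) (LinearMap.ker_eq_bot.2 hinj)
  let l : TensorProduct S T (KaehlerDifferential R S) →ₗ[T] T :=
    LinearMap.liftBaseChange T d.liftKaehlerDifferential
  refine ⟨(l.comp r).compDer (KaehlerDifferential.D R T), fun s => ?_⟩
  have h1 : KaehlerDifferential.D R T (algebraMap S T s) =
      KaehlerDifferential.mapBaseChange R S T (1 ⊗ₜ KaehlerDifferential.D R S s) := by
    rw [KaehlerDifferential.mapBaseChange_tmul, one_smul, KaehlerDifferential.map_D]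
  have h2 := LinearMap.congr_fun hr (1 ⊗ₜ KaehlerDifferential.D R S s)
  simp only [LinearMap.comp_apply, LinearMap.id_apply] at h2
  change l (r (KaehlerDifferential.D R T (algebraMap S T s))) = _
  rw [h1, h2]
  simp [l]

section function_field
variable {κ E : Type*} [Field κ] [Field E] [Algebra κ E] [CharZero E]

theorem exists_derivation_extend_intermediateField (L : IntermediateField κ E)
    (d : Derivation κ L L) :
    ∃ d' : Derivation κ E E, ∀ x : L, d' x = d x := by
  have hL : CharZero L := (algebraMap L E).charZero
  obtain ⟨t, ht⟩ := exists_isTranscendenceBasis L E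
  have : Algebra.IsAlgebraic (IntermediateField.adjoin L (Set.range (Subtype.val : t → E))) E :=
    ht.isAlgebraic_field
  have : Algebra.FormallySmooth L E :=
    Algebra.FormallySmooth.of_algebraicIndependent_of_isSeparable ht.1
  let d1 : Derivation κ L E := (Algebra.linearMap L E).compDer d
  exact exists_derivation_extend_of_formallySmooth d1

theorem isAlgClosed_constField {k : Type*} [Field k] [Algebra k E] [IsAlgClosed E]
    (δ : Derivation k E E) : IsAlgClosed (constField δ) := by
  refine IsAlgClosed.of_exists_root _ fun p hm hp => ?_
  obtain ⟨x, hx⟩ := IsAlgClosed.exists_aeval_eq_zero E p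
    (Polynomial.degree_ne_of_natDegree_ne (Irreducible.natDegree_pos hp).ne')
  have h0 : δ x = 0 :=
    derivation_eq_zero_of_isAlgebraic_of_le le_rfl ⟨p, hp.ne_zero, hx⟩
  refine ⟨⟨x, h0⟩, ?_⟩
  apply (algebraMap (constField δ) E).injective
  rw [map_zero, ← hx, Polynomial.aeval_def, Polynomial.eval, Polynomial.hom_eval₂]
  rfl

theorem exists_isDPlace_adjoin [IsAlgClosed κ] {S : Set E} (hSf : S.Finite)
    {L : IntermediateField κ E} (hL : L = IntermediateField.adjoin κ S)
    (y : L) (hy : Transcendental κ (y : E))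
    (hS : ∀ δ : Derivation κ E E, δ y = 0 → ∀ s ∈ S, δ s = 0) :
    ∃ (D : Derivation κ L L) (D' : Derivation κ E E) (v : Valuation L ℤᵐ⁰) (s : L),
      IsDPlace D v s ∧ 1 < v y ∧ ∀ x : L, D' x = (D x : E) := by
  have hκ : CharZero κ := (algebraMap κ E).charZero
  have hLc : CharZero L := (algebraMap L E).charZero
  have halg : ∀ x : L, IsAlgebraic (IntermediateField.adjoin κ {y}) x := by
    intro x
    refine isAlgebraic_adjoin_of_derivation _ _ fun δ hδ => ?_
    obtain ⟨δ', h'⟩ := exists_derivation_extend_intermediateField L δ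
    have h1 : δ' y = 0 := by rw [h', hδ y rfl]; rfl
    have h2 : L ≤ constField δ' := hL ▸ IntermediateField.adjoin_le_iff.2 (hS δ' h1)
    have h3 : δ' x = 0 := h2 x.2
    rw [h'] at h3
    exact_mod_cast h3
  have hess : Algebra.EssFiniteType κ L := by
    rw [IntermediateField.essFiniteType_iff]
    exact ⟨hSf.toFinset, by simp [hL]⟩
  have : Algebra.EssFiniteType (IntermediateField.adjoin κ {y}) L :=
    Algebra.EssFiniteType.of_comp κ _ _
  have hfin : FiniteDimensional (IntermediateField.adjoin κ {y}) L := by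
    obtain ⟨T, hT⟩ := IntermediateField.fg_top (IntermediateField.adjoin κ {y}) L
    have := IntermediateField.finiteDimensional_adjoin (K := IntermediateField.adjoin κ {y})
      (S := (T : Set L)) fun x _ => (halg x).isIntegral
    rw [hT] at this
    exact LinearEquiv.finiteDimensional
      (IntermediateField.topEquiv (F := IntermediateField.adjoin κ {y}) (E := L)).toLinearEquiv
  obtain ⟨D, v, s, h1, h2⟩ := exists_isDPlace y
    (fun h => hy (h.algebraMap (A := E))) hfin
  obtain ⟨D', hD'⟩ := exists_derivation_extend_intermediateField L D
  exact ⟨D, D', v, s, h1, h2, hD'⟩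

theorem IsDPlace.der_ne_zero {L : Type*} [Field L] [Algebra κ L] [CharZero L] [CharZero κ]
    {D : Derivation κ L L} {v : Valuation L ℤᵐ⁰} {s y : L} (h : IsDPlace D v s) (hy : 1 < v y) :
    D y ≠ 0 := by
  have hy0 : y ≠ 0 := by rintro rfl; simp at hy
  obtain ⟨n, c, hc, hl⟩ := h.toIsPlace.exists_lead (κ := κ) hy0
  rw [hl.val h.toIsPlace hc, ← exp_zero, exp_lt_exp] at hy
  have hn : (n : κ) ≠ 0 := by
    have : n ≠ 0 := by omega
    exact_mod_cast this
  exact (hl.der h).ne_zero h.toIsPlace (mul_ne_zero hn hc)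

theorem coe_schw {L : IntermediateField κ E} {D : Derivation κ L L} {D' : Derivation κ E E}
    (h : ∀ x : L, D' x = (D x : E)) (x : L) : schw D' (x : E) = (schw D x : L) := by
  simp only [schw, h]
  push_cast
  rfl

theorem coe_schwR {L : IntermediateField κ E} (c0 c1 : κ) (x : L) :
    schwR (algebraMap κ E c0) (algebraMap κ E c1) (x : E) =
      (schwR (algebraMap κ L c0) (algebraMap κ L c1) x : L) := by
  simp only [schwR]
  push_cast
  rfl

end function_field

section nonalgebraic
variable {k E : Type*} [Field k] [Field E] [Algebra k E] [CharZero E]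

/-- A derivation killing `d x - 1`-type ambiguity: algebraic dependence is inherited by `d w`. -/
theorem der_eq_zero_of_comm {d δ : Derivation k E E} {x w : E} (hx : d x = 1)
    (hw : ∀ δ' : Derivation k E E, δ' x = 0 → δ' w = 0) (hδ : δ x = 0) : δ (d w) = 0 := by
  have h := hw ⁅δ, d⁆ (by rw [Derivation.commutator_apply, hx, hδ]; simp)
  rw [Derivation.commutator_apply, hw δ hδ, map_zero, sub_zero] at h
  exact h

/-- A solution of the Schwarzian equation is not algebraic over its variable and constants. -/
theorem IsDatum.not_algebraic [IsAlgClosed E] {c0 c1 : k} (h01 : c0 ≠ c1) {δ : Derivation k E E}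
    {a : Datum E} (h : IsDatum (algebraMap k E c0) (algebraMap k E c1) δ a) {S : Set E}
    (hS : ∀ s ∈ S, δ s = 0)
    (hw : ∀ δ' : Derivation k E E, (∀ s ∈ S, δ' s = 0) → δ' a.z = 0 → δ' a.w = 0) : False := by
  let κ := constField δ
  have hκ : IsAlgClosed κ := isAlgClosed_constField δ
  have hc : CharZero κ := (algebraMap κ E).charZero
  let d : Derivation κ E E := (δ a.z)⁻¹ • overConst δ
  have hd : ∀ x, d x = (δ a.z)⁻¹ * δ x := fun x => rfl
  have hz := h.dz_ne
  have dz : d a.z = 1 := by rw [hd, inv_mul_cancel₀ hz]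
  have dw : d a.w = a.w1 := by rw [hd, h.dw]; field_simp
  have dw1 : d a.w1 = a.w2 := by rw [hd, h.dw1]; field_simp
  have k0 : ∀ δ' : Derivation κ E E, δ' a.z = 0 → δ' a.w = 0 := fun δ' h' =>
    hw (δ'.restrictScalars k) (fun s hs => by
      have := δ'.map_algebraMap ⟨s, hS s hs⟩
      exact this) h'
  have k1 : ∀ δ' : Derivation κ E E, δ' a.z = 0 → δ' a.w1 = 0 := fun δ' h' =>
    dw ▸ der_eq_zero_of_comm dz k0 h'
  have k2 : ∀ δ' : Derivation κ E E, δ' a.z = 0 → δ' a.w2 = 0 := fun δ' h' =>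
    dw1 ▸ der_eq_zero_of_comm dz k1 h'
  have gen : ∀ x, (∀ δ' : Derivation κ E E, δ' a.z = 0 → δ' x = 0) →
      ∀ δ' : Derivation κ E E, δ' x = d x * δ' a.z := by
    intro x hx δ'
    have := hx (δ' - (δ' a.z) • d) (by simp [dz])
    rw [Derivation.sub_apply, Derivation.smul_apply, sub_eq_zero] at this
    rw [this, smul_eq_mul, mul_comm]
  have hdat : ∀ δ' : Derivation κ E E, δ' a.z ≠ 0 →
      IsDatum (algebraMap k E c0) (algebraMap k E c1) δ' a := fun δ' h' =>
    ⟨by rw [gen _ k0, dw], by rw [gen _ k1, dw1], by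
      rw [gen _ k2, hd, h.dw2]; field_simp, h', h.w1_ne, h.w_ne0, h.w_ne1⟩
  have hδw : δ a.w ≠ 0 := by rw [h.dw]; exact mul_ne_zero h.w1_ne hz
  let S' : Set E := {a.z, a.w}
  let L := IntermediateField.adjoin κ S'
  let zL : L := ⟨a.z, IntermediateField.subset_adjoin _ _ (by simp [S'])⟩
  let wL : L := ⟨a.w, IntermediateField.subset_adjoin _ _ (by simp [S'])⟩
  have hLc : CharZero L := (algebraMap L E).charZero
  obtain ⟨D, D', v, s, hP, hv, hDD⟩ := exists_isDPlace_adjoin (S := S') (by simp [S']) rfl wL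
    (fun h' => hδw (derivation_eq_zero_of_isAlgebraic (δ := overConst δ) h'))
    (by
      intro δ' h' s hs
      have h1 : δ' a.w = 0 := h'
      rcases hs with rfl | rfl
      · rw [gen _ k0, dw] at h1
        exact (mul_eq_zero.1 h1).resolve_left h.w1_ne
      · exact h1)
  have hDw := hP.der_ne_zero hv
  have hDz' : D' a.z ≠ 0 := by
    intro h0
    apply hDw
    have := k0 D' h0
    have h2 := hDD wL
    rw [show ((wL : L) : E) = a.w from rfl, this] at h2
    exact_mod_cast h2.symm
  have hDz : D zL ≠ 0 := by
    intro h0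
    have h2 := hDD zL
    rw [h0] at h2
    exact hDz' h2
  have heq : schw D zL = schw D wL + schwR (algebraMap κ L (algebraMap k κ c0))
      (algebraMap κ L (algebraMap k κ c1)) wL * D wL ^ 2 := by
    have := (hdat D' hDz').schw_z
    apply Subtype.ext
    push_cast
    rw [← coe_schw hDD, ← coe_schw hDD, ← hDD, ← coe_schwR]
    exact this
  obtain ⟨e, he, l1⟩ := exists_schw_eq hP hDz
  obtain ⟨A, m, c, hc, l2, -, hA⟩ := exists_local_exponent hP
    (c0 := algebraMap k κ c0) (c1 := algebraMap k κ c1)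
    (fun h' => h01 ((algebraMap k κ).injective h')) hDw
  rw [heq] at l1
  have h3 := l1.unique hP.toIsPlace l2
  rw [(hA hv).1] at h3
  have he' : (e : κ) ≠ 0 := by exact_mod_cast he
  have h4 : (e : κ) ^ 2 = 0 := by
    simp only [Nat.cast_zero, zero_div] at h3
    field_simp at h3
    linear_combination -h3
  exact he' (pow_eq_zero_iff (by norm_num) |>.1 h4)

end nonalgebraic

end

section pair
variable {k E : Type*} [Field k] [Field E] [Algebra k E] [CharZero E]

theorem Datum.exists_derivation_v {c0 c1 : E} {a : Datum E} (h : a.w1 ≠ 0)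
    (ha : AlgebraicIndependent k ![a.z, a.w, a.w1, a.w2]) (e : E) (p : Fin 3 → E) :
    ∃ δ : Derivation k E E, a.e δ = e ∧ a.v c0 c1 δ = p := by
  obtain ⟨δ, hδ⟩ := exists_derivation_of_algebraicIndependent ha
    ![e - (p 0 + p 1 * a.z + p 2 * a.z ^ 2), a.w1 * e,
      a.w2 * e + a.w1 * (p 1 + 2 * p 2 * a.z),
      a.w3 c0 c1 * e + 2 * a.w2 * (p 1 + 2 * p 2 * a.z) + 2 * a.w1 * p 2]
  refine ⟨δ, v_unique h ?_ ?_ ?_ ?_⟩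
  · simpa using hδ 1
  · simpa using hδ 0
  · simpa using hδ 2
  · simpa using hδ 3

theorem IsDatum.smul {c0 c1 : E} {D : Derivation k E E} {a : Datum E} (h : IsDatum c0 c1 D a)
    {f : E} (hf : f ≠ 0) : IsDatum c0 c1 (f • D) a :=
  ⟨by simp [h.dw]; ring, by simp [h.dw1]; ring, by simp [h.dw2]; ring,
    by simp [hf, h.dz_ne], h.w1_ne, h.w_ne0, h.w_ne1⟩

/-- Fixing the jet of one solution up to translation fixes the other solution. -/
theorem e_eq_zero_of_translation [IsAlgClosed E] {c0 c1 : k} (h01 : c0 ≠ c1) {a b : Datum E}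
    (ha1 : a.w1 ≠ 0) (hb1 : b.w1 ≠ 0) (hb2 : b.w ≠ algebraMap k E c0)
    (hb3 : b.w ≠ algebraMap k E c1)
    (hv : ∀ δ : Derivation k E E, b.v (algebraMap k E c0) (algebraMap k E c1) δ =
      a.v (algebraMap k E c0) (algebraMap k E c1) δ)
    (δ : Derivation k E E) (he : a.e δ = 0)
    (h1 : a.v (algebraMap k E c0) (algebraMap k E c1) δ 1 = 0)
    (h2 : a.v (algebraMap k E c0) (algebraMap k E c1) δ 2 = 0) : b.e δ = 0 := by
  by_contra hne
  set d0 := algebraMap k E c0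
  set d1 := algebraMap k E c1
  have key : ∀ δ : Derivation k E E, a.e δ = 0 → a.v d0 d1 δ 1 = 0 → a.v d0 d1 δ 2 = 0 →
      δ (b.z - a.z) = b.e δ := by
    intro δ he h1 h2
    rw [map_sub, Datum.der_z (c0 := d0) (c1 := d1), Datum.der_z (a := a) (c0 := d0) (c1 := d1),
      hv, he, h1, h2]
    ring
  have hdat : IsDatum d0 d1 δ ⟨b.z - a.z, b.w, b.w1, b.w2⟩ := by
    have k1 := key δ he h1 h2
    refine ⟨?_, ?_, ?_, by simpa [k1] using hne, hb1, hb2, hb3⟩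
    · simp only [k1]; exact Datum.der_w hb1 δ
    · simp only [k1]
      rw [Datum.der_w1 (c0 := d0) (c1 := d1) hb1 δ, hv, h1, h2]; ring
    · simp only [k1]
      rw [Datum.der_w2 (c0 := d0) (c1 := d1) hb1 δ, hv, h1, h2]
      simp only [Datum.w3]; ring
  refine hdat.not_algebraic h01 (S := {a.w, a.w1, a.w2}) ?_ ?_
  · rintro s (rfl | rfl | rfl)
    · rw [Datum.der_w ha1, he, mul_zero]
    · rw [Datum.der_w1 (c0 := d0) (c1 := d1) ha1, he, h1, h2]; ring
    · rw [Datum.der_w2 (c0 := d0) (c1 := d1) ha1, he, h1, h2]; ring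
  · intro δ' hS hz
    have e0 : a.e δ' = 0 := by rw [Datum.e_apply, hS _ (by simp), zero_div]
    have g1 := hS a.w1 (by simp)
    have g2 := hS a.w2 (by simp)
    rw [Datum.der_w1 (c0 := d0) (c1 := d1) ha1, e0, mul_zero, zero_add] at g1
    have g1' := (mul_eq_zero.1 g1).resolve_left ha1
    rw [Datum.der_w2 (c0 := d0) (c1 := d1) ha1, e0, g1', mul_zero, mul_zero, zero_add,
      zero_add] at g2
    have g3 : a.v d0 d1 δ' 2 = 0 := by simpa [ha1] using g2
    have g4 : a.v d0 d1 δ' 1 = 0 := by simpa [g3] using g1'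
    have := key δ' e0 g4 g3
    change δ' (b.z - a.z) = 0 at hz
    change δ' b.w = 0
    rw [Datum.der_w hb1, ← this, hz, mul_zero]

theorem e_eq_zero_of_square [IsAlgClosed E] {c0 c1 : k} (h01 : c0 ≠ c1)
    {D : Derivation k E E} {a b : Datum E}
    (ha : IsDatum (algebraMap k E c0) (algebraMap k E c1) D a)
    (hb : IsDatum (algebraMap k E c0) (algebraMap k E c1) D b)
    (hv : ∀ δ : Derivation k E E, b.v (algebraMap k E c0) (algebraMap k E c1) δ =
      a.v (algebraMap k E c0) (algebraMap k E c1) δ)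
    (r : k) (δ : Derivation k E E) (he : a.e δ = 0) (c : E)
    (h : a.v (algebraMap k E c0) (algebraMap k E c1) δ =
      ![c * algebraMap k E r ^ 2, -2 * c * algebraMap k E r, c]) : b.e δ = 0 := by
  have har : a.z ≠ algebraMap k E r := fun h => ha.dz_ne (by rw [h, der_algebraMap])
  have hbr : b.z ≠ algebraMap k E r := fun h => hb.dz_ne (by rw [h, der_algebraMap])
  have ha' := Datum.inv_isDatum har ha (der_algebraMap D r)
  have hb' := Datum.inv_isDatum hbr hb (der_algebraMap D r)
  have va := fun δ : Derivation k E E => Datum.inv_v (c0 := algebraMap k E c0)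
    (c1 := algebraMap k E c1) har ha.w1_ne δ (der_algebraMap δ r)
  have vb := fun δ : Derivation k E E => Datum.inv_v (c0 := algebraMap k E c0)
    (c1 := algebraMap k E c1) hbr hb.w1_ne δ (der_algebraMap δ r)
  have := e_eq_zero_of_translation h01 (a := a.inv (algebraMap k E r))
    (b := b.inv (algebraMap k E r)) ha'.w1_ne hb'.w1_ne hb'.w_ne0 hb'.w_ne1
    (fun δ => by rw [(va δ).2, (vb δ).2, hv]) δ (by rw [(va δ).1, he, zero_div])
    (by rw [(va δ).2, h]; simp; ring) (by rw [(va δ).2, h]; simp; ring)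
  rw [(vb δ).1] at this
  exact (div_eq_zero_iff.1 this).resolve_right (pow_ne_zero 2 (sub_ne_zero.2 hbr))

theorem e_eq_zero_of_v_eq [IsAlgClosed E] {c0 c1 : k} (h01 : c0 ≠ c1)
    {D : Derivation k E E} {a b : Datum E}
    (ha : IsDatum (algebraMap k E c0) (algebraMap k E c1) D a)
    (hb : IsDatum (algebraMap k E c0) (algebraMap k E c1) D b)
    (hai : AlgebraicIndependent k ![a.z, a.w, a.w1, a.w2])
    (hv : ∀ δ : Derivation k E E, b.v (algebraMap k E c0) (algebraMap k E c1) δ =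
      a.v (algebraMap k E c0) (algebraMap k E c1) δ)
    (δ : Derivation k E E) (he : a.e δ = 0) : b.e δ = 0 := by
  set A := a.v (algebraMap k E c0) (algebraMap k E c1) δ 0 with hA
  set B := a.v (algebraMap k E c0) (algebraMap k E c1) δ 1 with hB
  set C := a.v (algebraMap k E c0) (algebraMap k E c1) δ 2 with hC
  obtain ⟨δ1, e1, v1⟩ := Datum.exists_derivation_v (c0 := algebraMap k E c0)
    (c1 := algebraMap k E c1) ha.w1_ne hai 0 ![-B / 2, B, -B / 2]
  obtain ⟨δ2, e2, v2⟩ := Datum.exists_derivation_v (c0 := algebraMap k E c0)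
    (c1 := algebraMap k E c1) ha.w1_ne hai 0 ![0, 0, C + B / 2]
  have b1 := e_eq_zero_of_square h01 ha hb hv 1 δ1 e1 (-B / 2) (by
    rw [v1]; ext i; fin_cases i <;> simp; ring)
  have b2 := e_eq_zero_of_square h01 ha hb hv 0 δ2 e2 (C + B / 2) (by
    rw [v2]; ext i; fin_cases i <;> simp)
  have b3 := e_eq_zero_of_translation h01 ha.w1_ne hb.w1_ne hb.w_ne0 hb.w_ne1 hv (δ - δ1 - δ2)
    (by rw [map_sub, map_sub, he, e1, e2]; ring)
    (by rw [map_sub, map_sub, Pi.sub_apply, Pi.sub_apply, v1, v2, ← hB]; simp)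
    (by rw [map_sub, map_sub, Pi.sub_apply, Pi.sub_apply, v1, v2, ← hC]
        simp only [Matrix.cons_val]; ring)
  rw [map_sub, map_sub, b1, b2] at b3
  simpa using b3

/-- The gauge identities relating two functions and their Schwarzians. -/
theorem gauge_identities (d : Derivation k E E) {x y : E} (hx : d x ≠ 0) (hy : d y ≠ 0)
    (hxy : y ≠ x) {K g : E} (hK : K = d x / (y - x) + d (d x) / d x / 2)
    (hg : g = d x * d y / (y - x) ^ 2) :
    g = K ^ 2 - d K + schw d x / 2 ∧
    schw d y = schw d x - 4 * d K + 2 * K * (d g / g) + d (d g / g) - (d g / g) ^ 2 / 2 := by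
  have h0 := sub_ne_zero.2 hxy
  have dK : d K = d (d x) / (y - x) - d x * (d y - d x) / (y - x) ^ 2
      + (d (d (d x)) / d x - d (d x) ^ 2 / d x ^ 2) / 2 := by
    rw [hK, map_add, der_div d _ two_ne_zero, der_div d _ hx, der_div d _ h0, der_ofNat, map_sub]
    field_simp
    ring
  have dG : d g / g = d (d x) / d x + d (d y) / d y - 2 * (d y - d x) / (y - x) := by
    rw [hg, der_div d _ (pow_ne_zero 2 h0), der_mul, der_pow, map_sub]
    field_simp
    ring
  have ddG : d (d g / g) = (d (d (d x)) / d x - d (d x) ^ 2 / d x ^ 2)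
      + (d (d (d y)) / d y - d (d y) ^ 2 / d y ^ 2)
      - (2 * (d (d y) - d (d x)) / (y - x) - 2 * (d y - d x) ^ 2 / (y - x) ^ 2) := by
    rw [dG, map_sub, map_add, der_div d _ hx, der_div d _ hy, der_div d _ h0, der_mul, der_ofNat,
      map_sub, map_sub]
    field_simp
    ring
  constructor
  · rw [dK, hK, hg, schw]; field_simp; ring
  · rw [ddG, dG, dK, hK, schw, schw]; field_simp; ring

end pair

section
open WithZero

section pair
variable {k E : Type*} [Field k] [Field E] [Algebra k E] [CharZero E]

namespace Datum

/-- The first invariant of a pair of solutions under simultaneous Möbius transformations. -/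
def gauge (a b : Datum E) : E := 1 / (a.w1 * (b.z - a.z)) - a.w2 / (2 * a.w1 ^ 2)

/-- The polynomial controlling the ramification of the solutions. -/
def ramPoly (c0 c1 w : E) : E := (w - c0) ^ 4 * (w - c1) ^ 3

/-- The second invariant of a pair of solutions under simultaneous Möbius transformations. -/
def cross (c0 c1 : E) (a b : Datum E) : E :=
  (b.z - a.z) ^ 12 * a.w1 ^ 6 * b.w1 ^ 6 / (ramPoly c0 c1 a.w * ramPoly c0 c1 b.w)

theorem der_gauge {c0 c1 : E} {a b : Datum E} (ha : a.w1 ≠ 0)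
    (hab : b.z ≠ a.z) (δ : Derivation k E E) (ea : a.e δ = 0) (eb : b.e δ = 0)
    (hv : b.v c0 c1 δ = a.v c0 c1 δ) : δ (a.gauge b) = 0 := by
  have h0 := sub_ne_zero.2 hab
  have z1 := der_z (a := a) (c0 := c0) (c1 := c1) δ
  have z2 := der_z (a := b) (c0 := c0) (c1 := c1) δ
  have y1 := der_w1 ha δ (c0 := c0) (c1 := c1)
  have u1 := der_w2 ha δ (c0 := c0) (c1 := c1)
  rw [ea] at z1 y1 u1
  rw [eb, hv] at z2
  rw [gauge, map_sub, der_div δ _ (mul_ne_zero ha h0), der_div δ _ (by simpa using ha), der_mul,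
    der_mul, der_pow, der_ofNat, map_sub, z1, z2, y1, u1, Derivation.map_one_eq_zero]
  field_simp
  ring

theorem der_cross {c0 c1 : E} {a b : Datum E} (ha : a.w1 ≠ 0) (hb : b.w1 ≠ 0)
    (ha0 : a.w ≠ c0) (ha1 : a.w ≠ c1) (hb0 : b.w ≠ c0) (hb1 : b.w ≠ c1)
    (δ : Derivation k E E) (h0 : δ c0 = 0) (h1 : δ c1 = 0) (ea : a.e δ = 0) (eb : b.e δ = 0)
    (hv : b.v c0 c1 δ = a.v c0 c1 δ) : δ (a.cross c0 c1 b) = 0 := by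
  have z1 := der_z (a := a) (c0 := c0) (c1 := c1) δ
  have z2 := der_z (a := b) (c0 := c0) (c1 := c1) δ
  have x1 := der_w ha δ
  have x2 := der_w hb δ
  have y1 := der_w1 ha δ (c0 := c0) (c1 := c1)
  have y2 := der_w1 hb δ (c0 := c0) (c1 := c1)
  rw [ea] at z1 y1 x1
  rw [eb, hv] at z2 y2
  rw [eb] at x2
  have hd : δ (ramPoly c0 c1 a.w * ramPoly c0 c1 b.w) = 0 := by
    simp [ramPoly, h0, h1, x1, x2]
  rw [cross, der_div δ _ (by simp [ramPoly, sub_ne_zero, *]), hd, der_mul, der_mul, der_pow,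
    der_pow, der_pow, map_sub, z1, z2, y1, y2]
  push_cast
  ring

end Datum

theorem cross_place_bound {c0 c1 : k} (h01 : c0 ≠ c1) {L : IntermediateField k E} [CharZero L]
    [CharZero k] {D₀ : Derivation k E E} {a b : Datum E}
    (ha : IsDatum (algebraMap k E c0) (algebraMap k E c1) D₀ a)
    (hb : IsDatum (algebraMap k E c0) (algebraMap k E c1) D₀ b) (hab : b.z ≠ a.z)
    (wa wb K Ψ : L) (hwa : (wa : E) = a.w) (hwb : (wb : E) = b.w) (hK : (K : E) = a.gauge b)
    (hΨ : (Ψ : E) = a.cross (algebraMap k E c0) (algebraMap k E c1) b)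
    (hL : ∀ δ : Derivation k E E, δ a.w = 0 → ∀ x : L, δ x = 0)
    {D : Derivation k L L} {v : Valuation L ℤᵐ⁰} {s : L} (hP : IsDPlace D v s)
    {D' : Derivation k E E} (hD' : ∀ x : L, D' x = (D x : E)) (hne : D' a.w ≠ 0) :
    v Ψ ≤ 1 ∧ (1 < v wa → v Ψ < 1) := by
  have hp := hP.toIsPlace
  have hDw0 : D₀ a.w ≠ 0 := by rw [ha.dw]; exact mul_ne_zero ha.w1_ne ha.dz_ne
  obtain ⟨d, hd⟩ : ∃ d : Derivation k E E, d = (D' a.w / D₀ a.w) • D₀ := ⟨_, rfl⟩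
  have hf : D' a.w / D₀ a.w ≠ 0 := div_ne_zero hne hDw0
  have ha' := ha.smul hf
  have hb' := hb.smul hf
  rw [← hd] at ha' hb'
  have hdD : ∀ x : L, d x = (D x : E) := by
    intro x
    have := hL (D' - d) (by
      rw [Derivation.sub_apply, hd, Derivation.smul_apply, smul_eq_mul, div_mul_cancel₀ _ hDw0,
        sub_self]) x
    rw [Derivation.sub_apply, sub_eq_zero, hD'] at this
    exact this.symm
  clear hd hD' hne hL
  have dzw : ∀ {a : Datum E}, IsDatum (algebraMap k E c0) (algebraMap k E c1) d a →
      d a.w ≠ 0 := fun h => by rw [h.dw]; exact mul_ne_zero h.w1_ne h.dz_ne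
  have nea : D wa ≠ 0 := fun h => dzw ha' (by rw [← hwa, hdD, h]; rfl)
  have neb : D wb ≠ 0 := fun h => dzw hb' (by rw [← hwb, hdD, h]; rfl)
  obtain ⟨A, m, c, hc, l1, l2, l3⟩ := exists_local_exponent hP h01 nea
  obtain ⟨B, m', c', hc', l1', l2', -⟩ := exists_local_exponent hP h01 neb
  obtain ⟨g1, g2⟩ := gauge_identities d ha'.dz_ne hb'.dz_ne hab rfl rfl
  have c2 : ((2 : L) : E) = 2 := rfl
  have c4 : ((4 : L) : E) = 4 := rfl
  let KL : L := D wa * K + D (D wa) / D wa / 2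
  have hKL : (KL : E) = d a.z / (b.z - a.z) + d (d a.z) / d a.z / 2 := by
    have h0 := sub_ne_zero.2 hab
    have h1 := ha'.w1_ne
    have h2 := ha'.dz_ne
    have e2 : d (d a.w) = a.w2 * (d a.z) ^ 2 + a.w1 * d (d a.z) := by
      rw [ha'.dw, der_mul, ha'.dw1]; ring
    simp only [KL]
    push_cast
    rw [c2, ← hdD, ← hdD, ← hdD, hK, hwa, e2, ha'.dw, Datum.gauge]
    field_simp
    ring
  let r : L := schw D wa + schwR (algebraMap k L c0) (algebraMap k L c1) wa * D wa ^ 2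
  let r' : L := schw D wb + schwR (algebraMap k L c0) (algebraMap k L c1) wb * D wb ^ 2
  have hr : (r : E) = schw d a.z := by
    rw [ha'.schw_z]
    simp only [r]
    push_cast
    rw [← coe_schw hdD, ← coe_schwR, ← hdD, hwa]
  have hr' : (r' : E) = schw d b.z := by
    rw [hb'.schw_z]
    simp only [r']
    push_cast
    rw [← coe_schw hdD, ← coe_schwR, ← hdD, hwb]
  let g : L := KL ^ 2 - D KL + r / 2
  have hg : (g : E) = d a.z * d b.z / (b.z - a.z) ^ 2 := by
    rw [g1]
    simp only [g]
    push_cast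
    rw [c2, ← hdD, hr, hKL]
  have hg0 : g ≠ 0 := by
    intro h
    rw [h] at hg
    have : d a.z * d b.z / (b.z - a.z) ^ 2 ≠ 0 :=
      div_ne_zero (mul_ne_zero ha'.dz_ne hb'.dz_ne) (pow_ne_zero 2 (sub_ne_zero.2 hab))
    exact this hg.symm
  have hr'g : r' = r - 4 * D KL + 2 * KL * (D g / g) + D (D g / g) - (D g / g) ^ 2 / 2 := by
    apply Subtype.ext
    push_cast
    rw [c2, c4, hr', g2, hr, ← hdD KL, hKL, ← hdD (D g / g)]
    push_cast
    rw [← hdD g, hg]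
  obtain ⟨n, γ, hγ, hn⟩ := hp.exists_lead (κ := k) hg0
  have hord := gauge_order_le hP rfl hr'g l1 l1' hn hγ
  have hΨg : Ψ = (D wa ^ 6 / ((wa - algebraMap k L c0) ^ 4 * (wa - algebraMap k L c1) ^ 3)) *
      (D wb ^ 6 / ((wb - algebraMap k L c0) ^ 4 * (wb - algebraMap k L c1) ^ 3)) / g ^ 6 := by
    apply Subtype.ext
    push_cast
    rw [hΨ, hg, ← hdD, ← hdD, hwa, hwb, ha'.dw, hb'.dw, Datum.cross, Datum.ramPoly, Datum.ramPoly]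
    have h1 := ha'.dz_ne
    have h2 := hb'.dz_ne
    have h3 := sub_ne_zero.2 hab
    have h4 := sub_ne_zero.2 ha'.w_ne0
    have h5 := sub_ne_zero.2 hb'.w_ne0
    have h6 := sub_ne_zero.2 ha'.w_ne1
    have h7 := sub_ne_zero.2 hb'.w_ne1
    field_simp
  have hlead := ((l2.mul hp l2').div hp (hn.pow hp 6) (pow_ne_zero 6 hγ))
  rw [← hΨg] at hlead
  have hval := hlead.val hp (div_ne_zero (mul_ne_zero hc hc') (pow_ne_zero 6 hγ))
  rw [hval, ← exp_zero, exp_le_exp, exp_lt_exp]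
  refine ⟨by push_cast; omega, fun h => ?_⟩
  rw [exp_zero] at h
  have := (l3 h).2
  push_cast; omega

/-- A solution is determined by its infinitesimal Möbius transformations. -/
theorem z_eq_of_v_eq [IsAlgClosed k] [IsAlgClosed E] {c0 c1 : k} (h01 : c0 ≠ c1)
    {D₀ : Derivation k E E} {a b : Datum E}
    (ha : IsDatum (algebraMap k E c0) (algebraMap k E c1) D₀ a)
    (hb : IsDatum (algebraMap k E c0) (algebraMap k E c1) D₀ b)
    (hai : AlgebraicIndependent k ![a.z, a.w, a.w1, a.w2])
    (hv : ∀ δ : Derivation k E E, b.v (algebraMap k E c0) (algebraMap k E c1) δ =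
      a.v (algebraMap k E c0) (algebraMap k E c1) δ) : b.z = a.z := by
  by_contra hab
  have hk : CharZero k := (algebraMap k E).charZero
  have hDw0 : D₀ a.w ≠ 0 := by rw [ha.dw]; exact mul_ne_zero ha.w1_ne ha.dz_ne
  let S : Set E := {a.w, b.w, a.gauge b, a.cross (algebraMap k E c0) (algebraMap k E c1) b}
  have hkill : ∀ δ : Derivation k E E, δ a.w = 0 → ∀ s ∈ S, δ s = 0 := by
    intro δ hδ
    have ea : a.e δ = 0 := by rw [Datum.e_apply, hδ, zero_div]
    have eb := e_eq_zero_of_v_eq h01 ha hb hai hv δ ea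
    rintro s (rfl | rfl | rfl | rfl)
    · exact hδ
    · rw [Datum.der_w hb.w1_ne, eb, mul_zero]
    · exact Datum.der_gauge ha.w1_ne hab δ ea eb (hv δ)
    · exact Datum.der_cross ha.w1_ne hb.w1_ne ha.w_ne0 ha.w_ne1 hb.w_ne0 hb.w_ne1 δ
        (der_algebraMap δ c0) (der_algebraMap δ c1) ea eb (hv δ)
  let L := IntermediateField.adjoin k S
  have hLc : CharZero L := (algebraMap L E).charZero
  have hL : ∀ δ : Derivation k E E, δ a.w = 0 → ∀ x : L, δ x = 0 := by
    intro δ hδ x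
    have h2 : L ≤ constField δ := IntermediateField.adjoin_le_iff.2 (hkill δ hδ)
    exact h2 x.2
  have hmem : ∀ s ∈ S, s ∈ L := fun s hs => IntermediateField.subset_adjoin _ _ hs
  let wa : L := ⟨a.w, hmem _ (by simp [S])⟩
  let wb : L := ⟨b.w, hmem _ (by simp [S])⟩
  let K : L := ⟨a.gauge b, hmem _ (by simp [S])⟩
  let Ψ : L := ⟨a.cross (algebraMap k E c0) (algebraMap k E c1) b, hmem _ (by simp [S])⟩
  have hfin : S.Finite := by simp [S]
  have hΨ0 : Ψ ≠ 0 := by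
    have h1 := sub_ne_zero.2 ha.w_ne0
    have h2 := sub_ne_zero.2 ha.w_ne1
    have h3 := sub_ne_zero.2 hb.w_ne0
    have h4 := sub_ne_zero.2 hb.w_ne1
    have h5 := sub_ne_zero.2 hab
    have h6 := ha.w1_ne
    have h7 := hb.w1_ne
    intro h
    have : a.cross (algebraMap k E c0) (algebraMap k E c1) b = 0 := congrArg Subtype.val h
    simp [Datum.cross, Datum.ramPoly, *] at this
  -- the invariant is not constant, because it vanishes at the poles of `a.w`
  have hΨt : Transcendental k (Ψ : E) := by
    intro halg
    obtain ⟨c, hc⟩ := minpoly.mem_range_of_degree_eq_one k _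
      (IsAlgClosed.degree_eq_one_of_irreducible k (minpoly.irreducible halg.isIntegral))
    have hc' : Ψ = algebraMap k L c := Subtype.ext hc.symm
    obtain ⟨D, D', v, s, hP, hv, hDD⟩ := exists_isDPlace_adjoin hfin rfl wa
      (fun h' => hDw0 (derivation_eq_zero_of_isAlgebraic h')) hkill
    have hne : D' a.w ≠ 0 := fun h => hP.der_ne_zero hv (by
      apply Subtype.ext; rw [← hDD]; exact h)
    have := (cross_place_bound h01 ha hb hab wa wb K Ψ rfl rfl rfl rfl hL hP hDD hne).2 hv
    rw [hc', hP.toIsPlace.const c (by rintro rfl; simp [hc'] at hΨ0)] at this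
    exact lt_irrefl _ this
  have hexch : ∀ δ : Derivation k E E, δ Ψ = 0 → δ a.w = 0 := by
    intro δ hδ
    have h1 := hL (δ - (δ a.w / D₀ a.w) • D₀) (by simp [hDw0]) Ψ
    rw [Derivation.sub_apply, hδ, Derivation.smul_apply, zero_sub, neg_eq_zero, smul_eq_mul,
      mul_eq_zero, div_eq_zero_iff] at h1
    rcases h1 with (h1 | h1) | h1
    · exact h1
    · exact absurd h1 hDw0
    · obtain ⟨ε, hε⟩ := exists_derivation_of_algebraicIndependent
        ((algebraicIndependent_unique_type_iff (x := ![(Ψ : E)])).2 hΨt) ![1]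
      have h2 := hL (ε - (ε a.w / D₀ a.w) • D₀) (by simp [hDw0]) Ψ
      rw [Derivation.sub_apply, Derivation.smul_apply, h1, smul_zero, sub_zero] at h2
      exact absurd ((hε 0).symm.trans h2) one_ne_zero
  obtain ⟨D, D', v, s, hP, hv, hDD⟩ := exists_isDPlace_adjoin hfin rfl Ψ hΨt
    (fun δ hδ => hkill δ (hexch δ hδ))
  have hne : D' a.w ≠ 0 := fun h => hP.der_ne_zero hv (by
    apply Subtype.ext; rw [← hDD]; exact hL D' h Ψ)
  have := (cross_place_bound h01 ha hb hab wa wb K Ψ rfl rfl rfl rfl hL hP hDD hne).1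
  exact absurd hv (not_lt.2 this)

end pair

end

section gauge
variable {k E : Type*} [Field k] [Field E] [Algebra k E] [CharZero E]

/-- A Lie algebra automorphism relating two solutions is undone by a Möbius transformation
fixing infinity, provided that it preserves translations. -/
theorem exists_datum_v_eq_of_affine {c0 c1 : E} {D : Derivation k E E} {a b : Datum E}
    (hb : IsDatum c0 c1 D b) {n h : E} {H Y : Fin 3 → E} {N : Fin 3 → E} (hN : N = ![n, 0, 0])
    (hn : n ≠ 0) (hh : H 0 = h)
    (hθ : ∀ δ : Derivation k E E, b.v c0 c1 δ =
      a.v c0 c1 δ 0 • N + a.v c0 c1 δ 1 • H + a.v c0 c1 δ 2 • Y)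
    (hn0 : ∀ δ : Derivation k E E, δ n = 0) (hh0 : ∀ δ : Derivation k E E, δ h = 0)
    (b1 : qbr N H = N) (b2 : qbr N Y = (2 : E) • H) (b3 : qbr H Y = Y) :
    ∃ b' : Datum E, IsDatum c0 c1 D b' ∧ schw D b'.z = schw D b.z ∧
      ∀ δ : Derivation k E E, b'.v c0 c1 δ = a.v c0 c1 δ := by
  subst hN
  have h1 : H 1 = 1 := by
    have := congrFun b1 0
    simp [qbr] at this
    exact mul_left_cancel₀ hn (this.trans (mul_one n).symm)
  have h2 : H 2 = 0 := by
    have := congrFun b1 1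
    simpa [qbr, hn] using this
  have y1 : Y 1 = 2 * h / n := by
    have := congrFun b2 0
    simp [qbr, hh] at this
    field_simp; linear_combination this
  have y2 : Y 2 = 1 / n := by
    have := congrFun b2 1
    simp [qbr, h1] at this
    field_simp; linear_combination this
  have y0 : Y 0 = h ^ 2 / n := by
    have := congrFun b3 0
    simp only [qbr, hh, h1, y1, Matrix.cons_val] at this
    field_simp at this ⊢; linear_combination -this / 2
  have d1 (δ : Derivation k E E) : δ (1 / n) = 0 := by rw [der_div δ _ hn, hn0]; simp
  have d2 (δ : Derivation k E E) : δ (h / n) = 0 := by rw [der_div δ _ hn, hn0, hh0]; simp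
  have hα : 1 / n ≠ 0 := one_div_ne_zero hn
  refine ⟨b.aff (1 / n) (h / n), Datum.aff_isDatum hα hb (d1 D) (d2 D),
    schw_smul_add D hα (d1 D) (d2 D), fun δ => ?_⟩
  have hH : H = ![h, 1, 0] := by ext i; fin_cases i <;> simp [hh, h1, h2]
  have hY : Y = ![h ^ 2 / n, 2 * h / n, 1 / n] := by ext i; fin_cases i <;> simp [y0, y1, y2]
  rw [(Datum.aff_v hα hb.w1_ne δ (d1 δ) (d2 δ)).2, hθ, hH, hY]
  ext i
  fin_cases i
  · simp; field_simp; ring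
  · simp; field_simp; ring
  · simp; field_simp

theorem exists_datum_v_eq {c0 c1 : E} {D : Derivation k E E} {a b : Datum E}
    (hb : IsDatum c0 c1 D b) {N H Y : Fin 3 → E} (hn : N ≠ 0)
    (hθ : ∀ δ : Derivation k E E, b.v c0 c1 δ =
      a.v c0 c1 δ 0 • N + a.v c0 c1 δ 1 • H + a.v c0 c1 δ 2 • Y)
    (hN0 : ∀ (δ : Derivation k E E) i, δ (N i) = 0)
    (hH0 : ∀ (δ : Derivation k E E) i, δ (H i) = 0)
    (b1 : qbr N H = N) (b2 : qbr N Y = (2 : E) • H) (b3 : qbr H Y = Y) :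
    ∃ b' : Datum E, IsDatum c0 c1 D b' ∧ schw D b'.z = schw D b.z ∧
      ∀ δ : Derivation k E E, b'.v c0 c1 δ = a.v c0 c1 δ := by
  have disc : N 1 ^ 2 = 4 * N 0 * N 2 := by
    have e0 := congrFun b1 0
    have e1 := congrFun b1 1
    have e2 := congrFun b1 2
    simp only [qbr, Matrix.cons_val] at e0 e1 e2
    linear_combination -N 1 * e1 + 2 * N 0 * e2 + 2 * N 2 * e0
  by_cases hN2 : N 2 = 0
  · have hN1 : N 1 = 0 := by simpa [hN2] using disc
    have hN : N = ![N 0, 0, 0] := by ext i; fin_cases i <;> simp [hN1, hN2]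
    refine exists_datum_v_eq_of_affine hb hN (fun h => hn ?_) rfl hθ (fun δ => hN0 δ 0)
      (fun δ => hH0 δ 0) b1 b2 b3
    rw [hN, h]; ext i; fin_cases i <;> simp
  · have hr0 (δ : Derivation k E E) : δ (-N 1 / (2 * N 2)) = 0 := by
      rw [der_div δ _ (by simpa using hN2), der_mul, map_neg, hN0, hN0, der_ofNat]; simp
    set r := -N 1 / (2 * N 2) with hr
    have hbr : b.z ≠ r := fun h => hb.dz_ne (by rw [h, hr0])
    let M : (Fin 3 → E) → Fin 3 → E := fun v =>
      ![v 2, -(v 1 + 2 * r * v 2), v 0 + r * v 1 + r ^ 2 * v 2]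
    have hMq : ∀ p q, qbr (M p) (M q) = M (qbr p q) := by
      intro p q
      ext i; fin_cases i <;> simp only [M, qbr, Matrix.cons_val] <;> simp <;> ring
    obtain ⟨b', h1, h2, h3⟩ := exists_datum_v_eq_of_affine (a := a) (n := N 2)
      (Datum.inv_isDatum hbr hb (hr0 D)) (N := M N) (H := M H) (Y := M Y) (h := M H 0)
      (by
        ext i; fin_cases i
        · simp [M]
        · simp [M, hr]; field_simp; ring
        · simp [M, hr]; field_simp; linear_combination -disc)
      hN2 rfl
      (fun δ => by
        rw [(Datum.inv_v hbr hb.w1_ne δ (hr0 δ)).2, hθ]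
        ext i; fin_cases i <;> simp [M] <;> ring)
      (fun δ => hN0 δ 2) (fun δ => hH0 δ 2)
      (by rw [hMq, b1])
      (by rw [hMq, b2]; ext i; fin_cases i <;> simp [M] <;> ring) (by rw [hMq, b3])
    refine ⟨b', h1, ?_, h3⟩
    rw [h2]
    have hd : D (b.z - r) = D b.z := by simp [hr0]
    have h4 : schw D (b.inv r).z = schw D (b.z - r) := schw_inv D (by rw [hd]; exact hb.dz_ne)
    rw [h4]
    simp only [schw, hd]

end gauge

section main
variable {k E : Type*} [Field k] [Field E] [Algebra k E] [CharZero E]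

/-- The jets of solutions with distinct Schwarzians are as independent as possible. -/
theorem exists_derivation_v_pi [IsAlgClosed k] [IsAlgClosed E] {c0 c1 : k} (h01 : c0 ≠ c1)
    {D : Derivation k E E} (hker : ∀ x, D x = 0 → ∀ δ : Derivation k E E, δ x = 0)
    {I : Type*} [Finite I] (a : I → Datum E)
    (ha : ∀ i, IsDatum (algebraMap k E c0) (algebraMap k E c1) D (a i))
    (hai : ∀ i, AlgebraicIndependent k ![(a i).z, (a i).w, (a i).w1, (a i).w2])
    (hs : Function.Injective fun i => schw D (a i).z) (c : I → Fin 3 → E) :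
    ∃ δ : Derivation k E E, ∀ i, (a i).v (algebraMap k E c0) (algebraMap k E c1) δ = c i := by
  set d0 := algebraMap k E c0
  set d1 := algebraMap k E c1
  let V : Derivation k E E →ₗ[E] (I → Fin 3 → E) := LinearMap.pi fun i => (a i).v d0 d1
  have hlie : ∀ δ ε, V ⁅δ, ε⁆ = (fun i j => δ (V ε i j)) - (fun i j => ε (V δ i j)) -
      fun i => qbr (V δ i) (V ε i) := by
    intro δ ε
    funext i
    exact Datum.v_lie (ha i).w1_ne (ha i).w_ne0 (ha i).w_ne1 δ ε
  have hVD : V D = 0 := by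
    funext i; exact (Datum.v_self (ha i)).2
  have hDlie : ∀ δ, V ⁅D, δ⁆ = fun i j => D (V δ i j) := by
    intro δ
    rw [hlie, hVD]
    funext i j
    fin_cases j <;> simp [qbr]
  let Λ : Submodule E (I → Fin 3 → E) := LinearMap.range V
  have hst : ∀ (ε : Derivation k E E), ∀ x ∈ Λ, (fun i j => ε (x i j)) ∈ Λ := by
    intro ε x hx
    have := der_stable_of_stable D hker
      (Λ.comap (LinearEquiv.curry E E I (Fin 3)).toLinearMap) (by
        rintro y ⟨δ, hδ⟩
        refine ⟨⁅D, δ⁆, ?_⟩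
        rw [hDlie, hδ]; rfl) ε (x := Function.uncurry x) (by
        change Function.curry (Function.uncurry x) ∈ Λ
        rwa [Function.curry_uncurry])
    exact this
  have hbr : ∀ x ∈ Λ, ∀ y ∈ Λ, (fun i => qbr (x i) (y i)) ∈ Λ := by
    rintro _ ⟨δ, rfl⟩ _ ⟨ε, rfl⟩
    have h1 := hst δ (V ε) ⟨ε, rfl⟩
    have h2 := hst ε (V δ) ⟨δ, rfl⟩
    have h3 := Λ.sub_mem (Λ.sub_mem h1 h2) ⟨⁅δ, ε⁆, rfl⟩
    rw [hlie] at h3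
    simpa using h3
  have hsurj : ∀ i p, ∃ x ∈ Λ, x i = p := by
    intro i p
    obtain ⟨δ, -, h⟩ := Datum.exists_derivation_v (c0 := d0) (c1 := d1) (ha i).w1_ne (hai i) 0 p
    exact ⟨V δ, ⟨δ, rfl⟩, h⟩
  have hΛ : Λ = ⊤ := by
    refine lie_eq_top Λ hbr hsurj fun i i' hii => ?_
    by_contra hcon
    have hz := lie_pair_dichotomy Λ hbr hsurj i i' hcon
    have hz' : ∀ δ δ', V δ i = V δ' i → V δ i' = V δ' i' := by
      intro δ δ' h
      have := hz (V (δ - δ')) ⟨_, rfl⟩ (by rw [map_sub, Pi.sub_apply, h, sub_self])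
      rwa [map_sub, Pi.sub_apply, sub_eq_zero] at this
    have hex : ∀ p, ∃ δ, V δ i = p := fun p => by
      obtain ⟨_, ⟨δ, rfl⟩, h⟩ := hsurj i p; exact ⟨δ, h⟩
    choose f hf using hex
    let θ : (Fin 3 → E) → Fin 3 → E := fun p => V (f p) i'
    have hθ : ∀ δ, V δ i' = θ (V δ i) := fun δ => hz' _ _ (hf _).symm
    have hθq : ∀ p q, qbr (θ p) (θ q) = θ (qbr p q) := by
      intro p q
      obtain ⟨ε, hε⟩ := hbr (V (f p)) ⟨_, rfl⟩ (V (f q)) ⟨_, rfl⟩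
      have h1 := congrFun hε i'
      rw [hθ, hε] at h1
      simp only [hf] at h1
      exact h1.symm
    have hθc : ∀ p, (∀ j, D (p j) = 0) → ∀ j, D (θ p j) = 0 := by
      intro p hp
      have h1 := hDlie (f p)
      have h2 := hz (V ⁅D, f p⁆) ⟨_, rfl⟩ (by
        rw [h1]; funext j; change D (V (f p) i j) = 0; rw [hf, hp])
      rw [h1] at h2
      intro j
      exact congrFun h2 j
    have hθs : ∀ (r : E) p, θ (r • p) = r • θ p := by
      intro r p
      have h1 := hz' (f (r • p)) (r • f p) (by simp [hf])
      simpa using h1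
    have hdec : ∀ δ, V δ i' = V δ i 0 • θ ![1, 0, 0] + V δ i 1 • θ ![0, 1, 0]
        + V δ i 2 • θ ![0, 0, 1] := by
      intro δ
      rw [hz' δ (V δ i 0 • f ![1, 0, 0] + V δ i 1 • f ![0, 1, 0] + V δ i 2 • f ![0, 0, 1])]
      · simp [θ]
      · simp only [map_add, map_smul, Pi.add_apply, Pi.smul_apply, hf]
        ext j; fin_cases j <;> simp
    have hb1 : qbr (θ ![1, 0, 0]) (θ ![0, 1, 0]) = θ ![1, 0, 0] := by
      rw [hθq]; congr 1; ext j; fin_cases j <;> simp [qbr]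
    have hb2 : qbr (θ ![1, 0, 0]) (θ ![0, 0, 1]) = (2 : E) • θ ![0, 1, 0] := by
      rw [hθq, ← hθs]; congr 1; ext j; fin_cases j <;> simp [qbr]
    have hb3 : qbr (θ ![0, 1, 0]) (θ ![0, 0, 1]) = θ ![0, 0, 1] := by
      rw [hθq]; congr 1; ext j; fin_cases j <;> simp [qbr]
    have hc0 : ∀ (δ : Derivation k E E) j, δ (θ ![1, 0, 0] j) = 0 := fun δ j =>
      hker _ (hθc _ (fun j => by fin_cases j <;> simp) j) δ
    have hc1 : ∀ (δ : Derivation k E E) j, δ (θ ![0, 1, 0] j) = 0 := fun δ j =>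
      hker _ (hθc _ (fun j => by fin_cases j <;> simp) j) δ
    have hN : θ ![1, 0, 0] ≠ 0 := by
      intro h0
      rw [h0] at hb2
      have hH : θ ![0, 1, 0] = 0 := by
        have : (2 : E) • θ ![0, 1, 0] = 0 := by
          rw [← hb2]; ext j; fin_cases j <;> simp [qbr]
        simpa using this
      have hY : θ ![0, 0, 1] = 0 := by
        rw [← hb3, hH]; ext j; fin_cases j <;> simp [qbr]
      obtain ⟨_, ⟨δ, rfl⟩, hδ⟩ := hsurj i' ![1, 0, 0]
      rw [hdec, h0, hH, hY] at hδ
      have := congrFun hδ 0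
      simp at this
    obtain ⟨b', g1, g2, g3⟩ := exists_datum_v_eq (a := a i) (ha i') hN hdec hc0 hc1 hb1 hb2 hb3
    have := z_eq_of_v_eq h01 (ha i) g1 (hai i) g3
    rw [this] at g2
    exact hii (hs g2)
  have : c ∈ Λ := hΛ ▸ Submodule.mem_top
  obtain ⟨δ, hδ⟩ := this
  exact ⟨δ, fun i => congrFun hδ i⟩

end main

section JFacts

open UpperHalfPlane hiding I
open Complex Filter Topology ModularForm EisensteinSeries Derivative
open scoped Manifold MatrixGroups

/-- The punctured-disc coordinate at the cusp, restricted to the upper half-plane. -/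
def qq (z : ℍ) : ℂ := cexp (2 * (Real.pi : ℂ) * I * z)

lemma tendsto_qq : Tendsto qq atImInfty (𝓝 0) := by
  have := UpperHalfPlane.qParam_tendsto_atImInfty (h := 1) one_pos
  refine this.congr fun z => ?_
  simp [qq, Function.Periodic.qParam]

lemma bounded_of_hasSum {F : ℍ → ℂ} {c : ℕ → ℂ} (h : ∀ z, HasSum (fun m => c m * qq z ^ m) (F z)) :
    IsBoundedAtImInfty F :=
  isBoundedAtImInfty_of_hasSum_qExpansion (h := 1) (c := c) one_pos fun τ => by
    simpa [qq, Function.Periodic.qParam, smul_eq_mul] using h τ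

lemma zero_of_mul_qq {F : ℍ → ℂ} (hF : IsBoundedAtImInfty F) :
    Tendsto (fun z => qq z * F z) atImInfty (𝓝 0) := by
  have h1 : qq =o[atImInfty] (fun _ => (1 : ℝ)) := by
    rw [Asymptotics.isLittleO_one_iff]; exact tendsto_qq
  have h2 := h1.mul_isBigO hF
  simpa using h2

lemma tendsto_of_hasSum {F : ℍ → ℂ} {c : ℕ → ℂ} (h : ∀ z, HasSum (fun m => c m * qq z ^ m) (F z)) :
    Tendsto F atImInfty (𝓝 (c 0)) := by
  have hq : ∀ z, qq z ≠ 0 := fun z => exp_ne_zero _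
  have h1 : IsBoundedAtImInfty (fun z => (F z - c 0) / qq z) := by
    apply bounded_of_hasSum (c := fun m => c (m + 1))
    intro z
    have h2 := (hasSum_nat_add_iff' 1).2 (h z)
    have h3 := h2.div_const (qq z)
    simp only [Finset.range_one, Finset.sum_singleton, pow_zero, mul_one] at h3
    have h4 : (fun m => c (m + 1) * qq z ^ m) = fun m => c (m + 1) * qq z ^ (m + 1) / qq z := by
      ext m
      rw [pow_succ, ← mul_assoc, mul_div_cancel_right₀ _ (hq z)]
    rw [h4]; exact h3
  have h2 := zero_of_mul_qq h1
  have h3 := h2.add_const (c 0)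
  rw [zero_add] at h3
  refine h3.congr fun z => ?_
  have := hq z
  field_simp
  ring

lemma tendsto_E2 : Tendsto E2 atImInfty (𝓝 1) := by
  have := tendsto_of_hasSum (F := E2)
      (c := fun m => (if m = 0 then 1 else -24 * (ArithmeticFunction.sigma 1 m : ℂ)))
    fun z => by simpa [qq, smul_eq_mul, Function.Periodic.qParam] using
        hasSum_qExpansion_E2 (z := z)
  simpa using this

lemma tendsto_E {k : ℕ} (hk : 3 ≤ k) (hk2 : Even k) : Tendsto (E hk) atImInfty (𝓝 1) := by
  have := tendsto_of_hasSum (F := E hk) (c := fun m => (qExpansion 1 (E hk)).coeff m)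
    fun z => by
      simpa [qq, smul_eq_mul, Function.Periodic.qParam] using
       ModularForm.hasSum_qExpansion (E hk) one_pos one_mem_strictPeriods_SL z
  simpa [E_qExpansion_coeff_zero hk hk2] using this

/-- A bounded holomorphic function near the cusp has derivative tending to zero. -/
lemma isZero_D {F : ℍ → ℂ} (hF : MDiff F) (hb : IsBoundedAtImInfty F) :
    Tendsto (D F) atImInfty (𝓝 0) := by
  obtain ⟨M, A, hM⟩ := isBoundedAtImInfty_iff.1 hb
  have hd := UpperHalfPlane.mdifferentiable_iff.1 hF
  have key : ∀ z : ℍ, 2 * |A| + 1 ≤ z.im → ‖deriv (F ∘ ofComplex) z‖ ≤ M / (z.im / 2) := by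
    intro z hz
    have hA := le_abs_self A
    have hA0 := abs_nonneg A
    have hpos : 0 < z.im / 2 := by have := z.im_pos; positivity
    have him : ∀ w ∈ Metric.closedBall (z : ℂ) (z.im / 2), z.im / 2 ≤ w.im := by
      intro w hw
      have := (Complex.abs_im_le_norm (w - z)).trans (by simpa [dist_eq_norm] using hw)
      rw [Complex.sub_im] at this
      have := (abs_le.1 this).1
      have h5 : ((z : ℂ)).im = z.im := rfl
      linarith
    refine norm_deriv_le_of_forall_mem_sphere_norm_le hpos ?_ ?_
    · apply DifferentiableOn.diffContOnCl
      rw [closure_ball _ hpos.ne']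
      exact hd.mono fun w hw => lt_of_lt_of_le hpos (him w hw)
    · intro w hw
      have h6 := him w (Metric.sphere_subset_closedBall hw)
      have h7 : 0 < w.im := lt_of_lt_of_le hpos h6
      rw [Function.comp_apply, ofComplex_apply_of_im_pos h7]
      apply hM
      show A ≤ w.im
      linarith
  rw [tendsto_zero_iff_norm_tendsto_zero]
  have him : Tendsto (fun z : ℍ => z.im) atImInfty atTop := tendsto_comap
  have h1 : Tendsto (fun z : ℍ => ‖(2 * (Real.pi : ℂ) * I)⁻¹‖ * (M / (z.im / 2)))
      atImInfty (𝓝 0) := by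
    have : Tendsto (fun z : ℍ => M / (z.im / 2)) atImInfty (𝓝 0) :=
      (tendsto_const_nhds (x := M)).div_atTop (him.atTop_div_const two_pos)
    simpa using this.const_mul ‖(2 * (Real.pi : ℂ) * I)⁻¹‖
  refine squeeze_zero' (Eventually.of_forall fun z => norm_nonneg _) ?_ h1
  filter_upwards [him.eventually_ge_atTop (2 * |A| + 1)] with z hz
  rw [normalizedDerivOfComplex, norm_mul]
  exact mul_le_mul_of_nonneg_left (key z hz) (norm_nonneg _)

/-- A level-one modular form from its defining properties. -/
def mkMF {k : ℤ} (f : ℍ → ℂ) (hf : MDiff f) (hi : ∀ γ : SL(2, ℤ), f ∣[k] γ = f)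
    (hb : IsBoundedAtImInfty f) : ModularForm 𝒮ℒ k where
  toFun := f
  slash_action_eq' := fun _ ⟨γ, hγ⟩ ↦ hγ ▸ hi γ
  holo' := hf
  bdd_at_cusps' {c} hc := by
    rw [Subgroup.IsArithmetic.isCusp_iff_isCusp_SL2Z] at hc
    rw [OnePoint.isBoundedAt_iff_forall_SL2Z hc]
    intro γ _
    rw [hi γ]; exact hb

/-- A level-one cusp form from its defining properties. -/
def mkCF {k : ℤ} (f : ℍ → ℂ) (hf : MDiff f) (hi : ∀ γ : SL(2, ℤ), f ∣[k] γ = f)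
    (hb : IsZeroAtImInfty f) : CuspForm 𝒮ℒ k where
  toFun := f
  slash_action_eq' := fun _ ⟨γ, hγ⟩ ↦ hγ ▸ hi γ
  holo' := hf
  zero_at_cusps' {c} hc := by
    rw [Subgroup.IsArithmetic.isCusp_iff_isCusp_SL2Z] at hc
    rw [OnePoint.isZeroAt_iff_forall_SL2Z hc]
    intro γ _
    rw [hi γ]; exact hb

lemma E_slash {k : ℕ} (hk : 3 ≤ k) (γ : SL(2, ℤ)) : (E hk : ℍ → ℂ) ∣[(k : ℤ)] γ = E hk :=
  (E hk).slash_action_eq' _ ⟨γ, rfl⟩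

lemma isBounded_of_tendsto {f : ℍ → ℂ} {c : ℂ} (h : Tendsto f atImInfty (𝓝 c)) :
    IsBoundedAtImInfty f := h.isBigO_one ℝ

lemma exists_smul_of_rank_one {k : ℤ} (hr : Module.rank ℂ (ModularForm 𝒮ℒ k) = 1)
    (g f : ModularForm 𝒮ℒ k) (hg : Tendsto g atImInfty (𝓝 1)) {a : ℂ}
    (hf : Tendsto f atImInfty (𝓝 a)) : ∀ z, f z = a * g z := by
  have hg0 : g ≠ 0 := by
    rintro rfl
    have : Tendsto (fun _ : ℍ => (0 : ℂ)) atImInfty (𝓝 1) := hg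
    exact zero_ne_one (tendsto_nhds_unique tendsto_const_nhds this)
  obtain ⟨c, rfl⟩ := (finrank_eq_one_iff_of_nonzero' _ hg0).1
    (Module.rank_eq_one_iff_finrank_eq_one.mp hr) f
  have h2 : Tendsto (fun z => c * g z) atImInfty (𝓝 (c * 1)) := hg.const_mul c
  have : a = c * 1 := tendsto_nhds_unique hf h2
  intro z
  rw [this, mul_one]; rfl

lemma ramanujan_E4 (z : ℍ) : D E₄ z = (E2 z * E₄ z - E₆ z) / 3 := by
  have hE4 : MDiff (E₄ : ℍ → ℂ) := E₄.holo'
  have ht : Tendsto (serreDerivative 4 E₄) atImInfty (𝓝 (0 - 4 * 12⁻¹ * 1 * 1)) :=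
    (isZero_D hE4 (isBounded_of_tendsto (tendsto_E _ ⟨2, rfl⟩))).sub
      ((tendsto_E2.const_mul (4 * 12⁻¹)).mul (tendsto_E _ ⟨2, rfl⟩))
  have h := exists_smul_of_rank_one (k := 6) levelOne_weight_six_rank_one E₆
    (mkMF (serreDerivative 4 E₄) (serreDerivative_mdifferentiable 4 hE4)
      (fun γ => by
        have := serreDerivative_slash_invariant (k := 4) hE4 (γ := γ) (E_slash (k := 4) _ γ)
        simpa using this) (isBounded_of_tendsto ht)) (tendsto_E _ ⟨3, rfl⟩) ht z
  have h_rel : D E₄ z - 4 * 12⁻¹ * E2 z * E₄ z = (0 - 4 * 12⁻¹ * 1 * 1) * E₆ z := h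
  linear_combination h_rel

/-- `D E₂ - E₂²/12` is a modular form of weight four. -/
lemma DE2_slash (γ : SL(2, ℤ)) :
    (fun z : ℍ => D E2 z - E2 z ^ 2 / 12) ∣[(4 : ℤ)] γ = fun z : ℍ => D E2 z - E2 z ^ 2 / 12 := by
  have hE := E2_mdifferentiable
  have hs := E2_slash_action γ
  have h1 := normalizedDerivOfComplex_SL_slash (k := 2) hE (γ := γ)
  have hpi : (Real.pi : ℂ) ≠ 0 := by exact_mod_cast Real.pi_ne_zero
  have hk : (1 / (2 * riemannZeta 2) : ℂ) = 3 / (Real.pi : ℂ) ^ 2 := by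
    rw [riemannZeta_two]; field_simp; norm_num
  rw [hk] at hs
  ext z
  have hdn := denom_ne_zero γ z
  have hden : ∀ w : ℍ, denom γ w = (γ 1 0 : ℂ) * w + (γ 1 1 : ℂ) := fun w => by
    simp [denom]
  have hsz : ∀ w : ℍ, (E2 ∣[(2 : ℤ)] γ) w = E2 w - 3 / (Real.pi : ℂ) ^ 2 *
      (2 * Real.pi * I * γ 1 0 / denom γ w) := fun w => by
    rw [hs]; rfl
  have hE' : DifferentiableAt ℂ (E2 ∘ ofComplex) z := mdifferentiableAt_iff.mp (hE z)
  have hDz : D (E2 ∣[(2 : ℤ)] γ) z = D E2 z + 3 / (Real.pi : ℂ) ^ 2 * (γ 1 0 / denom γ z) ^ 2 := by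
    have hc : ((E2 ∣[(2 : ℤ)] γ) ∘ ofComplex) =ᶠ[𝓝 (z : ℂ)] fun w => (E2 ∘ ofComplex) w -
        3 / (Real.pi : ℂ) ^ 2 * (2 * Real.pi * I * γ 1 0 / ((γ 1 0 : ℂ) * w + (γ 1 1 : ℂ))) := by
      filter_upwards [isOpen_upperHalfPlaneSet.mem_nhds z.im_pos] with w hw
      rw [Function.comp_apply, hsz, hden, Function.comp_apply, ofComplex_apply_of_im_pos hw]
    have hl : HasDerivAt (fun w : ℂ => (γ 1 0 : ℂ) * w + (γ 1 1 : ℂ)) (γ 1 0 : ℂ) z := by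
      simpa using ((hasDerivAt_id (z : ℂ)).const_mul (γ 1 0 : ℂ)).add_const (γ 1 1 : ℂ)
    have hn : (γ 1 0 : ℂ) * z + (γ 1 1 : ℂ) ≠ 0 := by rw [← hden]; exact hdn
    have hd := hE'.hasDerivAt.sub ((((hasDerivAt_const (z : ℂ)
      (2 * Real.pi * I * γ 1 0 : ℂ))).div hl hn).const_mul (3 / (Real.pi : ℂ) ^ 2))
    have hd2 : deriv (fun w => (E2 ∘ ofComplex) w -
        3 / (Real.pi : ℂ) ^ 2 *
            (2 * Real.pi * I * γ 1 0 / ((γ 1 0 : ℂ) * w + (γ 1 1 : ℂ)))) z = _ :=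
      hd.deriv
    rw [normalizedDerivOfComplex, hc.deriv_eq, hd2, normalizedDerivOfComplex, hden]
    field_simp
    ring
  have h2 := congrFun h1 z
  rw [hDz] at h2
  simp only [Pi.sub_apply, hsz] at h2
  have h3 : ((fun z : ℍ => D E2 z - E2 z ^ 2 / 12) ∣[(4 : ℤ)] γ) z =
      (D E2 ∣[(2 + 2 : ℤ)] γ) z - ((E2 ∣[(2 : ℤ)] γ) z) ^ 2 / 12 := by
    simp only [SL_slash_apply]
    have : (denom γ z) ^ (-4 : ℤ) = ((denom γ z) ^ (-2 : ℤ)) ^ 2 := by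
      rw [← zpow_natCast, ← zpow_mul]; norm_num
    norm_num only
    rw [this]
    ring
  have h4 : (D E2 ∣[(2 + 2 : ℤ)] γ) z = D E2 z + 3 / (Real.pi : ℂ) ^ 2 * (γ 1 0 / denom γ z) ^ 2 +
     ((2 : ℤ) : ℂ) * (2 * Real.pi * I)⁻¹ * (γ 1 0 / denom γ z) * (E2 z - 3 / (Real.pi : ℂ) ^ 2 *
      (2 * Real.pi * I * γ 1 0 / denom γ z)) := by
    rw [h2]; ring
  rw [h3, hsz, h4]
  have hI := I_sq
  push_cast
  field_simp
  linear_combination (12 * (Real.pi : ℂ) * denom γ z * (γ 1 0 : ℂ) * E2 z -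
    36 * (γ 1 0 : ℂ) ^ 2 * I) * hI

lemma ramanujan_E2 (z : ℍ) : D E2 z = (E2 z ^ 2 - E₄ z) / 12 := by
  have hE := E2_mdifferentiable
  have ht : Tendsto (fun z : ℍ => D E2 z - E2 z ^ 2 / 12) atImInfty (𝓝 (0 - 1 ^ 2 / 12)) :=
    (isZero_D hE (isBounded_of_tendsto tendsto_E2)).sub ((tendsto_E2.pow 2).div_const 12)
  have hM : MDiff ((fun z => D E2 z - E2 z ^ 2 / 12) : ℍ → ℂ) := by
    refine (normalizedDerivOfComplex_mdifferentiable hE).sub ?_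
    have h : MDiff ((fun z => E2 z ^ 2 / 12) : ℍ → ℂ) := by
      have := (MDifferentiable.mul (mdifferentiable_const (c := (12 : ℂ)⁻¹)) (hE.mul hE) :
        MDiff ((fun z ↦ (12 : ℂ)⁻¹ * (E2 z * E2 z)) : ℍ → ℂ))
      convert! this using 2
      simp only [Pi.mul_apply]
      ring
    exact h
  have h := exists_smul_of_rank_one (k := 4) levelOne_weight_four_rank_one E₄
    (mkMF _ hM DE2_slash (isBounded_of_tendsto ht)) (tendsto_E _ ⟨2, rfl⟩) ht z
  have h' : D E2 z - E2 z ^ 2 / 12 = (0 - 1 ^ 2 / 12) * E₄ z := h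
  linear_combination h'

lemma deriv_disc (z : ℍ) : D discriminant z = E2 z * discriminant z := by
  have h1 := logDeriv_eta_eq_E2 z
  have hη : DifferentiableAt ℂ ModularForm.eta z :=
      differentiableAt_eta_of_mem_upperHalfPlaneSet z.2
  have hη0 : ModularForm.eta z ≠ 0 := eta_ne_zero z.2
  rw [logDeriv_apply, div_eq_iff hη0] at h1
  have h2 : (discriminant ∘ ofComplex) =ᶠ[𝓝 (z : ℂ)] fun w => ModularForm.eta w ^ 24 := by
    filter_upwards [isOpen_upperHalfPlaneSet.mem_nhds z.im_pos] with w hw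
    simp [discriminant, ofComplex_apply_of_im_pos hw]
  rw [normalizedDerivOfComplex, h2.deriv_eq, deriv_fun_pow hη, h1, discriminant]
  have := Real.pi_ne_zero
  field_simp
  push_cast
  ring

end JFacts

section JFacts

open UpperHalfPlane hiding I
open Complex Filter Topology ModularForm EisensteinSeries Derivative
open scoped Manifold MatrixGroups

variable {j : ℂ → ℂ} (hj : IsModularJ j)

lemma isOpen_HH : IsOpen HH := isOpen_upperHalfPlaneSet

include hj

lemma mdiff_j : MDiff (fun z : ℍ => j z : ℍ → ℂ) := by
  rw [UpperHalfPlane.mdifferentiable_iff]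
  refine hj.holo.congr fun w hw => ?_
  simp [ofComplex_apply_of_im_pos (show 0 < w.im from hw)]

lemma j_smul (γ : SL(2, ℤ)) (z : ℍ) : j ((γ • z : ℍ) : ℂ) = j z := by
  rw [← hj.invariant γ.1 γ.2 z z.im_pos]
  congr 1
  rw [UpperHalfPlane.specialLinearGroup_apply]
  simp [moeb, zmat]

lemma tendsto_j_sub : Tendsto (fun z : ℍ => j z - (qq z)⁻¹ - 744) atImInfty (𝓝 0) := by
  obtain ⟨a, ha⟩ := hj.fourier
  have hb : IsBoundedAtImInfty (fun z : ℍ => (j z - (qq z)⁻¹ - 744) / qq z) := by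
    apply bounded_of_hasSum (c := a)
    intro z
    have h3 := (ha z z.im_pos).div_const (qq z)
    have h4 : (fun m => a m * qq z ^ m) =
        fun m => a m * cexp (2 * (Real.pi : ℂ) * I * z) ^ (m + 1) / qq z := by
      ext m
      rw [pow_succ, ← mul_assoc]
      exact (mul_div_cancel_right₀ _ (exp_ne_zero _)).symm
    rw [h4]; exact h3
  refine (zero_of_mul_qq hb).congr fun z => ?_
  have : qq z ≠ 0 := exp_ne_zero _
  field_simp

lemma tendsto_j_disc : Tendsto (fun z : ℍ => j z * discriminant z) atImInfty (𝓝 1) := by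
  have h1 : Tendsto (fun z : ℍ => discriminant z / qq z) atImInfty (𝓝 1) := by
    refine tendsto_atImInfty_tprod_one_sub_eta_q_pow.congr fun z => ?_
    have : qq z ≠ 0 := exp_ne_zero _
    rw [discriminant_eq_q_prod, eq_div_iff this, mul_comm]
    congr 1
    simp [qq, Function.Periodic.qParam]
  have h2 : Tendsto (fun z : ℍ => (discriminant z : ℂ)) atImInfty (𝓝 0) :=
      discriminant_isZeroAtImInfty
  have h3 := (((tendsto_j_sub hj).add_const 744).mul h2).add h1
  rw [mul_zero, zero_add] at h3
  refine h3.congr fun z => ?_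
  have : qq z ≠ 0 := exp_ne_zero _
  field_simp
  ring

lemma exists_j_eq : ∃ e0 : ℂ, ∀ z : ℍ, j z = E₄ z ^ 3 / discriminant z + e0 := by
  have hE4 : MDiff (E₄ : ℍ → ℂ) := E₄.holo'
  have hD : MDiff (discriminant : ℍ → ℂ) := CuspForm.discriminant.holo'
  have hDs : ∀ γ : SL(2, ℤ), (discriminant : ℍ → ℂ) ∣[(12 : ℤ)] γ = discriminant :=
    fun γ => CuspForm.discriminant.slash_action_eq' _ ⟨γ, rfl⟩
  let f : ℍ → ℂ := fun z => j z * discriminant z - E₄ z ^ 3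
  have hf : MDiff f := by
    have h := ((mdiff_j hj).mul hD).sub (hE4.mul (hE4.mul hE4))
    have e : f = (fun z : ℍ => j z) * discriminant - E₄ * (E₄ * E₄) := by
      ext z
      simp only [f, Pi.sub_apply, Pi.mul_apply]
      ring
    rw [e]; exact h
  have hs : ∀ γ : SL(2, ℤ), f ∣[(12 : ℤ)] γ = f := by
    intro γ
    ext z
    have h1 := congrFun (hDs γ) z
    have h2 := congrFun (E_slash (k := 4) (by norm_num) γ) z
    rw [SL_slash_apply] at h1 h2 ⊢
    simp only [f]
    rw [j_smul hj, ← h1, ← h2]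
    have h3 : (denom γ z) ^ (-12 : ℤ) = ((denom γ z) ^ (-((4 : ℕ) : ℤ))) ^ 3 := by
      rw [← zpow_natCast, ← zpow_mul]; norm_num
    rw [h3]
    ring
  have ht : IsZeroAtImInfty f := by
    have := (tendsto_j_disc hj).sub ((tendsto_E (k := 4) (by norm_num) ⟨2, rfl⟩).pow 3)
    rw [one_pow, sub_self] at this
    exact this
  obtain ⟨c, hc⟩ := CuspForm.exists_smul_discriminant_of_weight_eq_twelve (mkCF f hf hs ht)
  refine ⟨c, fun z => ?_⟩
  have h1 : c * discriminant z = j z * discriminant z - E₄ z ^ 3 := congrArg (fun g => g z) hc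
  have h2 := discriminant_ne_zero z
  field_simp
  linear_combination -h1

lemma j_surj (c : ℂ) : ∃ z ∈ HH, j z = c := by
  by_contra! hne
  have h0 : ∀ z : ℍ, j z - c ≠ 0 := fun z => sub_ne_zero.2 (hne z z.im_pos)
  let f : ℍ → ℂ := fun z => 1 / (j z - c)
  have hf : MDiff f := by
    exact mdifferentiable_const.div ((mdiff_j hj).sub mdifferentiable_const) h0
  have hs : ∀ γ : SL(2, ℤ), f ∣[(0 : ℤ)] γ = f := by
    intro γ
    ext z
    rw [SL_slash_apply]
    simp only [f]
    rw [j_smul hj]; simp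
  have ht : Tendsto f atImInfty (𝓝 0) := by
    have h1 : Tendsto (fun z : ℍ => discriminant z) atImInfty (𝓝 0) := discriminant_isZeroAtImInfty
    have h2 := h1.div ((tendsto_j_disc hj).sub (h1.const_mul c)) (by simp)
    rw [zero_div] at h2
    refine h2.congr fun z => ?_
    have h2 := discriminant_ne_zero z
    have := h0 z
    simp only [f, Pi.div_apply]
    rw [← sub_mul]
    field_simp
  obtain ⟨b, hb⟩ := ModularFormClass.levelOne_weight_zero_const
      (mkMF f hf hs (isBounded_of_tendsto ht))
  have hb' : f = Function.const _ b := hb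
  rw [hb'] at ht
  have h3 : b = 0 := tendsto_nhds_unique (tendsto_const_nhds (x := b)) ht
  have h4 : f UpperHalfPlane.I = 0 := by rw [hb', h3]; rfl
  simp only [f] at h4
  exact one_div_ne_zero (h0 _) h4

end JFacts

section JOde

open UpperHalfPlane hiding I
open Complex Filter Topology ModularForm EisensteinSeries Derivative
open scoped Manifold MatrixGroups

lemma hasDerivAt_comp_ofComplex {F : ℍ → ℂ} (hF : MDiff F) (z : ℍ) :
    HasDerivAt (F ∘ ofComplex) (2 * Real.pi * I * Derivative.normalizedDerivOfComplex F z) z := by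
  have h1 := ((UpperHalfPlane.mdifferentiable_iff.1 hF) z z.im_pos).differentiableAt
    (isOpen_HH.mem_nhds z.im_pos)
  convert! h1.hasDerivAt using 1
  rw [Derivative.normalizedDerivOfComplex]
  field_simp

section Ramanujan

variable {U : Set ℂ} (hU : IsOpen U) {c e0 : ℂ} {e2 e4 e6 dl f : ℂ → ℂ} (hc : c ≠ 0)
  (h2 : ∀ w ∈ U, HasDerivAt e2 (c * ((e2 w ^ 2 - e4 w) / 12)) w)
  (h4 : ∀ w ∈ U, HasDerivAt e4 (c * ((e2 w * e4 w - e6 w) / 3)) w)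
  (h6 : ∀ w ∈ U, DifferentiableAt ℂ e6 w)
  (hd : ∀ w ∈ U, HasDerivAt dl (c * (e2 w * dl w)) w)
  (hd0 : ∀ w ∈ U, dl w ≠ 0)
  (hrel : ∀ w ∈ U, dl w = (e4 w ^ 3 - e6 w ^ 2) / 1728)
  (hf : ∀ w ∈ U, f w = e4 w ^ 3 / dl w + e0)

include hU h4 h6 hd hrel

lemma hasDerivAt_e6 {w : ℂ} (hw : w ∈ U) (hw6 : e6 w ≠ 0) :
    HasDerivAt e6 (c * ((e2 w * e6 w - e4 w ^ 2) / 2)) w := by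
  have hn : U ∈ 𝓝 w := hU.mem_nhds hw
  have a := ((h6 w hw).hasDerivAt.pow 2)
  have b := (((h4 w hw).pow 3).sub a).div_const 1728
  have e := (hd w hw).unique (b.congr_of_eventuallyEq
    (Filter.eventually_of_mem hn fun v hv => by simpa using hrel v hv))
  rw [hrel w hw] at e
  convert! (h6 w hw).hasDerivAt using 1
  apply mul_left_cancel₀ hw6
  push_cast at e
  linear_combination (-864) * e

include hf hd0

lemma hasDerivAt_j_ramanujan {w : ℂ} (hw : w ∈ U) :
    HasDerivAt f (-c * (e4 w ^ 2 * e6 w / dl w)) w := by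
  have hn : U ∈ 𝓝 w := hU.mem_nhds hw
  have a := (((h4 w hw).pow 3).div (hd w hw) (hd0 w hw)).add_const e0
  refine (a.congr_of_eventuallyEq
    (Filter.eventually_of_mem hn fun v hv => by simpa using hf v hv)).congr_deriv ?_
  have := hd0 w hw
  simp only [Pi.pow_apply]
  push_cast
  field_simp
  ring

include hc

lemma deriv_ne_zero_iff_of_ramanujan {z : ℂ} (hz : z ∈ U) :
    deriv f z ≠ 0 ↔ f z ≠ e0 ∧ f z ≠ e0 + 1728 := by
  have hz0 := hd0 z hz
  have hr := hrel z hz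
  have z46 : e4 z ^ 3 - e6 z ^ 2 ≠ 0 := fun h => hz0 (by rw [hr, h, zero_div])
  have hf' : f z - e0 = 1728 * e4 z ^ 3 / (e4 z ^ 3 - e6 z ^ 2) := by
    rw [hf z hz, hr]; field_simp; ring
  have hf'' : f z - (e0 + 1728) = 1728 * e6 z ^ 2 / (e4 z ^ 3 - e6 z ^ 2) := by
    have : f z - (e0 + 1728) = (f z - e0) - 1728 := by ring
    rw [this, hf']; field_simp; ring
  rw [(hasDerivAt_j_ramanujan hU h4 h6 hd hd0 hrel hf hz).deriv, ← sub_ne_zero (a := f z),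
    ← sub_ne_zero (a := f z) (b := e0 + 1728), hf', hf'']
  simp [hc, hz0, z46]

include h2

lemma schw_of_ramanujan {z : ℂ} (hz : z ∈ U) (hz1 : deriv f z ≠ 0) :
    deriv^[3] f z = 3 / 2 * (deriv^[2] f z) ^ 2 / deriv f z
      - schwR e0 (e0 + 1728) (f z) * deriv f z ^ 3 := by
  have hj' := fun w hw => hasDerivAt_j_ramanujan (w := w) hU h4 h6 hd hd0 hrel hf hw
  have hz0 := hd0 z hz
  have hr := hrel z hz
  have e1 := (hj' z hz).deriv
  rw [e1] at hz1 ⊢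
  have z4 : e4 z ≠ 0 := by rintro h; simp [h] at hz1
  have z6 : e6 z ≠ 0 := by rintro h; simp [h] at hz1
  have z46 : e4 z ^ 3 - e6 z ^ 2 ≠ 0 := fun h => hz0 (by rw [hr, h, zero_div])
  have hUz : ∀ᶠ w in 𝓝 z, w ∈ U := hU.mem_nhds hz
  have hV : ∀ᶠ w in 𝓝 z, w ∈ U ∧ e6 w ≠ 0 :=
    hUz.and ((h6 z hz).continuousAt.eventually_ne z6)
  have d2 : ∀ w, w ∈ U → e6 w ≠ 0 → HasDerivAt (fun w => -c * (e4 w ^ 2 * e6 w / dl w))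
      (-c ^ 2 * ((e2 w * e4 w ^ 2 * e6 w / 6 - 2 / 3 * e4 w * e6 w ^ 2 - e4 w ^ 4 / 2) /
          dl w)) w := by
    intro w hw hw6
    have a := (((((h4 w hw).pow 2).mul (hasDerivAt_e6 hU h4 h6 hd hrel hw hw6)).div (hd w hw)
      (hd0 w hw)).const_mul (-c))
    refine a.congr_deriv ?_
    have := hd0 w hw
    simp only [Pi.pow_apply, Pi.mul_apply]
    push_cast
    field_simp
    ring
  have ev1 : deriv f =ᶠ[𝓝 z] fun w => -c * (e4 w ^ 2 * e6 w / dl w) :=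
    hV.mono fun w hw => (hj' w hw.1).deriv
  have ev2 : deriv^[2] f =ᶠ[𝓝 z] fun w => -c ^ 2 *
      ((e2 w * e4 w ^ 2 * e6 w / 6 - 2 / 3 * e4 w * e6 w ^ 2 - e4 w ^ 4 / 2) / dl w) :=
    ev1.deriv.trans (hV.mono fun w hw => (d2 w hw.1 hw.2).deriv)
  have g2 := h2 z hz
  have g4 := h4 z hz
  have g6 := hasDerivAt_e6 hU h4 h6 hd hrel hz z6
  have a := ((((((g2.mul (g4.pow 2)).mul g6).div_const 6).sub
    ((g4.const_mul (2 / 3)).mul (g6.pow 2))).sub ((g4.pow 4).div_const 2)).div (hd z hz)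
      hz0).const_mul (-c ^ 2)
  have e3 : deriv^[3] f z = _ := (ev2.deriv.eq_of_nhds).trans a.deriv
  rw [e3, ev2.eq_of_nhds]
  simp only [Pi.pow_apply, Pi.mul_apply, Pi.sub_apply]
  have hf' : f z - e0 = 1728 * e4 z ^ 3 / (e4 z ^ 3 - e6 z ^ 2) := by
    rw [hf z hz, hr]; field_simp; ring
  have hf'' : f z - (e0 + 1728) = 1728 * e6 z ^ 2 / (e4 z ^ 3 - e6 z ^ 2) := by
    have : f z - (e0 + 1728) = (f z - e0) - 1728 := by ring
    rw [this, hf']; field_simp; ring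
  rw [schwR, hf', hf'', hr]
  push_cast
  field_simp
  ring

end Ramanujan

variable {j : ℂ → ℂ} (hj : IsModularJ j)

include hj

theorem j_ode : ∃ e0 e1 : ℂ, e0 ≠ e1 ∧ ∀ z ∈ HH,
    (deriv j z ≠ 0 ↔ j z ≠ e0 ∧ j z ≠ e1) ∧
    (deriv j z ≠ 0 → deriv^[3] j z = 3 / 2 * (deriv^[2] j z) ^ 2 / deriv j z
      - schwR e0 e1 (j z) * deriv j z ^ 3) := by
  obtain ⟨e0, he⟩ := exists_j_eq hj
  have up : ∀ w ∈ HH, ∃ z : ℍ, (z : ℂ) = w := fun w hw => ⟨⟨w, hw⟩, rfl⟩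
  have key : ∀ (F : ℍ → ℂ) (z : ℍ), (F ∘ ofComplex) z = F z := fun F z => by simp
  have hc : 2 * Real.pi * I ≠ 0 := by simp [Real.pi_ne_zero]
  have h2 : ∀ w ∈ HH, HasDerivAt (E2 ∘ ofComplex) (2 * Real.pi * I *
      (((E2 ∘ ofComplex) w ^ 2 - (E₄ ∘ ofComplex) w) / 12)) w := fun w hw => by
    obtain ⟨w, rfl⟩ := up w hw
    simp only [key, ← ramanujan_E2]
    exact hasDerivAt_comp_ofComplex E2_mdifferentiable w
  have h4 : ∀ w ∈ HH, HasDerivAt (E₄ ∘ ofComplex) (2 * Real.pi * I * (((E2 ∘ ofComplex) w *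
      (E₄ ∘ ofComplex) w - (E₆ ∘ ofComplex) w) / 3)) w := fun w hw => by
    obtain ⟨w, rfl⟩ := up w hw
    simp only [key, ← ramanujan_E4]
    exact hasDerivAt_comp_ofComplex E₄.holo' w
  have hd : ∀ w ∈ HH, HasDerivAt (discriminant ∘ ofComplex) (2 * Real.pi * I *
      ((E2 ∘ ofComplex) w * (discriminant ∘ ofComplex) w)) w := fun w hw => by
    obtain ⟨w, rfl⟩ := up w hw
    simp only [key, ← deriv_disc]
    exact hasDerivAt_comp_ofComplex CuspForm.discriminant.holo' w
  have h6 : ∀ w ∈ HH, DifferentiableAt ℂ (E₆ ∘ ofComplex) w := fun w hw => by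
    obtain ⟨w, rfl⟩ := up w hw
    exact (hasDerivAt_comp_ofComplex E₆.holo' w).differentiableAt
  have hd0 : ∀ w ∈ HH, (discriminant ∘ ofComplex) w ≠ 0 := fun w hw => discriminant_ne_zero
      (ofComplex w)
  have hrel : ∀ w ∈ HH, (discriminant ∘ ofComplex) w =
      ((E₄ ∘ ofComplex) w ^ 3 - (E₆ ∘ ofComplex) w ^ 2) / 1728 :=
    fun w hw => discriminant_eq_E₄_cube_sub_E₆_sq (ofComplex w)
  have hf : ∀ w ∈ HH, j w = (E₄ ∘ ofComplex) w ^ 3 / (discriminant ∘ ofComplex) w + e0 :=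
    fun w hw => by
      obtain ⟨w, rfl⟩ := up w hw
      simp only [key]
      exact he w
  exact ⟨e0, e0 + 1728, by simp, fun z hz =>
    ⟨deriv_ne_zero_iff_of_ramanujan isOpen_HH hc h4 h6 hd hd0 hrel hf hz,
      schw_of_ramanujan isOpen_HH hc h2 h4 h6 hd hd0 hrel hf hz⟩⟩

end JOde

section Jets

open Complex Filter Topology

variable {D : Derivation ℚ ℂ ℂ} {g h : ℂ → ℂ} {u : ℂ}

/-- The derivation `D` is compatible with all derivatives of `g` at `u`. -/
def JetAt (D : Derivation ℚ ℂ ℂ) (g : ℂ → ℂ) (u : ℂ) : Prop :=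
  AnalyticAt ℂ g u ∧ ∀ k, D (deriv^[k] g u) = deriv^[k + 1] g u * D u

lemma iterate_deriv_congr {g h : ℂ → ℂ} (e : g =ᶠ[𝓝 u] h) (k : ℕ) :
    deriv^[k] g =ᶠ[𝓝 u] deriv^[k] h := by
  induction k generalizing g h with
  | zero => exact e
  | succ k ih => exact ih e.deriv

lemma AnalyticAt.iterate_deriv' (hg : AnalyticAt ℂ g u) (k : ℕ) :
    AnalyticAt ℂ (deriv^[k] g) u := by
  induction k generalizing g with
  | zero => exact hg
  | succ k ih => exact ih hg.deriv

lemma iterate_deriv_add (hg : AnalyticAt ℂ g u) (hh : AnalyticAt ℂ h u) (k : ℕ) :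
    deriv^[k] (g + h) u = deriv^[k] g u + deriv^[k] h u := by
  induction k generalizing g h with
  | zero => rfl
  | succ k ih =>
    have e : deriv (g + h) =ᶠ[𝓝 u] deriv g + deriv h := by
      filter_upwards [hg.eventually_analyticAt, hh.eventually_analyticAt] with w h1 h2
      exact deriv_add h1.differentiableAt h2.differentiableAt
    have := (iterate_deriv_congr e k).eq_of_nhds
    simp only [Function.iterate_succ, Function.comp] at this ⊢
    rw [this, ih hg.deriv hh.deriv]

lemma JetAt.deriv (hg : JetAt D g u) : JetAt D (deriv g) u :=
  ⟨hg.1.deriv, fun k => hg.2 (k + 1)⟩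

lemma JetAt.map (hg : JetAt D g u) : D (g u) = _root_.deriv g u * D u := hg.2 0

lemma JetAt.congr (hg : JetAt D g u) (e : g =ᶠ[𝓝 u] h) : JetAt D h u :=
  ⟨hg.1.congr e, fun k => by
    rw [← (iterate_deriv_congr e k).eq_of_nhds, ← (iterate_deriv_congr e (k + 1)).eq_of_nhds,
      hg.2]⟩

lemma JetAt.add (hg : JetAt D g u) (hh : JetAt D h u) : JetAt D (g + h) u :=
  ⟨hg.1.add hh.1, fun k => by
    rw [iterate_deriv_add hg.1 hh.1, iterate_deriv_add hg.1 hh.1, map_add, hg.2, hh.2, add_mul]⟩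

lemma iterate_deriv_const (c : ℂ) (k : ℕ) : _root_.deriv^[k + 1] (fun _ : ℂ => c) = fun _ => 0 := by
  induction k with
  | zero => ext; simp
  | succ k ih => rw [Function.iterate_succ_apply', ih]; ext; simp

lemma jetAt_const {c : ℂ} (hc : D c = 0) : JetAt D (fun _ => c) u := by
  refine ⟨analyticAt_const, fun k => ?_⟩
  rw [iterate_deriv_const, zero_mul]
  cases k with
  | zero => exact hc
  | succ k => rw [iterate_deriv_const]; exact map_zero D

lemma jetAt_id : JetAt D id u := by
  refine ⟨analyticAt_id, fun k => ?_⟩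
  have e : _root_.deriv (id : ℂ → ℂ) = fun _ => 1 := by ext; simp
  cases k with
  | zero => simp
  | succ k =>
    have h1 : JetAt D (fun _ => (1 : ℂ)) u := jetAt_const (by simp)
    have := h1.2 k
    rwa [← e] at this

lemma JetAt.mul (hg : JetAt D g u) (hh : JetAt D h u) : JetAt D (g * h) u := by
  refine ⟨hg.1.mul hh.1, fun k => ?_⟩
  have e : ∀ {g h : ℂ → ℂ}, JetAt D g u → JetAt D h u → _root_.deriv (g * h) =ᶠ[𝓝 u]
      _root_.deriv g * h + g * _root_.deriv h := by
    intro g h hg hh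
    filter_upwards [hg.1.eventually_analyticAt, hh.1.eventually_analyticAt] with w h1 h2
    exact (h1.differentiableAt.hasDerivAt.mul h2.differentiableAt.hasDerivAt).deriv
  induction k generalizing g h with
  | zero =>
    rw [zero_add, Function.iterate_one, (e hg hh).eq_of_nhds]
    simp only [Function.iterate_zero, id, Pi.mul_apply, Pi.add_apply,
      Derivation.leibniz, smul_eq_mul, hg.map, hh.map]
    ring
  | succ k ih =>
    have e1 := (iterate_deriv_congr (e hg hh) k).eq_of_nhds
    have e2 := (iterate_deriv_congr (e hg hh) (k + 1)).eq_of_nhds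
    rw [iterate_deriv_add (hg.1.deriv.mul hh.1) (hg.1.mul hh.1.deriv)] at e1 e2
    rw [Function.iterate_succ_apply, e1, Function.iterate_succ_apply, e2, map_add,
      ih hg.deriv hh, ih hg hh.deriv, add_mul]

lemma JetAt.comp_mul {f : ℂ → ℂ} (hg : JetAt D g (h u)) (hh : JetAt D h u) (hf : JetAt D f u) :
    JetAt D ((g ∘ h) * f) u := by
  refine ⟨(hg.1.comp hh.1).mul hf.1, fun k => ?_⟩
  have e : ∀ {g f : ℂ → ℂ}, JetAt D g (h u) → JetAt D f u → _root_.deriv ((g ∘ h) * f) =ᶠ[𝓝 u]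
      (_root_.deriv g ∘ h) * (_root_.deriv h * f) + (g ∘ h) * _root_.deriv f := by
    intro g f hg hf
    filter_upwards [hh.1.continuousAt.eventually hg.1.eventually_analyticAt,
      hh.1.eventually_analyticAt, hf.1.eventually_analyticAt] with w h1 h2 h3
    have d := (h1.differentiableAt.hasDerivAt.comp w h2.differentiableAt.hasDerivAt).mul
      h3.differentiableAt.hasDerivAt
    rw [d.deriv]
    simp only [Pi.add_apply, Pi.mul_apply, Function.comp]
    ring
  induction k generalizing g f with
  | zero =>
    rw [zero_add, Function.iterate_one, (e hg hf).eq_of_nhds]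
    simp only [Function.iterate_zero, id, Pi.mul_apply, Pi.add_apply, Function.comp,
      Derivation.leibniz, smul_eq_mul, hg.map, hh.map, hf.map]
    ring
  | succ k ih =>
    have A : ∀ {g f : ℂ → ℂ}, JetAt D g (h u) → JetAt D f u → AnalyticAt ℂ ((g ∘ h) * f) u :=
      fun hg hf => (hg.1.comp hh.1).mul hf.1
    have hhf := hh.deriv.mul hf
    have e1 := (iterate_deriv_congr (e hg hf) k).eq_of_nhds
    have e2 := (iterate_deriv_congr (e hg hf) (k + 1)).eq_of_nhds
    rw [iterate_deriv_add (A hg.deriv hhf) (A hg hf.deriv)] at e1 e2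
    rw [Function.iterate_succ_apply, e1, Function.iterate_succ_apply, e2, map_add,
      ih hg.deriv hhf, ih hg hf.deriv, add_mul]

lemma JetAt.comp (hg : JetAt D g (h u)) (hh : JetAt D h u) : JetAt D (g ∘ h) u := by
  have := hg.comp_mul hh (jetAt_const (c := 1) (by simp))
  refine this.congr (.of_eq ?_)
  ext; simp

lemma eqOn_zero_of_jetAt {U : Set ℂ} (hc : IsPreconnected U)
    (hg : ∀ w ∈ U, JetAt D g w) (hu : u ∈ U) (hDu : D u ≠ 0) (h0 : g u = 0) : Set.EqOn g 0 U := by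
  have hk : ∀ k, _root_.deriv^[k] g u = 0 := by
    intro k
    induction k with
    | zero => exact h0
    | succ k ih =>
      have := (hg u hu).2 k
      rw [ih, map_zero] at this
      exact (mul_eq_zero.1 this.symm).resolve_right hDu
  refine AnalyticOnNhd.eqOn_zero_of_preconnected_of_eventuallyEq_zero
    (fun w hw => (hg w hw).1) hc hu ?_
  refine analyticOrderAt_eq_top.1 (ENat.eq_top_iff_forall_ge.2 fun m => ?_)
  rw [natCast_le_analyticOrderAt_iff_iteratedDeriv_eq_zero (hg u hu).1]
  intro i _
  rw [iteratedDeriv_eq_iterate, hk]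

end Jets

section Mahler

open Complex Filter Topology

lemma eval_curve {σ : Type*} (T : MvPolynomial σ ℂ) (q : σ → Polynomial ℂ) {S : Set ℂ}
    (hS : S.Infinite) (h : ∀ s ∈ S, MvPolynomial.eval (fun i => (q i).eval s) T = 0) (s : ℂ) :
    MvPolynomial.eval (fun i => (q i).eval s) T = 0 := by
  have e : ∀ s, (MvPolynomial.aeval q T).eval s = MvPolynomial.eval (fun i => (q i).eval s) T := by
    intro s
    rw [← Polynomial.coe_aeval_eq_eval, ← AlgHom.comp_apply, MvPolynomial.comp_aeval]
    simp [MvPolynomial.aeval_eq_eval]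
  have : MvPolynomial.aeval q T = 0 :=
    Polynomial.eq_zero_of_infinite_isRoot _ (hS.mono fun s hs => by
      simp only [Set.mem_ofPred_eq, Polynomial.IsRoot.def, e, h s hs])
  rw [← e, this, Polynomial.eval_zero]

lemma infinite_range_intCast : (Set.range ((↑) : ℤ → ℂ)).Infinite :=
  Set.infinite_range_of_injective Int.cast_injective

variable {j : ℂ → ℂ} (hj : IsModularJ j)

include hj

lemma analyticAt_j {z : ℂ} (hz : z ∈ HH) : AnalyticAt ℂ j z :=
  hj.holo.analyticAt (isOpen_HH.mem_nhds hz)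

lemma j_moeb {a b c d : ℤ} (h : a * d - b * c = 1) {z : ℂ} (hz : z ∈ HH) :
    j ((a * z + b) / (c * z + d)) = j z := by
  have := hj.invariant !![a, b; c, d] (by rw [Matrix.det_fin_two_of, h]) z hz
  simpa [moeb, zmat] using this

omit hj in
lemma denom_ne_zero' {a b c d : ℤ} (h : a * d - b * c = 1) {z : ℂ} (hz : z ∈ HH) :
    (c * z + d : ℂ) ≠ 0 := by
  intro h0
  have hi := congrArg Complex.im h0
  have hr := congrArg Complex.re h0
  simp at hi hr
  have hz' : z.im ≠ 0 := ne_of_gt hz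
  have hc : c = 0 := by simpa [hz'] using hi
  subst hc
  simp at hr
  subst hr
  simp at h

omit hj in
lemma moeb_mem {a b c d : ℤ} (h : a * d - b * c = 1) {z : ℂ} (hz : z ∈ HH) :
    ((a * z + b) / (c * z + d) : ℂ) ∈ HH := by
  have h0 := denom_ne_zero' h hz
  have h1 : ((a * z + b) / (c * z + d) : ℂ).im = z.im / Complex.normSq (c * z + d) := by
    rw [Complex.div_im, ← sub_div]
    have h' : ((a : ℝ) * d - b * c) = 1 := by exact_mod_cast h
    congr 1
    simp
    linear_combination (z.im) * h'
  simp only [HH, Set.mem_ofPred_eq, h1]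
  exact div_pos hz (Complex.normSq_pos.2 h0)

omit hj in
lemma hasDerivAt_moeb {a b c d : ℤ} (h : a * d - b * c = 1) {z : ℂ} (h0 : (c * z + d : ℂ) ≠ 0) :
    HasDerivAt (fun z : ℂ => (a * z + b) / (c * z + d)) (((c * z + d : ℂ) ^ 2)⁻¹) z := by
  have e1 : HasDerivAt (fun z : ℂ => a * z + b) (a : ℂ) z := by
    simpa using ((hasDerivAt_id z).const_mul (a : ℂ)).add_const (b : ℂ)
  have e2 : HasDerivAt (fun z : ℂ => c * z + d) (c : ℂ) z := by
    simpa using ((hasDerivAt_id z).const_mul (c : ℂ)).add_const (d : ℂ)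
  refine (e1.div e2 h0).congr_deriv ?_
  have h' : ((a : ℂ) * d - b * c) = 1 := by exact_mod_cast h
  field_simp
  linear_combination h'

lemma deriv_j_moeb {a b c d : ℤ} (h : a * d - b * c = 1) {z : ℂ} (hz : z ∈ HH) :
    deriv j ((a * z + b) / (c * z + d)) = (c * z + d) ^ 2 * deriv j z := by
  have h0 := denom_ne_zero' h hz
  have d1 := (analyticAt_j hj (moeb_mem h hz)).differentiableAt.hasDerivAt.comp z
    (hasDerivAt_moeb h h0)
  have d2 : HasDerivAt (j ∘ fun z : ℂ => (a * z + b) / (c * z + d)) (deriv j z) z :=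
    (analyticAt_j hj hz).differentiableAt.hasDerivAt.congr_of_eventuallyEq
      (Filter.eventually_of_mem (isOpen_HH.mem_nhds hz) fun w hw => j_moeb hj h hw)
  rw [← d1.unique d2, mul_comm (_ ^ 2), inv_mul_cancel_right₀ (pow_ne_zero 2 h0)]

lemma deriv2_j_moeb {a b c d : ℤ} (h : a * d - b * c = 1) {z : ℂ} (hz : z ∈ HH) :
    deriv (deriv j) ((a * z + b) / (c * z + d)) =
      (c * z + d) ^ 4 * deriv (deriv j) z + 2 * c * (c * z + d) ^ 3 * deriv j z := by
  have h0 := denom_ne_zero' h hz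
  have d1 := (analyticAt_j hj (moeb_mem h hz)).deriv.differentiableAt.hasDerivAt.comp z
    (hasDerivAt_moeb h h0)
  have e2 : HasDerivAt (fun z : ℂ => c * z + d) (c : ℂ) z := by
    simpa using ((hasDerivAt_id z).const_mul (c : ℂ)).add_const (d : ℂ)
  have d2 := ((e2.pow 2).mul
    (analyticAt_j hj hz).deriv.differentiableAt.hasDerivAt).congr_of_eventuallyEq
      (f₁ := deriv j ∘ fun z : ℂ => (a * z + b) / (c * z + d))
      (Filter.eventually_of_mem (isOpen_HH.mem_nhds hz) fun w hw => deriv_j_moeb hj h hw)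
  have := d1.unique d2
  rw [← div_eq_mul_inv, div_eq_iff (pow_ne_zero 2 h0)] at this
  rw [this]
  simp only [Pi.pow_apply]
  push_cast
  ring

lemma j_mahler {T : MvPolynomial (Fin 4) ℂ}
    (hT : ∀ z ∈ HH, MvPolynomial.eval ![z, j z, deriv j z, deriv (deriv j) z] T = 0) : T = 0 := by
  obtain ⟨e0, e1, -, he⟩ := j_ode hj
  -- the first coordinate is free
  have h1 : ∀ z ∈ HH, ∀ X, MvPolynomial.eval ![X, j z, deriv j z, deriv (deriv j) z] T = 0 := by
    intro z hz X
    have := eval_curve T ![Polynomial.X, .C (j z), .C (deriv j z), .C (deriv (deriv j) z)]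
      (S := (z + ·) '' Set.range ((↑) : ℤ → ℂ))
      (infinite_range_intCast.image (add_right_injective z).injOn) (by
        rintro _ ⟨_, ⟨m, rfl⟩, rfl⟩
        have hm : (1 : ℤ) * 1 - m * 0 = 1 := by ring
        have h := hT _ (moeb_mem hm hz)
        rw [j_moeb hj hm hz, deriv_j_moeb hj hm hz, deriv2_j_moeb hj hm hz] at h
        simp at h
        refine (congrArg (fun v => MvPolynomial.eval v T) (funext fun i => ?_)).trans (h)
        fin_cases i <;> simp) X
    refine (congrArg (fun v => MvPolynomial.eval v T) (funext fun i => ?_)).trans (this)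
    fin_cases i <;> simp
  -- hence the last two are free as well
  have h2 : ∀ z ∈ HH, ∀ X, ∀ c d : ℂ, MvPolynomial.eval ![X, j z, (c * z + d) ^ 2 * deriv j z,
      (c * z + d) ^ 4 * deriv (deriv j) z + 2 * c * (c * z + d) ^ 3 * deriv j z] T = 0 := by
    intro z hz X c d
    have A : ∀ c : ℤ, c ≠ 0 → ∀ d : ℂ, MvPolynomial.eval ![X, j z, (c * z + d) ^ 2 * deriv j z,
      (c * z + d) ^ 4 * deriv (deriv j) z + 2 * c * (c * z + d) ^ 3 * deriv j z] T = 0 := by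
      intro c hc d
      let P : Polynomial ℂ := .C (c * z) + .X
      have := eval_curve T ![.C X, .C (j z), P ^ 2 * .C (deriv j z),
        P ^ 4 * .C (deriv (deriv j) z) + .C (2 * (c : ℂ)) * P ^ 3 * .C (deriv j z)]
        (S := Set.range fun m : ℤ => (1 + m * c : ℂ))
        (Set.infinite_range_of_injective fun a b h => by simpa [hc] using h) (by
          rintro _ ⟨m, rfl⟩
          have hm : (1 : ℤ) * (1 + m * c) - m * c = 1 := by ring
          have h := h1 _ (moeb_mem hm hz) X
          rw [j_moeb hj hm hz, deriv_j_moeb hj hm hz, deriv2_j_moeb hj hm hz] at h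
          refine (congrArg (fun v => MvPolynomial.eval v T) (funext fun i => ?_)).trans (h)
          fin_cases i <;> simp [P]) d
      refine (congrArg (fun v => MvPolynomial.eval v T) (funext fun i => ?_)).trans (this)
      fin_cases i <;> simp [P]
    let P : Polynomial ℂ := .X * .C z + .C d
    have := eval_curve T ![.C X, .C (j z), P ^ 2 * .C (deriv j z),
        P ^ 4 * .C (deriv (deriv j) z) + 2 * .X * P ^ 3 * .C (deriv j z)]
        (S := ((↑) : ℤ → ℂ) '' {0}ᶜ)
        ((Set.finite_singleton (0 : ℤ)).infinite_compl.image Int.cast_injective.injOn) (by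
          rintro _ ⟨m, hm, rfl⟩
          refine (congrArg (fun v => MvPolynomial.eval v T) (funext fun i => ?_)).trans (A m hm d)
          fin_cases i <;> simp [P, mul_comm z]) c
    refine (congrArg (fun v => MvPolynomial.eval v T) (funext fun i => ?_)).trans (this)
    fin_cases i <;> simp [P, mul_comm z]
  have h3 : ∀ z ∈ HH, deriv j z ≠ 0 → ∀ X Y W : ℂ, Y ≠ 0 →
      MvPolynomial.eval ![X, j z, Y, W] T = 0 := by
    intro z hz hz1 X Y W hY
    obtain ⟨t, ht⟩ := IsAlgClosed.exists_pow_nat_eq (Y / deriv j z) (n := 2) (by norm_num)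
    have ht0 : t ≠ 0 := by rintro rfl; simp [hY, hz1, eq_comm] at ht
    have := h2 z hz X ((W - t ^ 4 * deriv (deriv j) z) / (2 * t ^ 3 * deriv j z))
      (t - (W - t ^ 4 * deriv (deriv j) z) / (2 * t ^ 3 * deriv j z) * z)
    rw [add_sub_cancel, ht] at this
    refine (congrArg (fun v => MvPolynomial.eval v T) (funext fun i => ?_)).trans (this)
    fin_cases i <;> simp
    · field_simp
    · field_simp; ring
  have h4 : T *
      (MvPolynomial.X 2 * ((MvPolynomial.X 1 - .C e0) * (MvPolynomial.X 1 - .C e1))) = 0 := by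
    refine MvPolynomial.funext fun v => ?_
    simp only [map_mul, map_sub, MvPolynomial.eval_X, MvPolynomial.eval_C, map_zero]
    by_cases hv : v 2 * ((v 1 - e0) * (v 1 - e1)) = 0
    · rw [hv, mul_zero]
    · simp only [mul_eq_zero, not_or, sub_eq_zero] at hv
      obtain ⟨z, hz, hzv⟩ := j_surj hj (v 1)
      have := h3 z hz ((he z hz).1.2 (by rw [hzv]; exact hv.2)) (v 0) (v 2) (v 3) hv.1
      rw [hzv] at this
      rw [mul_eq_zero]; left
      refine (congrArg (fun v => MvPolynomial.eval v T) (funext fun i => ?_)).trans (this)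
      fin_cases i <;> simp
  have hX : ∀ e : ℂ, (MvPolynomial.X 1 - .C e : MvPolynomial (Fin 4) ℂ) ≠ 0 := by
    intro e h
    have := congrArg (MvPolynomial.eval fun _ => e + 1) h
    simp at this
  exact (mul_eq_zero.1 h4).resolve_right
    (mul_ne_zero (MvPolynomial.X_ne_zero _) (mul_ne_zero (hX _) (hX _)))

end Mahler

section JData

open Complex Filter Topology

/-- A derivation compatible with `j`, together with the critical values of `j`. -/
structure IsJCtx (j : ℂ → ℂ) (D : Derivation ℚ ℂ ℂ) (e0 e1 : ℂ) : Prop where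
  hj : IsModularJ j
  jet : ∀ z ∈ HH, JetAt D j z
  ne : e0 ≠ e1
  crit : ∀ z ∈ HH, deriv j z ≠ 0 ↔ j z ≠ e0 ∧ j z ≠ e1
  ode : ∀ z ∈ HH, deriv j z ≠ 0 → deriv^[3] j z = 3 / 2 * (deriv^[2] j z) ^ 2 / deriv j z
      - schwR e0 e1 (j z) * deriv j z ^ 3
  map_e0 : D e0 = 0
  map_e1 : D e1 = 0

lemma exists_isJCtx {j D' : ℂ → ℂ} (hj : IsModularJ j) (hD : IsJDeriv j D') :
    ∃ D e0 e1, IsJCtx j D e0 e1 ∧ ∀ x, D x = D' x := by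
  let D : Derivation ℚ ℂ ℂ := Derivation.mk' (AddMonoidHom.mk' D' hD.1).toRatLinearMap
    fun a b => hD.2.1 a b
  have hDD : ∀ x, D x = D' x := fun x => rfl
  obtain ⟨e0, e1, hne, he⟩ := j_ode hj
  have hjet : ∀ z ∈ HH, JetAt D j z := fun z hz => ⟨analyticAt_j hj hz, fun k => hD.2.2 z hz k⟩
  have hcr : ∀ e, (∀ z ∈ HH, j z = e → deriv j z = 0) → D e = 0 := by
    intro e h
    obtain ⟨z, hz, rfl⟩ := j_surj hj e
    rw [(hjet z hz).map, h z hz rfl, zero_mul]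
  refine ⟨D, e0, e1, ⟨hj, hjet, hne, fun z hz => (he z hz).1, fun z hz => (he z hz).2,
    hcr _ fun z hz h => ?_, hcr _ fun z hz h => ?_⟩, hDD⟩
  · by_contra h1
    exact ((he z hz).1.1 h1).1 h
  · by_contra h1
    exact ((he z hz).1.1 h1).2 h

lemma isPreconnected_HH : IsPreconnected HH := (convex_halfSpace_im_gt 0).isPreconnected

namespace IsJCtx

variable {j : ℂ → ℂ} {D : Derivation ℚ ℂ ℂ} {e0 e1 : ℂ} (h : IsJCtx j D e0 e1)

include h

theorem algebraicIndependent {z : ℂ} (hz : z ∈ HH) (hDz : D z ≠ 0) :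
    AlgebraicIndependent (constField D) ![z, j z, deriv j z, deriv (deriv j) z] := by
  rw [algebraicIndependent_iff]
  intro T hT
  have key : ∀ T : MvPolynomial (Fin 4) (constField D), ∀ w ∈ HH, JetAt D
      (fun w => MvPolynomial.aeval ![w, j w, deriv j w, deriv (deriv j) w] T) w := by
    intro T w hw
    induction T using MvPolynomial.induction_on with
    | C c => simpa using jetAt_const c.2
    | add p q hp hq => simp only [map_add]; exact hp.add hq
    | mul_X p i hp =>
      simp only [map_mul, MvPolynomial.aeval_X]
      refine hp.mul (h := fun w => ![w, j w, deriv j w, deriv (deriv j) w] i) ?_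
      fin_cases i
      · exact jetAt_id
      · exact h.jet w hw
      · exact (h.jet w hw).deriv
      · exact (h.jet w hw).deriv.deriv
  have hz0 := eqOn_zero_of_jetAt isPreconnected_HH (key T) hz hDz hT
  have := j_mahler h.hj (T := MvPolynomial.map (algebraMap _ ℂ) T) fun w hw => by
    rw [MvPolynomial.eval_map, ← MvPolynomial.aeval_def]
    exact hz0 hw
  exact MvPolynomial.map_injective _ (algebraMap (constField D) ℂ).injective (by simpa using this)

lemma deriv_ne_zero {z : ℂ} (hz : z ∈ HH) (hDz : D z ≠ 0) : deriv j z ≠ 0 :=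
  (h.algebraicIndependent hz hDz).ne_zero 2

lemma map_j {z : ℂ} (hz : z ∈ HH) : D (j z) = deriv j z * D z := (h.jet z hz).map

end IsJCtx

/-- The jet of `j` at `z`. -/
def jDatum (j : ℂ → ℂ) (z : ℂ) : Datum ℂ := ⟨z, j z, deriv j z, deriv (deriv j) z⟩

lemma IsJCtx.isDatum {j : ℂ → ℂ} {D : Derivation ℚ ℂ ℂ} {e0 e1 : ℂ} (h : IsJCtx j D e0 e1)
    {z : ℂ} (hz : z ∈ HH) (hDz : D z ≠ 0) : IsDatum e0 e1 D (jDatum j z) := by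
  have h1 := h.deriv_ne_zero hz hDz
  refine ⟨(h.jet z hz).map, (h.jet z hz).deriv.map, ?_, hDz, h1, ((h.crit z hz).1 h1).1,
    ((h.crit z hz).1 h1).2⟩
  rw [Datum.w3]
  exact (h.ode z hz h1) ▸ (h.jet z hz).deriv.deriv.map

end JData

section Implicit

open Filter Topology

/-- The analytic implicit function theorem for one equation in two complex variables. -/
theorem exists_implicit {H : ℂ × ℂ → ℂ} {s z : ℂ} (hH : AnalyticAt ℂ H (s, z)) (h0 : H (s, z) = 0)
    (h1 : fderiv ℂ H (s, z) (0, 1) ≠ 0) :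
    ∃ φ : ℂ → ℂ, AnalyticAt ℂ φ s ∧ φ s = z ∧ ∀ᶠ t in 𝓝 s, H (t, φ t) = 0 := by
  have cdf : ContDiffAt ℂ ⊤ H (s, z) := hH.contDiffAt
  have inv : (fderiv ℂ H (s, z) ∘L .inr ℂ ℂ ℂ).IsInvertible := by
    refine ⟨ContinuousLinearEquiv.unitsEquivAut ℂ (Units.mk0 _ h1), ?_⟩
    ext
    simp
  refine ⟨cdf.implicitFunction (by simp) inv, ?_, cdf.implicitFunction_apply_self (by simp) inv, ?_⟩
  · exact (cdf.contDiffAt_implicitFunction (by simp) inv).analyticAt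
  · have := cdf.eventually_apply_implicitFunction (by simp) inv
    filter_upwards [this] with t ht
    rw [ht, h0]

/-- Fixed points of the Möbius maps `γ₀ ∘ Tᵏ ∘ U` accumulating at the cusp `γ₀ ∞`. -/
theorem exists_moeb_fixed {U : ℂ → ℂ} {a b c d : ℤ} (hc : c ≠ 0) (h : a * d - b * c = 1)
    (hU : AnalyticAt ℂ U (a / c)) :
    ∃ Z : ℕ → ℂ, Tendsto Z atTop (𝓝 (a / c)) ∧ ∀ᶠ k : ℕ in atTop,
      Z k ≠ a / c ∧
        Z k = (a * (U (Z k) + k) + b) / (c * (U (Z k) + k) + d) := by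
  have hc' : (c : ℂ) ≠ 0 := by exact_mod_cast hc
  have h' : (a * d - b * c : ℂ) = 1 := by exact_mod_cast h
  set r : ℂ := a / c with hr
  have hcr : c * r = a := by rw [hr]; field_simp
  let H : ℂ × ℂ → ℂ := fun x =>
    (x.2 - r) * (c ^ 2 * (U x.2 * x.1 + 1) + c * d * x.1) + x.1
  have hUa : AnalyticAt ℂ (fun x : ℂ × ℂ => U x.2) (0, r) :=
    AnalyticAt.fun_comp (f := fun x : ℂ × ℂ => x.2) hU analyticAt_snd
  have hH : AnalyticAt ℂ H (0, r) := by
    have h1 : AnalyticAt ℂ (fun x : ℂ × ℂ => x.1) (0, r) := analyticAt_fst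
    have h2 : AnalyticAt ℂ (fun x : ℂ × ℂ => x.2) (0, r) := analyticAt_snd
    exact ((h2.sub analyticAt_const).mul ((analyticAt_const.mul ((hUa.mul h1).add
      analyticAt_const)).add (analyticAt_const.mul h1))).add h1
  have hd : fderiv ℂ H (0, r) (0, 1) = c ^ 2 := by
    have h2 : HasDerivAt (fun t : ℂ => ((0 : ℂ), r + t)) (0, 1) 0 :=
      (hasDerivAt_const _ _).prodMk ((hasDerivAt_id _).const_add r)
    have h3 := (HasFDerivAt.comp_hasDerivAt (x := (0 : ℂ)) (l := H)
      (f := fun t : ℂ => ((0 : ℂ), r + t))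
          (by simpa using hH.differentiableAt.hasFDerivAt) h2).deriv
    rw [← h3]
    have : (H ∘ fun t : ℂ => ((0 : ℂ), r + t)) = fun t => t * (c : ℂ) ^ 2 := by
      ext t; simp [H]
    rw [this]
    simp
  obtain ⟨φ, hφ, hφ0, hφe⟩ := exists_implicit hH (by simp [H]) (by rw [hd]; positivity)
  have hlim : Tendsto (fun k : ℕ => ((k : ℂ))⁻¹) atTop (𝓝 0) := by
    exact tendsto_inv_atTop_nhds_zero_nat
  refine ⟨fun k => φ (k : ℂ)⁻¹, hφ0 ▸ hφ.continuousAt.tendsto.comp hlim, ?_⟩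
  filter_upwards [hlim.eventually hφe, eventually_gt_atTop 0] with k hk hk0
  have hk' : (k : ℂ) ≠ 0 := by exact_mod_cast hk0.ne'
  set z := φ (k : ℂ)⁻¹
  simp only [H] at hk
  have hk2 : (z - r) * (c ^ 2 * (U z + k) + c * d) + 1 = 0 := by
    have := congrArg (fun x => (k : ℂ) * x) hk
    simp only [mul_zero] at this
    rw [← this]
    field_simp
  refine ⟨fun hz => ?_, ?_⟩
  · rw [hz] at hk2; simp at hk2
  · have ht : c * (U z + k) + d ≠ 0 := fun ht => by
      have : (z - r) * (c * (c * (U z + k) + d)) + 1 = 0 := by rw [← hk2]; ring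
      simp [ht] at this
    rw [eq_div_iff ht]
    apply mul_left_cancel₀ hc'
    linear_combination hk2 + (c * (U z + k) + d) * hcr + h'

end Implicit

section Density

/-- Primitive integer vectors of slope close to a given real number are Zariski dense. -/
theorem exists_coprime_eval_ne_zero {T : MvPolynomial (Fin 2) ℂ} (hT : T ≠ 0) (x : ℝ) {ε : ℝ}
    (hε : 0 < ε) : ∃ a b c d : ℤ, c ≠ 0 ∧ a * d - b * c = 1 ∧ |(a : ℝ) / c - x| < ε ∧
      MvPolynomial.eval ![(a : ℂ), (c : ℂ)] T ≠ 0 := by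
  obtain ⟨q, hq1, hq2⟩ := exists_rat_btwn (show x - ε / 2 < x + ε / 2 by linarith)
  obtain ⟨a, c, hc, hqq, hcop⟩ : ∃ a c : ℤ, 0 < c ∧ (q : ℝ) = a / c ∧ IsCoprime a c :=
    ⟨q.num, q.den, by exact_mod_cast q.pos, by exact_mod_cast (Rat.num_div_den q).symm,
      Rat.isCoprime_num_den q⟩
  obtain ⟨d, b', hbd⟩ := hcop
  by_contra! hcon
  have hcR : (1 : ℝ) ≤ c := by exact_mod_cast hc
  have key : ∀ m' : ℤ, 2 / ε < c * m' + d → ∀ m : ℤ, 0 < m →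
      MvPolynomial.eval ![((a * m' - b') * m + a : ℂ), ((c * m' + d) * m + c : ℂ)] T = 0 := by
    intro m' hm' m hm
    have hmR : (1 : ℝ) ≤ m := by exact_mod_cast hm
    have h1 : (0 : ℝ) < c * m' + d := lt_trans (by positivity) hm'
    have h2 : (0 : ℝ) < (c * m' + d) * m + c := by positivity
    have h3 := hcon ((a * m' - b') * m + a) (a * m' - b') ((c * m' + d) * m + c) (c * m' + d)
      (by exact_mod_cast h2.ne') (by linear_combination hbd) ?_
    · simpa using h3
    push_cast
    have h4 : ((a * m' - b') * m + a : ℝ) / ((c * m' + d) * m + c) - a / c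
        = -m / (c * ((c * m' + d) * m + c)) := by
      have hbd' : (d * a + b' * c : ℝ) = 1 := by exact_mod_cast hbd
      have hc0 : (c : ℝ) ≠ 0 := by positivity
      rw [div_sub_div _ _ h2.ne' hc0, div_eq_div_iff (by positivity) (by positivity)]
      linear_combination (-m * ((c * m' + d) * m + c) * c : ℝ) * hbd'
    have h5 : |(m : ℝ) / (c * ((c * m' + d) * m + c))| < ε / 2 := by
      rw [abs_of_pos (by positivity), div_lt_iff₀ (by positivity)]
      rw [div_lt_iff₀ hε] at hm'
      nlinarith [mul_pos hε h2, mul_pos (mul_pos hε h2) (show (0:ℝ) < c by linarith)]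
    calc _ = |(-m / (c * ((c * m' + d) * m + c)) : ℝ) + (q - x)| := by rw [← h4, hqq]; ring_nf
      _ ≤ |(-m / (c * ((c * m' + d) * m + c)) : ℝ)| + |(q : ℝ) - x| := abs_add_le _ _
      _ < ε / 2 + ε / 2 := by
        apply add_lt_add_of_lt_of_le
        · rwa [neg_div, abs_neg]
        · rw [abs_le]; constructor <;> linarith
      _ = ε := by ring
  have hinf : (((↑) : ℤ → ℂ) '' {m : ℤ | 0 < m}).Infinite :=
    (Set.Ioi_infinite (0 : ℤ)).image (Int.cast_injective.injOn)
  have hinf' : (((↑) : ℤ → ℂ) '' {m' : ℤ | 2 / ε < c * m' + d}).Infinite := by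
    refine Set.Infinite.image (Int.cast_injective.injOn) ?_
    obtain ⟨N, hN⟩ := exists_int_gt ((2 / ε) - d)
    refine (Set.Ioi_infinite (max N 0)).mono fun m' hm' => ?_
    have h1 : (N : ℝ) < m' := by exact_mod_cast (le_max_left _ _).trans_lt hm'
    have h2 : (0 : ℝ) < m' := by exact_mod_cast (le_max_right _ _).trans_lt hm'
    show 2 / ε < c * m' + d
    nlinarith
  have key2 : ∀ s t : ℂ,
      MvPolynomial.eval ![(a * t - b') * s + a, (c * t + d) * s + c] T = 0 := by
    intro s t
    have h1 : ∀ m' : ℤ, 2 / ε < c * m' + d →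
        MvPolynomial.eval ![(a * m' - b') * s + a, (c * m' + d) * s + c] T = 0 := by
      intro m' hm'
      have := eval_curve T ![Polynomial.C (a * m' - b' : ℂ) * Polynomial.X + Polynomial.C (a : ℂ),
        Polynomial.C (c * m' + d : ℂ) * Polynomial.X + Polynomial.C (c : ℂ)] hinf (by
          rintro _ ⟨m, hm, rfl⟩
          refine (congrArg (fun v => MvPolynomial.eval v T) (funext fun i => ?_)).trans
            (key m' hm' m hm)
          fin_cases i <;> simp) s
      refine (congrArg (fun v => MvPolynomial.eval v T) (funext fun i => ?_)).trans this
      fin_cases i <;> simp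
    have := eval_curve T ![(Polynomial.C (a : ℂ) * Polynomial.X - Polynomial.C (b' : ℂ)) *
        Polynomial.C s + Polynomial.C (a : ℂ),
      (Polynomial.C (c : ℂ) * Polynomial.X + Polynomial.C (d : ℂ)) * Polynomial.C s +
        Polynomial.C (c : ℂ)] hinf' (by
        rintro _ ⟨m', hm', rfl⟩
        refine (congrArg (fun v => MvPolynomial.eval v T) (funext fun i => ?_)).trans (h1 m' hm')
        fin_cases i <;> simp) t
    refine (congrArg (fun v => MvPolynomial.eval v T) (funext fun i => ?_)).trans this
    fin_cases i <;> simp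
  let Q : MvPolynomial (Fin 2) ℂ := MvPolynomial.C (a : ℂ) * MvPolynomial.X 1
    - MvPolynomial.C (c : ℂ) * MvPolynomial.X 0
  have hQ : Q ≠ 0 := fun h => by
    have := congrArg (MvPolynomial.eval ![(1 : ℂ), 0]) h
    simp [Q, hc.ne'] at this
  have hbd' : (d * a + b' * c : ℂ) = 1 := by exact_mod_cast hbd
  refine mul_ne_zero hT hQ (MvPolynomial.funext fun v => ?_)
  simp only [map_mul, map_zero]
  by_cases h0 : MvPolynomial.eval v Q = 0
  · rw [h0, mul_zero]
  rw [mul_eq_zero_of_left]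
  have hQv : MvPolynomial.eval v Q = a * v 1 - c * v 0 := by simp [Q]
  rw [hQv] at h0
  set t : ℂ := (d * v 0 + b' * v 1 - 1) / (a * v 1 - c * v 0)
  have ht : t * (a * v 1 - c * v 0) = d * v 0 + b' * v 1 - 1 := div_mul_cancel₀ _ h0
  refine (congrArg (fun v => MvPolynomial.eval v T) (funext fun i => ?_)).trans
    (key2 (a * v 1 - c * v 0) t)
  fin_cases i
  · change v 0 = (a * t - b') * (a * v 1 - c * v 0) + a
    linear_combination -v 0 * hbd' - a * ht
  · change v 1 = (c * t + d) * (a * v 1 - c * v 0) + c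
    linear_combination -v 1 * hbd' - c * ht

end Density

section Iterates

open Filter Topology

variable {j : ℂ → ℂ}

lemma jIt_succ (n : ℕ) (z : ℂ) : jIt j (n + 1) z = j (jIt j n z) := rfl

lemma jIt_succ' (n : ℕ) (z : ℂ) : jIt j (n + 1) z = jIt j n (j z) := by
  induction n with
  | zero => rfl
  | succ n ih => rw [jIt_succ, ih, jIt_succ]

lemma mem_HHn {n : ℕ} {z : ℂ} : z ∈ HHn j n ↔ ∀ i < n, jIt j i z ∈ HH := by
  induction n with
  | zero => simp [HHn]
  | succ n ih =>
    change z ∈ HHn j n ∧ jIt j n z ∈ HH ↔ _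
    rw [ih]
    exact ⟨fun h i hi => (Nat.lt_succ_iff_lt_or_eq.1 hi).elim (h.1 i) fun h' => h' ▸ h.2,
      fun h => ⟨fun i hi => h i (by omega), h n (by omega)⟩⟩

lemma mem_HHn_succ {n : ℕ} {z : ℂ} : z ∈ HHn j (n + 1) ↔ z ∈ HH ∧ j z ∈ HHn j n := by
  simp only [mem_HHn, ← jIt_succ']
  exact ⟨fun h => ⟨h 0 (by omega), fun i hi => h (i + 1) (by omega)⟩,
    fun h i hi => by cases i with
      | zero => exact h.1
      | succ i => exact h.2 i (by omega)⟩

lemma HHn_anti {m n : ℕ} (h : m ≤ n) : HHn j n ⊆ HHn j m :=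
  fun _ hz => mem_HHn.2 fun i hi => mem_HHn.1 hz i (by omega)

lemma analyticAt_jIt (hj : IsModularJ j) {n : ℕ} {z : ℂ} (hz : z ∈ HHn j n) :
    AnalyticAt ℂ (jIt j n) z := by
  induction n with
  | zero => exact analyticAt_id
  | succ n ih => exact (analyticAt_j hj hz.2).comp (ih hz.1)

lemma eventually_mem_HHn (hj : IsModularJ j) {n : ℕ} {z : ℂ} (hz : z ∈ HHn j n) :
    ∀ᶠ w in 𝓝 z, w ∈ HHn j n := by
  induction n with
  | zero => exact Eventually.of_forall fun _ => trivial
  | succ n ih =>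
    exact (ih hz.1).and ((analyticAt_jIt hj hz.1).continuousAt.eventually
      (isOpen_HH.eventually_mem hz.2))

lemma deriv_jIt_succ (hj : IsModularJ j) {n : ℕ} {z : ℂ} (hz : z ∈ HHn j (n + 1)) :
    deriv (jIt j (n + 1)) z = deriv (jIt j n) (j z) * deriv j z := by
  have h := mem_HHn_succ.1 hz
  have : jIt j (n + 1) = jIt j n ∘ j := funext fun z => jIt_succ' n z
  rw [this, deriv_comp _ (analyticAt_jIt hj h.2).differentiableAt
    (analyticAt_j hj h.1).differentiableAt]

end Iterates

section Step

open Filter Topology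

variable {j : ℂ → ℂ}

/-- Points `z = γ (U z)`, `γ ∈ SL₂(ℤ)`, accumulating at a rational number. -/
theorem exists_moeb_seq {U : ℂ → ℂ} {a b c d : ℤ} (hc : c ≠ 0) (h : a * d - b * c = 1)
    (hU : AnalyticAt ℂ U (a / c)) (hUH : U (a / c) ∈ HH) :
    ∃ (Z : ℕ → ℂ), Tendsto Z atTop (𝓝 (a / c)) ∧
      Tendsto (fun k : ℕ => ‖(c : ℂ) * U (Z k) + ((d + k * c : ℤ) : ℂ)‖) atTop atTop ∧
      ∀ᶠ k : ℕ in atTop, Z k ≠ a / c ∧ U (Z k) ∈ HH ∧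
        Z k = (a * U (Z k) + ((b + k * a : ℤ) : ℂ)) / (c * U (Z k) + ((d + k * c : ℤ) : ℂ)) := by
  obtain ⟨Z, hZ, hZe⟩ := exists_moeb_fixed hc h hU
  have hUZ : Tendsto (fun k => U (Z k)) atTop (𝓝 (U (a / c))) := hU.continuousAt.tendsto.comp hZ
  refine ⟨Z, hZ, ?_, ?_⟩
  · have h1 : Tendsto (fun k : ℕ => ‖(k : ℂ) * c‖) atTop atTop := by
      simp only [norm_mul, Complex.norm_natCast]
      exact tendsto_natCast_atTop_atTop.atTop_mul_const (norm_pos_iff.2 (by exact_mod_cast hc))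
    have h2 : Tendsto (fun k : ℕ => ‖(c : ℂ) * U (Z k) + d‖) atTop (𝓝 ‖(c : ℂ) * U (a / c) + d‖) :=
      ((hUZ.const_mul _).add_const _).norm
    have h3 := h2.neg.add_atTop h1
    refine tendsto_atTop_mono (fun k => ?_) h3
    have := norm_sub_le ((c : ℂ) * U (Z k) + ((d + k * c : ℤ) : ℂ)) (c * U (Z k) + d)
    have h4 : ((c : ℂ) * U (Z k) + ((d + k * c : ℤ) : ℂ)) - (c * U (Z k) + d) = k * c := by
      push_cast; ring
    rw [h4] at this
    linarith
  · filter_upwards [hZe, hUZ.eventually (isOpen_HH.eventually_mem hUH)] with k hk hk2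
    refine ⟨hk.1, hk2, ?_⟩
    conv_lhs => rw [hk.2]
    push_cast
    ring_nf

lemma fderiv_comp_inr {G : ℂ × ℂ → ℂ} {g : ℂ → ℂ} {x u : ℂ} (hG : AnalyticAt ℂ G (x, g u))
    (hg : AnalyticAt ℂ g u) : AnalyticAt ℂ (fun q : ℂ × ℂ => G (q.1, g q.2)) (x, u) ∧
      fderiv ℂ (fun q : ℂ × ℂ => G (q.1, g q.2)) (x, u) (0, 1)
        = deriv g u * fderiv ℂ G (x, g u) (0, 1) := by
  have h1 : AnalyticAt ℂ (fun q : ℂ × ℂ => G (q.1, g q.2)) (x, u) :=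
    AnalyticAt.fun_comp (f := fun q : ℂ × ℂ => (q.1, g q.2)) hG (analyticAt_fst.prod
      (AnalyticAt.fun_comp (f := fun q : ℂ × ℂ => q.2) hg analyticAt_snd))
  refine ⟨h1, ?_⟩
  have e1 : HasDerivAt (fun t : ℂ => (x, t)) ((0 : ℂ), (1 : ℂ)) u :=
    (hasDerivAt_const _ _).prodMk (hasDerivAt_id _)
  have e2 : HasDerivAt (fun t : ℂ => (x, g t)) ((0 : ℂ), deriv g u) u :=
    (hasDerivAt_const _ _).prodMk hg.differentiableAt.hasDerivAt
  have e3 := HasFDerivAt.comp_hasDerivAt (x := u) (f := fun t : ℂ => (x, t))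
    (l := fun q : ℂ × ℂ => G (q.1, g q.2)) h1.differentiableAt.hasFDerivAt e1
  have e4 := HasFDerivAt.comp_hasDerivAt (x := u) (f := fun t : ℂ => (x, g t))
    (l := G) hG.differentiableAt.hasFDerivAt e2
  rw [e3.unique e4, ← smul_eq_mul, ← map_smul]
  simp

/-- Solving `G (z, j z) = 0` near a real point: the solutions come with arbitrarily large `j' z`. -/
theorem exists_root_step (hj : IsModularJ j) {G : ℂ × ℂ → ℂ} {x : ℝ} {u0 : ℂ} (hu0 : u0 ∈ HH)
    (hju : deriv j u0 ≠ 0) (hG : AnalyticAt ℂ G (x, j u0)) (h0 : G (x, j u0) = 0)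
    (h1 : fderiv ℂ G (x, j u0) (0, 1) ≠ 0) {ε : ℝ} (hε : 0 < ε) (M : ℝ) :
    ∃ z ∈ HH, ‖z - x‖ < ε ∧ ‖j z - j u0‖ < ε ∧ G (z, j z) = 0 ∧
      deriv (fun z => G (z, j z)) z ≠ 0 ∧ M < ‖deriv j z‖ := by
  obtain ⟨hf, hf1⟩ := fderiv_comp_inr hG (analyticAt_j hj hu0)
  obtain ⟨U, hU, hU0, hUe⟩ := exists_implicit hf h0 (by rw [hf1]; exact mul_ne_zero hju h1)
  have hUt : Tendsto U (𝓝 (x : ℂ)) (𝓝 u0) := hU0 ▸ hU.continuousAt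
  have hjt : Tendsto (fun Z => j (U Z)) (𝓝 (x : ℂ)) (𝓝 (j u0)) :=
    (analyticAt_j hj hu0).continuousAt.tendsto.comp hUt
  have hpt : Tendsto (fun Z => (Z, j (U Z))) (𝓝 (x : ℂ)) (𝓝 (x, j u0)) :=
    tendsto_id.prodMk_nhds hjt
  have hj1 : ∀ᶠ Z in 𝓝 (x : ℂ), deriv j (U Z) ≠ 0 :=
    ((analyticAt_j hj hu0).deriv.continuousAt.tendsto.comp hUt).eventually_ne hju
  have hj2 : ∀ᶠ Z in 𝓝 (x : ℂ), ‖j (U Z) - j u0‖ < ε := by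
    simpa [dist_eq_norm] using hjt.eventually (Metric.ball_mem_nhds _ hε)
  have hG1 := hpt.eventually hG.eventually_analyticAt
  have hG2 : ∀ᶠ Z in 𝓝 (x : ℂ), fderiv ℂ G (Z, j (U Z)) (0, 1) ≠ 0 :=
    (((ContinuousLinearMap.apply ℂ ℂ ((0, 1) : ℂ × ℂ)).continuous.tendsto _).comp
      (hG.fderiv.continuousAt.tendsto.comp hpt)).eventually_ne h1
  have hx : ∀ᶠ Z : ℂ in 𝓝 (x : ℂ), ‖Z - x‖ < ε := by
    filter_upwards [Metric.ball_mem_nhds (x : ℂ) hε] with Z hZ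
    rwa [Metric.mem_ball, dist_eq_norm] at hZ
  have hall := hU.eventually_analyticAt.and <|
      (hUt.eventually (isOpen_HH.eventually_mem hu0)).and <|
    hj1.and <| hj2.and <| hG1.and <| hG2.and <| hx.and hUe
  obtain ⟨δ, hδ, hball⟩ := Metric.eventually_nhds_iff_ball.1 hall
  obtain ⟨a, b, c, d, hc, h, hac, -⟩ := exists_coprime_eval_ne_zero (T := 1) one_ne_zero x hδ
  have hr : ((a : ℂ) / c) ∈ Metric.ball (x : ℂ) δ := by
    rw [Metric.mem_ball, dist_eq_norm]
    have : ((a : ℂ) / c - x) = ((a / c - x : ℝ) : ℂ) := by push_cast; rfl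
    rwa [this, Complex.norm_real]
  obtain ⟨hrU, hrH, hrj, -, hrG, hrG2, -⟩ := hball _ hr
  obtain ⟨Z, hZ, ht, hZe⟩ := exists_moeb_seq hc h hrU hrH
  set r : ℂ := a / c
  have hjr : Tendsto (fun k => j (U (Z k))) atTop (𝓝 (j (U r))) :=
    (analyticAt_j hj hrH).continuousAt.tendsto.comp (hrU.continuousAt.tendsto.comp hZ)
  have hprt : Tendsto (fun k => (Z k, j (U (Z k)))) atTop (𝓝 (r, j (U r))) := hZ.prodMk_nhds hjr
  have hfd : ∀ v : ℂ × ℂ, Tendsto (fun k => fderiv ℂ G (Z k, j (U (Z k))) v) atTop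
      (𝓝 (fderiv ℂ G (r, j (U r)) v)) := fun v =>
    ((ContinuousLinearMap.apply ℂ ℂ v).continuous.tendsto _).comp
      (hrG.fderiv.continuousAt.tendsto.comp hprt)
  have hjd : Tendsto (fun k => deriv j (U (Z k))) atTop (𝓝 (deriv j (U r))) :=
    (analyticAt_j hj hrH).deriv.continuousAt.tendsto.comp (hrU.continuousAt.tendsto.comp hZ)
  have hbig : Tendsto (fun k : ℕ => ‖(c : ℂ) * U (Z k) + ((d + k * c : ℤ) : ℂ)‖ ^ 2 *
      ‖deriv j (U (Z k))‖) atTop atTop :=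
    (tendsto_pow_atTop two_ne_zero |>.comp ht).atTop_mul_pos (norm_pos_iff.2 hrj) hjd.norm
  set A := fderiv ℂ G (r, j (U r)) (1, 0)
  set B := fderiv ℂ G (r, j (U r)) (0, 1)
  have hB : 0 < ‖B‖ := norm_pos_iff.2 hrG2
  have hA1 := (hfd (1, 0)).norm.eventually (gt_mem_nhds (lt_add_one ‖A‖))
  have hB1 := (hfd (0, 1)).norm.eventually (lt_mem_nhds (half_lt_self hB))
  have hin := hZ.eventually (Metric.isOpen_ball.eventually_mem hr)
  obtain ⟨k, hk1, hk2, hkA, hkB, hkin, hkZ⟩ :=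
    ((hbig.eventually_gt_atTop M).and ((hbig.eventually_gt_atTop ((‖A‖ + 1) / (‖B‖ / 2))).and
      (hA1.and (hB1.and (hin.and hZe))))).exists
  obtain ⟨-, hUH, hZk⟩ := hkZ
  have hdet : a * (d + k * c) - (b + k * a) * c = 1 := by linear_combination h
  have hzH : Z k ∈ HH := hZk ▸ moeb_mem hdet hUH
  have hjz : j (Z k) = j (U (Z k)) := by
    conv_lhs => rw [hZk]
    exact j_moeb hj hdet hUH
  have hjdz : ‖deriv j (Z k)‖ =
      ‖(c : ℂ) * U (Z k) + ((d + k * c : ℤ) : ℂ)‖ ^ 2 * ‖deriv j (U (Z k))‖ := by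
    conv_lhs => rw [hZk]
    rw [deriv_j_moeb hj hdet hUH, norm_mul, norm_pow]
  obtain ⟨-, -, -, g4, g5, -, g7, g8⟩ := hball _ hkin
  rw [← hjdz] at hk1 hk2
  rw [← hjz] at g4 g5 g8 hkA hkB
  refine ⟨Z k, hzH, g7, g4, g8, ?_, hk1⟩
  have e1 : HasDerivAt (fun z => (z, j z)) ((1 : ℂ), deriv j (Z k)) (Z k) :=
    (hasDerivAt_id _).prodMk (analyticAt_j hj hzH).differentiableAt.hasDerivAt
  have e2 := HasFDerivAt.comp_hasDerivAt (x := Z k) (f := fun z => (z, j z)) (l := G)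
    g5.differentiableAt.hasFDerivAt e1
  have e3 : ((1 : ℂ), deriv j (Z k)) = (1, 0) + deriv j (Z k) • (0, 1) := by simp
  change HasDerivAt (fun z => G (z, j z)) _ _ at e2
  rw [e2.deriv, e3, map_add, map_smul, smul_eq_mul]
  intro h5
  have h6 := congrArg norm (eq_neg_of_add_eq_zero_right h5)
  rw [norm_neg, norm_mul] at h6
  rw [div_lt_iff₀ (by positivity)] at hk2
  nlinarith [norm_nonneg (deriv j (Z k))]

end Step

section Descent

open Filter Topology

variable (j : ℂ → ℂ) (e0 e1 : ℂ)

/-- The sum of the terms `R(jᵢ v) (jᵢ' v)²` for `a ≤ i < b`, where `R` is the rational function in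
the Schwarzian equation of `j`. -/
def schwSum (a b : ℕ) (v : ℂ) : ℂ :=
  ∑ i ∈ Finset.Ico a b, schwR e0 e1 (jIt j i v) * deriv (jIt j i) v ^ 2

/-- The point `τ` with its coordinates from `m` on replaced by `v, j v, j (j v), …`. -/
def tailPt {N : ℕ} (τ : Fin N → ℂ) (m : ℕ) (v : ℂ) : Fin N → ℂ :=
  fun i => if (i : ℕ) < m then τ i else jIt j (i - m) v

/-- A point avoiding the poles and the zeros of the function `R`. -/
structure IsRegPt (w : ℂ) : Prop where
  ne0 : w ≠ e0
  ne1 : w ≠ e1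
  schwR_ne : schwR e0 e1 w ≠ 0

variable {j e0 e1}

lemma analyticAt_schwR {w : ℂ} (h0 : w ≠ e0) (h1 : w ≠ e1) : AnalyticAt ℂ (schwR e0 e1) w := by
  have h0' := sub_ne_zero.2 h0
  have h1' := sub_ne_zero.2 h1
  unfold schwR
  fun_prop (disch := simp [*])

lemma IsRegPt.eventually {w : ℂ} (h : IsRegPt e0 e1 w) : ∀ᶠ v in 𝓝 w, IsRegPt e0 e1 v := by
  filter_upwards [eventually_ne_nhds h.ne0, eventually_ne_nhds h.ne1,
    (analyticAt_schwR h.ne0 h.ne1).continuousAt.eventually_ne h.schwR_ne] with v h1 h2 h3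
  exact ⟨h1, h2, h3⟩

lemma schwSum_succ_succ (hj : IsModularJ j) {a b : ℕ} {z : ℂ} (hz : z ∈ HHn j b) :
    schwSum j e0 e1 (a + 1) (b + 1) z = deriv j z ^ 2 * schwSum j e0 e1 a b (j z) := by
  rw [schwSum, ← Finset.sum_Ico_add' (fun i => schwR e0 e1 (jIt j i z) * deriv (jIt j i) z ^ 2),
    schwSum, Finset.mul_sum]
  refine Finset.sum_congr rfl fun i hi => ?_
  have hi' := Finset.mem_Ico.1 hi
  rw [deriv_jIt_succ hj (HHn_anti (by omega) hz), jIt_succ']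
  ring

lemma analyticAt_schwSum (hj : IsModularJ j) {a b : ℕ} {z : ℂ} (hz : z ∈ HHn j b)
    (hr : ∀ i, a ≤ i → i < b → IsRegPt e0 e1 (jIt j i z)) :
    AnalyticAt ℂ (schwSum j e0 e1 a b) z := by
  refine Finset.analyticAt_fun_sum _ fun i hi => ?_
  obtain ⟨hi, hi'⟩ := Finset.mem_Ico.1 hi
  have h1 := analyticAt_jIt hj (HHn_anti hi'.le hz)
  exact ((analyticAt_schwR (hr i hi hi').ne0 (hr i hi hi').ne1).fun_comp h1).mul (h1.deriv.pow 2)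

lemma analyticAt_eval {σ V : Type*} [NormedAddCommGroup V] [NormedSpace ℂ V] {f : V → σ → ℂ} {v : V}
    (hf : ∀ i, AnalyticAt ℂ (fun x => f x i) v) (p : MvPolynomial σ ℂ) :
    AnalyticAt ℂ (fun x => MvPolynomial.eval (f x) p) v :=
  AnalyticAt.aeval_mvPolynomial hf p

lemma hasDerivAt_eval {σ : Type*} [Fintype σ] {f : ℂ → σ → ℂ} {f' : σ → ℂ} {v : ℂ}
    (hf : ∀ i, HasDerivAt (fun x => f x i) (f' i) v) (p : MvPolynomial σ ℂ) :
    HasDerivAt (fun x => MvPolynomial.eval (f x) p)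
      (∑ i, MvPolynomial.eval (f v) (MvPolynomial.pderiv i p) * f' i) v := by
  classical
  induction p using MvPolynomial.induction_on with
  | C c => simpa using hasDerivAt_const v c
  | add p q hp hq =>
    simp only [map_add, add_mul, Finset.sum_add_distrib]
    exact hp.add hq
  | mul_X p i hp =>
    have := hp.mul (hf i)
    simp only [map_mul, MvPolynomial.eval_X]
    refine this.congr_deriv ?_
    simp only [Derivation.leibniz, MvPolynomial.pderiv_X, smul_eq_mul, map_add, map_mul,
      MvPolynomial.eval_X, add_mul, Finset.sum_add_distrib, Pi.single_apply,
      apply_ite (MvPolynomial.eval (f v)), map_zero, mul_ite, mul_one, mul_zero, ite_mul,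
      zero_mul, Finset.sum_ite_eq, Finset.mem_univ, if_true, Finset.sum_mul]
    rw [add_comm]
    exact congrArg _ (Finset.sum_congr rfl fun k _ => by ring)

lemma tailPt_last {n : ℕ} (τ : Fin (n + 1) → ℂ) (v : ℂ) :
    tailPt j τ n v = Function.update τ (Fin.last n) v := by
  ext i
  rcases Fin.eq_castSucc_or_eq_last i with ⟨i, rfl⟩ | rfl
  · simp [tailPt]
  · simp [tailPt, jIt]

/-- Iterated solving of `j z = v`, starting from a point `τ` of a hypersurface whose coordinates but
the last are real, gives points `v` such that `(v, j v, …)` is close to the tail of `τ`. -/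
theorem exists_tailPt (hj : IsModularJ j) (hcrit : ∀ z ∈ HH, deriv j z ≠ 0 ↔ j z ≠ e0 ∧ j z ≠ e1)
    {n : ℕ} {p : MvPolynomial (Fin (n + 1)) ℂ} {τ : Fin (n + 1) → ℂ}
    (hreal : ∀ i, i ≠ Fin.last n → ∃ x : ℝ, τ i = x) (hreg : ∀ i, IsRegPt e0 e1 (τ i))
    (hp : MvPolynomial.eval τ p = 0)
    (hpd : MvPolynomial.eval τ (MvPolynomial.pderiv (Fin.last n) p) ≠ 0) (k : ℕ) (hk : k ≤ n) :
    ∀ ε > 0, ∃ v ∈ HHn j k, (∀ i, ‖tailPt j τ (n - k) v i - τ i‖ < ε) ∧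
      MvPolynomial.eval (tailPt j τ (n - k) v) p = 0 ∧
      deriv (fun v => MvPolynomial.eval (tailPt j τ (n - k) v) p) v ≠ 0 ∧
      ∀ a b, a < b → b ≤ k → schwSum j e0 e1 a b v ≠ 0 := by
  induction k with
  | zero =>
    intro ε hε
    have hτ : tailPt j τ n (τ (Fin.last n)) = τ := by rw [tailPt_last, Function.update_eq_self]
    simp only [Nat.sub_zero]
    refine ⟨τ (Fin.last n), trivial, fun i => ?_, ?_, ?_, fun a b hab hb => by omega⟩
    · simpa [hτ] using hε
    · rw [hτ, hp]
    · have := hasDerivAt_eval (f := tailPt j τ n) (f' := Pi.single (Fin.last n) 1)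
        (v := τ (Fin.last n)) (fun i => ?_) p
      · rw [this.deriv, hτ]
        simpa [Pi.single_apply] using hpd
      · simp only [tailPt_last]
        by_cases hi : i = Fin.last n
        · subst hi; simpa using hasDerivAt_id' _
        · simpa [Function.update_of_ne hi, Pi.single_eq_of_ne hi] using hasDerivAt_const _ _
  | succ k ih =>
    intro ε hε
    obtain ⟨m, rfl⟩ : ∃ m, n = m + (k + 1) := ⟨n - (k + 1), by omega⟩
    have ih := ih (by omega)
    have e1' : m + (k + 1) - k = m + 1 := by omega
    have e2' : m + (k + 1) - (k + 1) = m := by omega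
    rw [e1'] at ih
    rw [e2']
    obtain ⟨x, hx⟩ := hreal ⟨m, by omega⟩ (by simp [Fin.ext_iff])
    have hregε : ∀ᶠ δ in 𝓝[>] (0 : ℝ), ∀ i, ∀ w, ‖w - τ i‖ < δ → IsRegPt e0 e1 w := by
      rw [eventually_all]
      intro i
      obtain ⟨δ, hδ, h⟩ := Metric.eventually_nhds_iff_ball.1 (hreg i).eventually
      filter_upwards [Ioo_mem_nhdsGT hδ] with δ' hδ' w hw
      exact h w (by rw [Metric.mem_ball, dist_eq_norm]; exact hw.trans hδ'.2)
    obtain ⟨δ, hδreg, hδ0, hδε⟩ := (hregε.and (Ioo_mem_nhdsGT (half_pos hε))).exists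
    obtain ⟨v, hv, hvτ, hv0, hv1, hvs⟩ := ih δ hδ0
    have hvreg : ∀ i ≤ k, IsRegPt e0 e1 (jIt j i v) := by
      intro i hi
      have := hδreg ⟨m + 1 + i, by omega⟩ _ (hvτ ⟨m + 1 + i, by omega⟩)
      dsimp only [tailPt] at this
      rwa [if_neg (by omega), Nat.add_sub_cancel_left] at this
    obtain ⟨u0, hu0, rfl⟩ := j_surj hj v
    have hju : deriv j u0 ≠ 0 := by
      have := hvreg 0 (by omega)
      exact (hcrit u0 hu0).2 ⟨this.ne0, this.ne1⟩
    let G : ℂ × ℂ → ℂ := fun q => MvPolynomial.eval (fun i : Fin (m + (k + 1) + 1) =>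
      if (i : ℕ) < m then τ i else if (i : ℕ) = m then q.1 else jIt j (i - (m + 1)) q.2) p
    have hG : AnalyticAt ℂ G (x, j u0) := by
      refine analyticAt_eval (fun i => ?_) p
      split_ifs
      · exact analyticAt_const
      · exact analyticAt_fst
      · have hi : (i : ℕ) - (m + 1) ≤ k := by omega
        exact (analyticAt_jIt hj (HHn_anti hi hv)).fun_comp
          (f := fun q : ℂ × ℂ => q.2) analyticAt_snd
    have hGx : ∀ w, G (x, w) = MvPolynomial.eval (tailPt j τ (m + 1) w) p := by
      intro w
      refine congrArg (fun f => MvPolynomial.eval f p) (funext fun i => ?_)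
      simp only [tailPt]
      rcases lt_trichotomy (i : ℕ) m with h | h | h
      · rw [if_pos h, if_pos (by omega)]
      · rw [if_neg (by omega), if_pos h, if_pos (by omega), ← hx]
        exact congrArg τ (Fin.ext h.symm)
      · rw [if_neg (by omega), if_neg (by omega), if_neg (by omega)]
    have hGj : ∀ z, G (z, j z) = MvPolynomial.eval (tailPt j τ m z) p := by
      intro z
      refine congrArg (fun f => MvPolynomial.eval f p) (funext fun i => ?_)
      simp only [tailPt]
      rcases lt_trichotomy (i : ℕ) m with h | h | h
      · rw [if_pos h, if_pos h]
      · rw [if_neg (by omega), if_pos h, if_neg (by omega), h, Nat.sub_self]; rfl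
      · rw [if_neg (by omega), if_neg (by omega), if_neg (by omega), ← jIt_succ']
        congr 1; omega
    have hG1 : fderiv ℂ G (x, j u0) (0, 1) ≠ 0 := by
      have e1 : HasDerivAt (fun t : ℂ => ((x : ℂ), t)) ((0 : ℂ), (1 : ℂ)) (j u0) :=
        (hasDerivAt_const _ _).prodMk (hasDerivAt_id _)
      have e2 := HasFDerivAt.comp_hasDerivAt (x := j u0) (f := fun t : ℂ => ((x : ℂ), t))
        (l := G) hG.differentiableAt.hasFDerivAt e1
      rw [← e2.deriv]
      rwa [← funext hGx] at hv1
    -- a neighbourhood of `j u0`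
    have hnear : ∀ᶠ w in 𝓝 (j u0), w ∈ HHn j k ∧
        (∀ i ∈ Finset.range (k + 1), ‖jIt j i w - jIt j i (j u0)‖ < ε / 2) ∧
        ∀ a ∈ Finset.range (k + 1), ∀ b ∈ Finset.range (k + 1), a < b →
          schwSum j e0 e1 a b w ≠ 0 ∧
            ‖schwSum j e0 e1 a b (j u0)‖ / 2 < ‖schwSum j e0 e1 a b w‖ := by
      refine (eventually_mem_HHn hj hv).and (Eventually.and ?_ ?_)
      · rw [eventually_all_finset]
        intro i hi
        have h1 := (analyticAt_jIt hj (HHn_anti (Nat.lt_succ_iff.1 (Finset.mem_range.1 hi)) hv))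
        filter_upwards [h1.continuousAt.eventually (Metric.ball_mem_nhds _ (half_pos hε))] with w hw
        rwa [← dist_eq_norm]
      · rw [eventually_all_finset]
        intro a _
        rw [eventually_all_finset]
        intro b hb
        have hb := Nat.lt_succ_iff.1 (Finset.mem_range.1 hb)
        by_cases hab : a < b
        · have h1 := (analyticAt_schwSum hj (a := a) (HHn_anti hb hv)
            fun i _ hi => hvreg i (by omega)).continuousAt
          have h2 := hvs a b hab hb
          filter_upwards [h1.eventually_ne h2, h1.norm.eventually
            (lt_mem_nhds (half_lt_self (norm_pos_iff.2 h2)))] with w hw1 hw2 _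
          exact ⟨hw1, hw2⟩
        · exact Eventually.of_forall fun w h => absurd h hab
    obtain ⟨δ1, hδ1, hnear⟩ := Metric.eventually_nhds_iff_ball.1 hnear
    have hxreg : IsRegPt e0 e1 (x : ℂ) := hx ▸ hreg _
    have hnearx : ∀ᶠ z in 𝓝 (x : ℂ), IsRegPt e0 e1 z ∧
        ‖schwR e0 e1 z‖ < ‖schwR e0 e1 (x : ℂ)‖ + 1 :=
      hxreg.eventually.and ((analyticAt_schwR hxreg.ne0 hxreg.ne1).continuousAt.norm.eventually
        (gt_mem_nhds (lt_add_one _)))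
    obtain ⟨δ2, hδ2, hnearx⟩ := Metric.eventually_nhds_iff_ball.1 hnearx
    obtain ⟨M, hM0, hM⟩ : ∃ M : ℝ, 0 < M ∧ ∀ b ∈ Finset.range (k + 1), 0 < b →
        ‖schwR e0 e1 (x : ℂ)‖ + 1 < M ^ 2 * (‖schwSum j e0 e1 0 b (j u0)‖ / 2) := by
      refine ((eventually_gt_atTop 0).and ((eventually_all_finset _).2 fun b hb => ?_)).exists
      by_cases hb0 : 0 < b
      · have h2 := hvs 0 b hb0 (Nat.lt_succ_iff.1 (Finset.mem_range.1 hb))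
        filter_upwards [((tendsto_pow_atTop (two_ne_zero)).atTop_mul_const
          (half_pos (norm_pos_iff.2 h2))).eventually_gt_atTop (‖schwR e0 e1 (x : ℂ)‖ + 1)]
          with M hM _ using hM
      · exact Eventually.of_forall fun w h => absurd h hb0
    obtain ⟨z, hz, hzx, hzv, hz0, hz1, hzM⟩ := exists_root_step hj hu0 hju hG (by rw [hGx, hv0]) hG1
      (ε := min (ε / 2) (min δ1 δ2)) (by positivity) M
    simp only [lt_min_iff] at hzx hzv
    obtain ⟨hw1, hw2, hw3⟩ := hnear (j z) (by rw [Metric.mem_ball, dist_eq_norm]; exact hzv.2.1)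
    obtain ⟨hr1, hr2⟩ := hnearx z (by rw [Metric.mem_ball, dist_eq_norm]; exact hzx.2.2)
    have hzn : z ∈ HHn j (k + 1) := mem_HHn_succ.2 ⟨hz, hw1⟩
    have hjz : deriv j z ≠ 0 := norm_pos_iff.1 (hM0.trans hzM)
    refine ⟨z, hzn, fun i => ?_, by rw [← hGj, hz0], ?_, fun a b hab hb => ?_⟩
    · simp only [tailPt]
      rcases lt_trichotomy (i : ℕ) m with h | h | h
      · simpa [h] using hε
      · rw [if_neg (by omega), h, Nat.sub_self, show i = ⟨m, by omega⟩ from Fin.ext h, hx]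
        exact hzx.1.trans (half_lt_self hε)
      · rw [if_neg (by omega)]
        obtain ⟨l, hl⟩ : ∃ l, (i : ℕ) = m + 1 + l := ⟨i - (m + 1), by omega⟩
        have h1 := hw2 l (Finset.mem_range.2 (by omega))
        have h2 := hvτ i
        simp only [tailPt] at h2
        rw [if_neg (by omega), hl, Nat.add_sub_cancel_left] at h2
        rw [hl, show m + 1 + l - m = l + 1 by omega, jIt_succ']
        calc _ = ‖(jIt j l (j z) - jIt j l (j u0)) + (jIt j l (j u0) - τ i)‖ := by ring_nf
          _ ≤ _ := norm_add_le _ _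
          _ < ε / 2 + ε / 2 := add_lt_add h1 (h2.trans hδε)
          _ = ε := add_halves ε
    · convert hz1 using 2
      exact funext fun z => (hGj z).symm
    · obtain ⟨b, rfl⟩ : ∃ b', b = b' + 1 := ⟨b - 1, by omega⟩
      have hbk : b ∈ Finset.range (k + 1) := Finset.mem_range.2 (by omega)
      rcases a with _ | a
      · rw [schwSum, Finset.sum_eq_sum_Ico_succ_bot (by omega)]
        change _ + schwSum j e0 e1 (0 + 1) (b + 1) z ≠ 0
        rw [schwSum_succ_succ hj (HHn_anti (by omega) hzn)]
        simp only [jIt, id, deriv_id, one_pow, mul_one]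
        rcases Nat.eq_zero_or_pos b with rfl | hb0
        · simpa [schwSum] using hr1.schwR_ne
        · intro h0
          have h1 := congrArg norm (eq_neg_of_add_eq_zero_left h0)
          rw [norm_neg, norm_mul, norm_pow] at h1
          have h2 := hM b hbk hb0
          have h3 := (hw3 0 (by simp) b hbk hb0).2
          have h4 : M ^ 2 ≤ ‖deriv j z‖ ^ 2 := pow_le_pow_left₀ hM0.le hzM.le 2
          have h5 := mul_le_mul h4 h3.le (by positivity) (by positivity)
          linarith
      · rw [schwSum_succ_succ hj (HHn_anti (by omega) hzn)]
        exact mul_ne_zero (pow_ne_zero _ hjz)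
          (hw3 a (Finset.mem_range.2 (by omega)) b hbk (by omega)).1

end Descent

section CoeffDerivation

variable {σ : Type*} (D : Derivation ℚ ℂ ℂ)

/-- The polynomial obtained by applying a derivation to the coefficients. -/
def coeffD (p : MvPolynomial σ ℂ) : MvPolynomial σ ℂ :=
  ∑ m ∈ p.support, MvPolynomial.monomial m (D (MvPolynomial.coeff m p))

lemma coeff_coeffD (p : MvPolynomial σ ℂ) (m : σ →₀ ℕ) :
    MvPolynomial.coeff m (coeffD D p) = D (MvPolynomial.coeff m p) := by
  classical
  simp only [coeffD, MvPolynomial.coeff_sum, MvPolynomial.coeff_monomial, Finset.sum_ite_eq',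
    MvPolynomial.mem_support_iff]
  split_ifs with h
  · rfl
  · rw [not_not.1 h, map_zero]

lemma coeffD_add (p q : MvPolynomial σ ℂ) : coeffD D (p + q) = coeffD D p + coeffD D q := by
  ext m
  simp [coeff_coeffD]

lemma coeffD_C (c : ℂ) : coeffD D (MvPolynomial.C c : MvPolynomial σ ℂ) = MvPolynomial.C (D c) := by
  classical
  ext m
  rw [coeff_coeffD, MvPolynomial.coeff_C, MvPolynomial.coeff_C]
  split_ifs <;> simp

lemma coeffD_mul_X (p : MvPolynomial σ ℂ) (i : σ) :
    coeffD D (p * MvPolynomial.X i) = coeffD D p * MvPolynomial.X i := by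
  classical
  ext m
  rw [coeff_coeffD, MvPolynomial.coeff_mul_X', MvPolynomial.coeff_mul_X', coeff_coeffD]
  split_ifs <;> simp

lemma totalDegree_coeffD_le (p : MvPolynomial σ ℂ) :
    (coeffD D p).totalDegree ≤ p.totalDegree := by
  refine MvPolynomial.totalDegree_le_of_support_subset fun m hm => ?_
  rw [MvPolynomial.mem_support_iff, coeff_coeffD] at hm
  rw [MvPolynomial.mem_support_iff]
  rintro h
  exact hm (by rw [h, map_zero])

/-- A polynomial dividing a nonzero polynomial of at most its degree is its constant multiple. -/
lemma eq_C_mul_of_dvd {p q : MvPolynomial σ ℂ} (hq : q ≠ 0) (h : p ∣ q)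
    (hd : q.totalDegree ≤ p.totalDegree) : ∃ c : ℂ, c ≠ 0 ∧ q = MvPolynomial.C c * p := by
  obtain ⟨r, rfl⟩ := h
  have hp : p ≠ 0 := left_ne_zero_of_mul hq
  have hr : r ≠ 0 := right_ne_zero_of_mul hq
  rw [MvPolynomial.totalDegree_mul_of_isDomain hp hr] at hd
  have h0 : r.totalDegree = 0 := by omega
  rw [MvPolynomial.totalDegree_eq_zero_iff_eq_C] at h0
  refine ⟨r.coeff 0, fun h => hr (by rw [h0, h, map_zero]), ?_⟩
  rw [mul_comm, ← h0]

lemma not_dvd_coeffD {p : MvPolynomial σ ℂ} {m : σ →₀ ℕ} (hm : MvPolynomial.coeff m p = 1)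
    (hD : coeffD D p ≠ 0) : ¬ p ∣ coeffD D p := by
  intro h
  obtain ⟨c, hc, h1⟩ := eq_C_mul_of_dvd hD h (totalDegree_coeffD_le D p)
  have h2 := congrArg (MvPolynomial.coeff m) h1
  rw [coeff_coeffD, MvPolynomial.coeff_C_mul, hm, mul_one, D.map_one_eq_zero] at h2
  exact hc h2.symm

lemma totalDegree_pderiv_lt {p : MvPolynomial σ ℂ} {i : σ} (hp : MvPolynomial.pderiv i p ≠ 0) :
    (MvPolynomial.pderiv i p).totalDegree < p.totalDegree := by
  classical
  obtain ⟨m, hm, h⟩ : ∃ m ∈ (MvPolynomial.pderiv i p).support,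
      (MvPolynomial.pderiv i p).totalDegree = m.sum fun _ e => e :=
    Finset.exists_mem_eq_sup _ (MvPolynomial.support_nonempty.2 hp) _
  rw [MvPolynomial.mem_support_iff, MvPolynomial.coeff_pderiv] at hm
  have h1 := MvPolynomial.le_totalDegree (MvPolynomial.mem_support_iff.2 (left_ne_zero_of_mul hm))
  rw [Finsupp.sum_add_index' (by simp) (by simp), Finsupp.sum_single_index rfl] at h1
  omega

lemma not_dvd_pderiv {p : MvPolynomial σ ℂ} {i : σ} (hp : MvPolynomial.pderiv i p ≠ 0) :
    ¬ p ∣ MvPolynomial.pderiv i p := by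
  intro h
  have h1 := totalDegree_pderiv_lt hp
  obtain ⟨q, hq⟩ := h
  rw [hq] at hp
  rw [hq, MvPolynomial.totalDegree_mul_of_isDomain (left_ne_zero_of_mul hp)
    (right_ne_zero_of_mul hp)] at h1
  omega

lemma not_dvd_X_sub_C {p : MvPolynomial σ ℂ} {i₁ i₂ : σ} (hi : i₁ ≠ i₂)
    (h1 : MvPolynomial.pderiv i₁ p ≠ 0) (h2 : MvPolynomial.pderiv i₂ p ≠ 0) (i : σ) (c : ℂ) :
    ¬ p ∣ MvPolynomial.X i - MvPolynomial.C c := by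
  classical
  have key : ∀ k, k ≠ i → MvPolynomial.pderiv k p ≠ 0 →
      ¬ p ∣ MvPolynomial.X i - MvPolynomial.C c := by
    intro k hk hp h
    have hq : (MvPolynomial.X i - MvPolynomial.C c : MvPolynomial σ ℂ) ≠ 0 := by
      intro h0
      have := congrArg (MvPolynomial.eval fun _ => c + 1) h0
      simp at this
    have hd : (MvPolynomial.X i - MvPolynomial.C c : MvPolynomial σ ℂ).totalDegree ≤ 1 :=
      (MvPolynomial.totalDegree_sub _ _).trans (by simp)
    obtain ⟨a, ha, h3⟩ := eq_C_mul_of_dvd hq h (hd.trans (by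
      have := totalDegree_pderiv_lt hp
      omega))
    have h4 := congrArg (MvPolynomial.pderiv k) h3
    rw [map_sub, MvPolynomial.pderiv_X_of_ne hk.symm, MvPolynomial.pderiv_C, sub_zero,
      MvPolynomial.pderiv_C_mul] at h4
    exact mul_ne_zero ((map_ne_zero_iff _ (MvPolynomial.C_injective _ _)).2 ha) hp
      (by simpa using h4.symm)
  by_cases h : i₁ = i
  · exact key i₂ (by rw [← h]; exact hi.symm) h2
  · exact key i₁ h h1

end CoeffDerivation

section RealPoints

/-- A hypersurface contains points with all coordinates but the first one real, away from any
hypersurface not containing it. -/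
lemma exists_real_point_zero {n : ℕ} {P Q : MvPolynomial (Fin (n + 1)) ℂ} (hP : Irreducible P)
    (h0 : MvPolynomial.pderiv 0 P ≠ 0) (hPQ : ¬ P ∣ Q) :
    ∃ τ : Fin (n + 1) → ℂ, (∀ i, i ≠ 0 → ∃ x : ℝ, τ i = x) ∧ MvPolynomial.eval τ P = 0 ∧
      MvPolynomial.eval τ Q ≠ 0 := by
  classical
  set P' := MvPolynomial.finSuccEquiv ℂ n P with hP'
  set Q' := MvPolynomial.finSuccEquiv ℂ n Q with hQ'
  have hprime : Prime P' := (MulEquiv.prime_iff (MvPolynomial.finSuccEquiv ℂ n)).2 hP.prime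
  have hdeg : P'.natDegree ≠ 0 := by
    rw [hP', MvPolynomial.natDegree_finSuccEquiv, ← MvPolynomial.mem_vars_iff_degreeOf_ne_zero]
    by_contra h
    exact h0 (MvPolynomial.pderiv_eq_zero_of_notMem_vars h)
  have hPQ' : ¬ P' ∣ Q' := fun h => hPQ ((map_dvd_iff (MvPolynomial.finSuccEquiv ℂ n)).1 h)
  have hdom : IsDomain (AdjoinRoot P') := AdjoinRoot.isDomain_of_prime hprime
  have halg : Algebra.IsAlgebraic (MvPolynomial (Fin n) ℂ) (AdjoinRoot P') := by
    have h1 := Algebra.isAlgebraic_adjoin_singleton_iff.2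
      (AdjoinRoot.isAlgebraic_root hprime.ne_zero)
    exact ⟨fun x => h1 x (by rw [AdjoinRoot.adjoinRoot_eq_top]; trivial)⟩
  have hQ0 : AdjoinRoot.mk P' Q' ∈ nonZeroDivisors (AdjoinRoot P') :=
    mem_nonZeroDivisors_of_ne_zero fun h => hPQ' (AdjoinRoot.mk_eq_zero.1 h)
  obtain ⟨c, hc, b, hb⟩ := (halg.isAlgebraic (AdjoinRoot.mk P' Q')).exists_nonzero_dvd hQ0
  obtain ⟨b, rfl⟩ := AdjoinRoot.mk_surjective b
  rw [AdjoinRoot.algebraMap_eq, ← AdjoinRoot.mk_C, ← map_mul, ← sub_eq_zero, ← map_sub,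
    AdjoinRoot.mk_eq_zero] at hb
  obtain ⟨a, ha⟩ := hb
  obtain ⟨x, hx⟩ : ∃ x : Fin n → ℝ,
      MvPolynomial.eval (fun i => (x i : ℂ)) (c * P'.leadingCoeff) ≠ 0 := by
    by_contra! h
    refine mul_ne_zero hc (Polynomial.leadingCoeff_ne_zero.2 hprime.ne_zero)
      (MvPolynomial.funext_set (fun _ => Set.range ((↑) : ℝ → ℂ))
        (fun _ => Set.infinite_range_of_injective Complex.ofReal_injective) fun v hv => ?_)
    choose y hy using fun i => hv i (Set.mem_univ i)
    rw [map_zero, ← h y]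
    simp only [hy]
  rw [map_mul] at hx
  obtain ⟨y, hy⟩ := IsAlgClosed.exists_root
    (P'.map (MvPolynomial.eval fun i => (x i : ℂ))) (by
      rw [Polynomial.degree_map_eq_of_leadingCoeff_ne_zero _ (right_ne_zero_of_mul hx)]
      exact fun h => hdeg (Polynomial.natDegree_eq_of_degree_eq_some h))
  refine ⟨Fin.cons y fun i => (x i : ℂ), fun i hi => ?_, ?_, fun h => ?_⟩
  · obtain ⟨k, rfl⟩ := Fin.exists_succ_eq.2 hi
    exact ⟨x k, by simp⟩
  · rw [MvPolynomial.eval_eq_eval_mv_eval']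
    exact hy
  · rw [MvPolynomial.eval_eq_eval_mv_eval'] at h
    have h1 := congrArg (fun f => Polynomial.eval y
      (f.map (MvPolynomial.eval fun i => (x i : ℂ)))) ha
    simp only [Polynomial.map_sub, Polynomial.map_mul, Polynomial.eval_sub, Polynomial.eval_mul,
      Polynomial.map_C, Polynomial.eval_C] at h1
    rw [← hQ'] at h
    rw [hy.eq_zero, h, zero_mul, zero_mul, sub_zero] at h1
    exact left_ne_zero_of_mul hx h1

lemma exists_real_point_last {n : ℕ} {P Q : MvPolynomial (Fin (n + 1)) ℂ} (hP : Irreducible P)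
    (hl : MvPolynomial.pderiv (Fin.last n) P ≠ 0) (hPQ : ¬ P ∣ Q) :
    ∃ τ : Fin (n + 1) → ℂ, (∀ i, i ≠ Fin.last n → ∃ x : ℝ, τ i = x) ∧
      MvPolynomial.eval τ P = 0 ∧ MvPolynomial.eval τ Q ≠ 0 := by
  set e := MvPolynomial.renameEquiv ℂ (Fin.revPerm (n := n + 1)) with he
  have h0 : MvPolynomial.pderiv 0 (e P) ≠ 0 := by
    have h1 := MvPolynomial.pderiv_rename (R := ℂ) (Fin.rev_injective (n := n + 1)) (Fin.last n) P
    rw [Fin.rev_last] at h1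
    have h2 : e P = MvPolynomial.rename Fin.rev P := rfl
    rw [h2, h1]
    exact fun h => hl
        (MvPolynomial.rename_injective _ Fin.rev_injective (h.trans (map_zero _).symm))
  obtain ⟨τ, h1, h2, h3⟩ := exists_real_point_zero ((MulEquiv.irreducible_iff e).2 hP) h0
    (fun h => hPQ ((map_dvd_iff e).1 h))
  refine ⟨τ ∘ Fin.rev, fun i hi => h1 _ fun h => hi ?_, ?_, ?_⟩
  · rw [← Fin.rev_rev i, h, Fin.rev_zero]
  · rw [← MvPolynomial.eval_rename]
    exact h2
  · rw [← MvPolynomial.eval_rename]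
    exact h3

end RealPoints

section RegularPoints

lemma exists_finset_isRegPt {e0 e1 : ℂ} (h : e0 ≠ e1) :
    ∃ C : Finset ℂ, ∀ w, w ∉ C → IsRegPt e0 e1 w := by
  classical
  set P : Polynomial ℂ := .C 32 * (.X - .C e1) ^ 2 + .C 27 * (.X - .C e0) ^ 2
    - .C 23 * ((.X - .C e0) * (.X - .C e1)) with hP
  have hP0 : P ≠ 0 := by
    intro h0
    have := congrArg (Polynomial.eval e0) h0
    simp [hP, sub_eq_zero, h] at this
  refine ⟨{e0, e1} ∪ P.roots.toFinset, fun w hw => ?_⟩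
  simp only [Finset.mem_union, Finset.mem_insert, Finset.mem_singleton, Multiset.mem_toFinset,
    Polynomial.mem_roots hP0, not_or, Polynomial.IsRoot.def] at hw
  obtain ⟨⟨h0, h1⟩, h2⟩ := hw
  refine ⟨h0, h1, fun h3 => h2 ?_⟩
  have h0' := sub_ne_zero.2 h0
  have h1' := sub_ne_zero.2 h1
  rw [schwR] at h3
  field_simp at h3
  simp only [hP, Polynomial.eval_sub, Polynomial.eval_add, Polynomial.eval_mul, Polynomial.eval_pow,
    Polynomial.eval_C, Polynomial.eval_X]
  linear_combination h3 / 72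

lemma exists_generic_real_point {n : ℕ} (hn : 0 < n) {D : Derivation ℚ ℂ ℂ} {e0 e1 : ℂ}
    (he : e0 ≠ e1) {P : MvPolynomial (Fin (n + 1)) ℂ} (hP : Irreducible P)
    (h0 : MvPolynomial.pderiv 0 P ≠ 0) (hl : MvPolynomial.pderiv (Fin.last n) P ≠ 0)
    {m : Fin (n + 1) →₀ ℕ} (hm : MvPolynomial.coeff m P = 1) (hD : coeffD D P ≠ 0) :
    ∃ τ : Fin (n + 1) → ℂ, (∀ i, i ≠ Fin.last n → ∃ x : ℝ, τ i = x) ∧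
      MvPolynomial.eval τ P = 0 ∧ MvPolynomial.eval τ (MvPolynomial.pderiv 0 P) ≠ 0 ∧
      MvPolynomial.eval τ (MvPolynomial.pderiv (Fin.last n) P) ≠ 0 ∧
      MvPolynomial.eval τ (coeffD D P) ≠ 0 ∧ ∀ i, IsRegPt e0 e1 (τ i) := by
  obtain ⟨C, hC⟩ := exists_finset_isRegPt he
  have hne : (0 : Fin (n + 1)) ≠ Fin.last n := by
    rw [Ne, Fin.ext_iff, Fin.val_zero, Fin.val_last]
    exact hn.ne
  obtain ⟨τ, h1, h2, h3⟩ := exists_real_point_last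
    (Q := MvPolynomial.pderiv 0 P * MvPolynomial.pderiv (Fin.last n) P * coeffD D P *
      ∏ i, ∏ c ∈ C, (MvPolynomial.X i - MvPolynomial.C c)) hP hl (by
    intro h
    rcases hP.prime.dvd_or_dvd h with h | h
    · rcases hP.prime.dvd_or_dvd h with h | h
      · rcases hP.prime.dvd_or_dvd h with h | h
        · exact not_dvd_pderiv h0 h
        · exact not_dvd_pderiv hl h
      · exact not_dvd_coeffD D hm hD h
    · obtain ⟨i, -, h⟩ := hP.prime.exists_mem_finset_dvd h
      obtain ⟨c, -, h⟩ := hP.prime.exists_mem_finset_dvd h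
      exact not_dvd_X_sub_C hne h0 hl i c h)
  simp only [map_mul, map_prod, mul_ne_zero_iff, map_sub, MvPolynomial.eval_X,
    MvPolynomial.eval_C, Finset.prod_ne_zero_iff, sub_ne_zero] at h3
  obtain ⟨⟨⟨h4, h5⟩, h6⟩, h7⟩ := h3
  exact ⟨τ, h1, h2, h4, h5, h6, fun i => hC _ fun h => h7 i (Finset.mem_univ i) _ h rfl⟩

end RegularPoints

section SchwarzianExpansion

variable {R : Type*} [CommRing R] (cd Θ A : R → R) (Λ φ : R)

/-- The numerator of the second derivative, part free of `c`. -/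
def numW₀ : R := -Λ ^ 2 * cd φ + Λ * φ * Θ φ + Λ * φ * cd Λ - φ ^ 2 * Θ Λ

/-- The numerator of the second derivative, coefficient of `c`. -/
def numW₁ : R := φ ^ 2 * A Λ

/-- The numerator of the Schwarzian derivative, part free of `c`. -/
def numQ₀ : R :=
  -2 * φ * (Λ * (Λ * cd (numW₀ cd Θ Λ φ) - φ * Θ (numW₀ cd Θ Λ φ))
    - 3 * numW₀ cd Θ Λ φ * (Λ * cd Λ - φ * Θ Λ)) - 3 * numW₀ cd Θ Λ φ ^ 2

/-- The numerator of the Schwarzian derivative, coefficient of `c`. -/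
def numQ₁ : R :=
  -2 * φ * (Λ * (Λ * cd (numW₁ A Λ φ) - φ * (Θ (numW₁ A Λ φ) - A (numW₀ cd Θ Λ φ)))
    - 3 * numW₁ A Λ φ * (Λ * cd Λ - φ * Θ Λ) - 3 * numW₀ cd Θ Λ φ * φ * A Λ)
    - 6 * numW₀ cd Θ Λ φ * numW₁ A Λ φ

/-- The numerator of the Schwarzian derivative, coefficient of `c²`. -/
def numQ₂ : R :=
  -2 * φ * (Λ * φ * A (numW₁ A Λ φ) - 3 * numW₁ A Λ φ * φ * A Λ) - 3 * numW₁ A Λ φ ^ 2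

variable {cd Θ A Λ φ}

/-- The Schwarzian derivative of an element `u` with `ev Λ * D u = - ev φ`, when the derivation `D`
is given on the image of `ev` by the operators `cd`, `Θ` and `A`. -/
lemma schw_expansion {D : Derivation ℚ ℂ ℂ} {ev : R →+* ℂ} {u c : ℂ}
    (hev : ∀ G, D (ev G) = ev (cd G) + (ev (Θ G) - c * ev (A G)) * D u) (hc : D c = 0)
    (hA : A φ = 0) (h : ev φ + ev Λ * D u = 0) (hφ : ev φ ≠ 0) :
    2 * ev φ ^ 2 * ev Λ ^ 4 * schw D u =
      ev (numQ₀ cd Θ Λ φ) + c * ev (numQ₁ cd Θ A Λ φ) + c ^ 2 * ev (numQ₂ A Λ φ) := by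
  have hΛ : ev Λ ≠ 0 := fun h0 => hφ (by simpa [h0] using h)
  have hu : D u ≠ 0 := fun h0 => hφ (by simpa [h0] using h)
  have hd := congrArg D h
  rw [map_add, D.leibniz, map_zero, smul_eq_mul, smul_eq_mul, hev, hev, hA, map_zero] at hd
  set W₀ := numW₀ cd Θ Λ φ with hW₀
  set W₁ := numW₁ A Λ φ with hW₁
  have c2 : ev 2 = 2 := map_ofNat ev 2
  have c3 : ev 3 = 3 := map_ofNat ev 3
  have c6 : ev 6 = 6 := map_ofNat ev 6
  have eW₀ : ev W₀ = -ev Λ ^ 2 * ev (cd φ) + ev Λ * ev φ * ev (Θ φ) + ev Λ * ev φ * ev (cd Λ)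
      - ev φ ^ 2 * ev (Θ Λ) := by simp [hW₀, numW₀]
  have eW₁ : ev W₁ = ev φ ^ 2 * ev (A Λ) := by simp [hW₁, numW₁]
  have eQ₀ : ev (numQ₀ cd Θ Λ φ) = -2 * ev φ * (ev Λ * (ev Λ * ev (cd W₀) - ev φ * ev (Θ W₀))
    - 3 * ev W₀ * (ev Λ * ev (cd Λ) - ev φ * ev (Θ Λ))) - 3 * ev W₀ ^ 2 := by
    simp [numQ₀, c2, c3, ← hW₀]
  have eQ₁ : ev (numQ₁ cd Θ A Λ φ) = -2 * ev φ * (ev Λ * (ev Λ * ev (cd W₁)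
    - ev φ * (ev (Θ W₁) - ev (A W₀))) - 3 * ev W₁ * (ev Λ * ev (cd Λ) - ev φ * ev (Θ Λ))
    - 3 * ev W₀ * ev φ * ev (A Λ)) - 6 * ev W₀ * ev W₁ := by
    simp [numQ₁, c2, c3, c6, ← hW₀, ← hW₁]
  have eQ₂ : ev (numQ₂ A Λ φ) = -2 * ev φ * (ev Λ * ev φ * ev (A W₁)
    - 3 * ev W₁ * ev φ * ev (A Λ)) - 3 * ev W₁ ^ 2 := by
    simp [numQ₂, c2, c3, ← hW₁]
  have h2 : ev Λ ^ 3 * D (D u) = ev W₀ + c * ev W₁ := by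
    rw [eW₀, eW₁]
    have e1 : ev φ = - (ev Λ * D u) := by linear_combination h
    rw [e1]
    linear_combination ev Λ ^ 2 * hd
  have hd2 := congrArg D h2
  rw [D.leibniz, D.leibniz_pow, map_add, D.leibniz, hc] at hd2
  simp only [smul_eq_mul, nsmul_eq_mul] at hd2
  rw [hev W₀, hev W₁, hev Λ] at hd2
  generalize ev (cd W₀) = x1 at *
  generalize ev (Θ W₀) = x2 at *
  generalize ev (A W₀) = x3 at *
  generalize ev (cd W₁) = y1 at *
  generalize ev (Θ W₁) = y2 at *
  generalize ev (A W₁) = y3 at *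
  generalize ev (cd Λ) = l1 at *
  generalize ev (Θ Λ) = l2 at *
  generalize ev (A Λ) = l3 at *
  generalize ev W₀ = w0 at *
  generalize ev W₁ = w1 at *
  rw [eQ₀, eQ₁, eQ₂, schw]
  have e1 : ev φ = - (ev Λ * D u) := by linear_combination h
  have hS : 2 * ev φ ^ 2 * ev Λ ^ 4 * (D (D (D u)) / D u - 3 / 2 * (D (D u) / D u) ^ 2) =
      2 * ev Λ ^ 6 * D u * D (D (D u)) - 3 * (ev Λ ^ 3 * D (D u)) ^ 2 := by
    rw [e1]
    field_simp
  rw [hS, h2]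
  have h3 : ev Λ ^ 5 * D (D (D u)) = ev Λ * (ev Λ * x1 - ev φ * x2) + c * (ev Λ *
     (ev Λ * y1 - ev φ * (y2 - x3))) + c ^ 2 * (ev Λ * ev φ * y3) -
      3 * (w0 + c * w1) * (ev Λ * l1 - ev φ * l2 + c * ev φ * l3) := by
    rw [← h2, e1]
    push_cast at hd2
    linear_combination ev Λ ^ 2 * hd2
  rw [e1] at h3 ⊢
  linear_combination 2 * ev Λ * D u * h3

end SchwarzianExpansion

section DerivationEval

variable {σ τ : Type*} (D : Derivation ℚ ℂ ℂ)

lemma map_eval_of_derivation {T T' : Derivation ℂ (MvPolynomial σ ℂ) (MvPolynomial σ ℂ)}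
    {v : σ → ℂ} {d c : ℂ} (h : ∀ i, D (v i) = (MvPolynomial.eval v (T (MvPolynomial.X i)) -
      c * MvPolynomial.eval v (T' (MvPolynomial.X i))) * d) (G : MvPolynomial σ ℂ) :
    D (MvPolynomial.eval v G) = MvPolynomial.eval v (coeffD D G) +
      (MvPolynomial.eval v (T G) - c * MvPolynomial.eval v (T' G)) * d := by
  induction G using MvPolynomial.induction_on with
  | C a => simp [coeffD_C, MvPolynomial.derivation_C]
  | add p q hp hq =>
    simp only [map_add, hp, hq, coeffD_add]
    ring
  | mul_X p i hp =>
    rw [map_mul, MvPolynomial.eval_X, D.leibniz, hp, coeffD_mul_X, T.leibniz, T'.leibniz, h]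
    simp only [smul_eq_mul, map_add, map_mul, MvPolynomial.eval_X]
    ring

lemma coeffD_rename (f : σ → τ) (p : MvPolynomial σ ℂ) :
    coeffD D (MvPolynomial.rename f p) = MvPolynomial.rename f (coeffD D p) := by
  induction p using MvPolynomial.induction_on with
  | C a => simp [coeffD_C]
  | add p q hp hq => simp only [map_add, hp, hq, coeffD_add]
  | mul_X p i hp => simp only [map_mul, MvPolynomial.rename_X, coeffD_mul_X, hp]

lemma derivation_rename_eq_zero {T : Derivation ℂ (MvPolynomial τ ℂ) (MvPolynomial τ ℂ)}
    {f : σ → τ} (h : ∀ i, T (MvPolynomial.X (f i)) = 0) (p : MvPolynomial σ ℂ) :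
    T (MvPolynomial.rename f p) = 0 := by
  induction p using MvPolynomial.induction_on with
  | C a => simp [MvPolynomial.derivation_C]
  | add p q hp hq => rw [map_add, map_add, hp, hq, add_zero]
  | mul_X p i hp => rw [map_mul, MvPolynomial.rename_X, T.leibniz, hp, h, smul_zero, smul_zero,
      add_zero]

lemma eval_bind₁ (x : τ → ℂ) (w : σ → MvPolynomial τ ℂ) (G : MvPolynomial σ ℂ) :
    MvPolynomial.eval x (MvPolynomial.bind₁ w G) =
      MvPolynomial.eval (fun i => MvPolynomial.eval x (w i)) G := by
  induction G using MvPolynomial.induction_on with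
  | C a => simp
  | add p q hp hq => simp only [map_add, hp, hq]
  | mul_X p i hp => simp only [map_mul, MvPolynomial.bind₁_X_right, MvPolynomial.eval_X, hp]

end DerivationEval

section JetRing

open MvPolynomial Filter Topology

variable (n : ℕ)

/-- Polynomials in `Z`, `α` and the derivatives of the iterates of `j`. -/
abbrev JetRing := MvPolynomial (Fin 2 ⊕ ℕ × Fin (n + 1)) ℂ

/-- The derivation of the jet ring along `u`. -/
def jetShift : Derivation ℂ (JetRing n) (JetRing n) :=
  mkDerivation ℂ (Sum.elim 0 fun i => X (Sum.inr (i.1 + 1, i.2)))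

/-- The derivation `α² ∂/∂α` of the jet ring. -/
def jetAl : Derivation ℂ (JetRing n) (JetRing n) :=
  mkDerivation ℂ (Sum.elim ![0, X (Sum.inl 1) ^ 2] 0)

/-- The derivation `∂/∂u + α² ∂/∂Z` of the jet ring. -/
def jetTot : Derivation ℂ (JetRing n) (JetRing n) :=
  jetShift n + (X (Sum.inl 1) ^ 2 : JetRing n) • pderiv (Sum.inl 0)

/-- The variables `Z, j u, j (j u), …`. -/
def jetIdx : Fin (n + 1) → Fin 2 ⊕ ℕ × Fin (n + 1) :=
  fun i => if i = 0 then Sum.inl 0 else Sum.inr (0, i)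

variable {n}

lemma jetIdx_injective : Function.Injective (jetIdx n) := by
  intro a b h
  unfold jetIdx at h
  split_ifs at h with h1 h2 h2
  · rw [h1, h2]
  · simpa using h

lemma jetAl_rename (p : MvPolynomial (Fin (n + 1)) ℂ) : jetAl n (rename (jetIdx n) p) = 0 := by
  refine derivation_rename_eq_zero (fun i => ?_) p
  unfold jetIdx jetAl
  split_ifs <;> simp [mkDerivation_X]

lemma jetAl_jetShift (G : JetRing n) : jetAl n (jetShift n G) = jetShift n (jetAl n G) := by
  have : ⁅jetAl n, jetShift n⁆ = 0 := by
    refine MvPolynomial.derivation_ext fun i => ?_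
    rw [Derivation.commutator_apply]
    rcases i with i | i
    · fin_cases i <;> simp [jetAl, jetShift, mkDerivation_X]
    · simp [jetAl, jetShift, mkDerivation_X]
  rw [← sub_eq_zero, ← Derivation.commutator_apply, this, Derivation.zero_apply]

lemma jetTot_rename (p : MvPolynomial (Fin (n + 1)) ℂ) :
    jetTot n (rename (jetIdx n) p) = jetShift n (rename (jetIdx n) p) +
      X (Sum.inl 1) ^ 2 * rename (jetIdx n) (pderiv 0 p) := by
  have h := pderiv_rename (R := ℂ) (jetIdx_injective (n := n)) 0 p
  rw [← h]
  rfl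

lemma numQ₂_jet (p q : MvPolynomial (Fin (n + 1)) ℂ) :
    numQ₂ (jetAl n) (jetTot n (rename (jetIdx n) p)) (rename (jetIdx n) q) =
      -12 * X (Sum.inl 1) ^ 4 * rename (jetIdx n) q ^ 4 * rename (jetIdx n) (pderiv 0 p) *
        jetShift n (rename (jetIdx n) p) := by
  have hX : jetAl n (X (Sum.inl 1)) = X (Sum.inl 1) ^ 2 := by
    simp [jetAl, mkDerivation_X]
  have h1 : jetAl n (jetTot n (rename (jetIdx n) p)) =
      2 * X (Sum.inl 1) ^ 3 * rename (jetIdx n) (pderiv 0 p) := by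
    rw [jetTot_rename, map_add, jetAl_jetShift, jetAl_rename, map_zero, zero_add,
      Derivation.leibniz, jetAl_rename, Derivation.leibniz_pow, hX]
    simp
    ring
  have h2 : jetAl n (2 * X (Sum.inl 1) ^ 3 * rename (jetIdx n) (pderiv 0 p)) =
      6 * X (Sum.inl 1) ^ 4 * rename (jetIdx n) (pderiv 0 p) := by
    have : jetAl n 2 = 0 := by simpa using (jetAl n).map_natCast 2
    rw [Derivation.leibniz, jetAl_rename, Derivation.leibniz, Derivation.leibniz_pow, hX, this]
    simp
    ring
  rw [numQ₂, numW₁, h1, Derivation.leibniz, Derivation.leibniz_pow, jetAl_rename, h2, jetTot_rename]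
  simp
  ring

end JetRing

section JetValues

open MvPolynomial Filter Topology

variable {n : ℕ} (j : ℂ → ℂ)

/-- The point of the jet space given by values of `Z`, `α` and `u`. -/
def jetVal (Z α u : ℂ) : Fin 2 ⊕ ℕ × Fin (n + 1) → ℂ :=
  Sum.elim ![Z, α] fun i => deriv^[i.1] (jIt j i.2) u

/-- The point `(Z, j u, j (j u), …)`. -/
def jetPt (Z u : ℂ) : Fin (n + 1) → ℂ := fun i => if i = 0 then Z else jIt j i u

variable {j}

lemma eval_jetVal_rename (Z α u : ℂ) (p : MvPolynomial (Fin (n + 1)) ℂ) :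
    eval (jetVal j Z α u) (rename (jetIdx n) p) = eval (jetPt j Z u) p := by
  rw [eval_rename]
  refine congrArg (fun v => eval v p) (funext fun i => ?_)
  unfold jetPt jetIdx jetVal
  simp only [Function.comp]
  split_ifs <;> simp

lemma jetAt_jIt {D : Derivation ℚ ℂ ℂ} {e0 e1 : ℂ} (h : IsJCtx j D e0 e1) {l : ℕ} {u : ℂ}
    (hu : u ∈ HHn j l) : JetAt D (jIt j l) u := by
  induction l with
  | zero => exact jetAt_id
  | succ l ih => exact (h.jet _ hu.2).comp (ih hu.1)

lemma hasDerivAt_eval_jetVal (hj : IsModularJ j) {Z α u : ℂ} (hu : u ∈ HHn j n) (G : JetRing n) :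
    HasDerivAt (fun u => eval (jetVal j Z α u) G) (eval (jetVal j Z α u) (jetShift n G)) u := by
  induction G using MvPolynomial.induction_on with
  | C a => simpa [derivation_C] using hasDerivAt_const u a
  | add p q hp hq => simpa using hp.fun_add hq
  | mul_X p i hp =>
    have hX : HasDerivAt (fun u => jetVal j Z α u i)
        (eval (jetVal j Z α u) (jetShift n (X i))) u := by
      rcases i with i | ⟨k, l⟩
      · simpa [jetShift, mkDerivation_X, jetVal] using hasDerivAt_const u (![Z, α] i)
      · have h1 := (AnalyticAt.iterate_deriv' (analyticAt_jIt hj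
          (HHn_anti (Nat.lt_succ_iff.1 l.2) hu)) k).differentiableAt.hasDerivAt
        simpa [jetShift, mkDerivation_X, jetVal, ← Function.iterate_succ_apply'] using h1
    simp only [map_mul, eval_X, Derivation.leibniz, smul_eq_mul, map_add]
    refine (hp.fun_mul hX).congr_deriv ?_
    ring

lemma map_eval_jetVal {D : Derivation ℚ ℂ ℂ} {e0 e1 : ℂ} (h : IsJCtx j D e0 e1) {Z α u c : ℂ}
    (hu : u ∈ HHn j n) (hZ : D Z = α ^ 2 * D u) (hα : D α = -c * α ^ 2 * D u) (G : JetRing n) :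
    D (eval (jetVal j Z α u) G) = eval (jetVal j Z α u) (coeffD D G) +
      (eval (jetVal j Z α u) (jetTot n G) - c * eval (jetVal j Z α u) (jetAl n G)) * D u := by
  refine map_eval_of_derivation D (fun i => ?_) G
  rcases i with i | ⟨k, l⟩
  · fin_cases i
    · simp [jetTot, jetShift, jetAl, mkDerivation_X, jetVal, hZ]
    · simp [jetTot, jetShift, jetAl, mkDerivation_X, jetVal, hα]
  · have h1 := (jetAt_jIt h (HHn_anti (Nat.lt_succ_iff.1 l.2) hu)).2 k
    simpa [jetTot, jetShift, jetAl, mkDerivation_X, jetVal] using h1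

lemma exists_eval_jetVal (Z u : ℂ) (G : JetRing n) : ∃ T : MvPolynomial (Fin 2) ℂ,
    ∀ a c : ℂ, eval ![a, c] T = eval (jetVal j Z (a - c * Z) u) G := by
  refine ⟨bind₁ (Sum.elim ![C Z, X 0 - X 1 * C Z] fun i => C (deriv^[i.1] (jIt j i.2) u)) G,
    fun a c => ?_⟩
  rw [eval_bind₁]
  refine congrArg (fun v => eval v G) (funext fun i => ?_)
  rcases i with i | i
  · fin_cases i <;> simp [jetVal]
  · simp [jetVal]

lemma analyticAt_eval_jetVal (hj : IsModularJ j) {U : ℂ → ℂ} {t : ℂ} (hU : AnalyticAt ℂ U t)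
    (hUt : U t ∈ HHn j n) (a c : ℂ) (G : JetRing n) :
    AnalyticAt ℂ (fun t => eval (jetVal j t (a - c * t) (U t)) G) t := by
  refine analyticAt_eval (fun i => ?_) G
  rcases i with i | ⟨k, l⟩
  · fin_cases i
    · exact analyticAt_id
    · exact analyticAt_const.sub (analyticAt_const.mul analyticAt_id)
  · exact (AnalyticAt.iterate_deriv' (analyticAt_jIt hj
      (HHn_anti (Nat.lt_succ_iff.1 l.2) hUt)) k).fun_comp hU

end JetValues

section MoebiusJet

variable {D : Derivation ℚ ℂ ℂ}

/-- Schwarzian derivatives are invariant under Möbius transformations with constant coefficients,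
here given by the cocycle `α`. -/
lemma schw_of_cocycle {Z u α c : ℂ} (hc : D c = 0) (hα0 : α ≠ 0) (hu : D u ≠ 0)
    (hZ : D Z = α ^ 2 * D u) (hα : D α = -c * α ^ 2 * D u) : schw D Z = schw D u := by
  have h2 : D (D Z) = α ^ 2 * D (D u) - 2 * c * α ^ 3 * D u ^ 2 := by
    rw [hZ, D.leibniz, D.leibniz_pow, hα]
    simp
    ring
  have h3 : D (D (D Z)) = α ^ 2 * D (D (D u)) - 6 * c * α ^ 3 * D u * D (D u)
      + 6 * c ^ 2 * α ^ 4 * D u ^ 3 := by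
    have h20 : D (2 : ℂ) = 0 := by simpa using D.map_natCast 2
    rw [h2, map_sub, D.leibniz, D.leibniz_pow, hα, D.leibniz, D.leibniz, D.leibniz, D.leibniz_pow,
      D.leibniz_pow, hα, hc, h20]
    simp
    ring
  rw [schw, schw, h3, h2, hZ]
  field_simp
  ring

lemma cocycle_of_moeb {Z u a b c d : ℂ} (ha : D a = 0) (hb : D b = 0) (hc : D c = 0) (hd : D d = 0)
    (h : a * d - b * c = 1) (h0 : c * u + d ≠ 0) (hZ : Z = (a * u + b) / (c * u + d)) :
    a - c * Z ≠ 0 ∧ D Z = (a - c * Z) ^ 2 * D u ∧ D (a - c * Z) = -c * (a - c * Z) ^ 2 * D u := by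
  have h1 : Z * (c * u + d) = a * u + b := by rw [hZ, div_mul_cancel₀ _ h0]
  have h2 : (a - c * Z) * (c * u + d) = 1 := by linear_combination h - c * h1
  have h3 : D Z = (a - c * Z) ^ 2 * D u := by
    have h4 := congrArg D h1
    simp only [D.leibniz, map_add, ha, hb, hc, hd, smul_eq_mul] at h4
    refine mul_right_cancel₀ h0 ?_
    linear_combination h4 - (a - c * Z) * D u * h2
  refine ⟨left_ne_zero_of_mul (h2.trans_ne one_ne_zero), h3, ?_⟩
  rw [map_sub, D.leibniz, ha, hc, h3]
  simp
  ring

end MoebiusJet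

section BasePoint

open MvPolynomial Filter Topology

/-- A point `(x, u)` near which solutions with arbitrary first coordinate exist. -/
structure IsBasePt {n : ℕ} (j : ℂ → ℂ) (D : Derivation ℚ ℂ ℂ) (e0 e1 : ℂ)
    (P : MvPolynomial (Fin (n + 1)) ℂ) (x u : ℂ) : Prop where
  mem : u ∈ HHn j n
  eval_eq : eval (jetPt j x u) P = 0
  eval_pderiv : eval (jetPt j x u) (pderiv 0 P) ≠ 0
  eval_coeffD : eval (jetPt j x u) (coeffD D P) ≠ 0
  deriv_ne : deriv (fun u => eval (jetPt j x u) P) u ≠ 0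
  reg : ∀ i, 1 ≤ i → i ≤ n → IsRegPt e0 e1 (jIt j i u)
  sum_ne : ∀ a b, 1 ≤ a → a < b → b ≤ n → schwSum j e0 e1 a b u ≠ 0

lemma exists_isBasePt {n : ℕ} (hn : 0 < n) {j : ℂ → ℂ} {D : Derivation ℚ ℂ ℂ} {e0 e1 : ℂ}
    (h : IsJCtx j D e0 e1) {P : MvPolynomial (Fin (n + 1)) ℂ} (hP : Irreducible P)
    (h0 : pderiv 0 P ≠ 0) (hl : pderiv (Fin.last n) P ≠ 0)
    {m : Fin (n + 1) →₀ ℕ} (hm : coeff m P = 1) (hD : coeffD D P ≠ 0) :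
    ∃ (x : ℝ) (u : ℂ), u ∈ HH ∧ IsBasePt j D e0 e1 P x u := by
  obtain ⟨N, rfl⟩ : ∃ N, n = N + 1 := ⟨n - 1, by omega⟩
  obtain ⟨τ, h1, h2, h3, h4, h5, h6⟩ := exists_generic_real_point hn h.ne hP h0 hl hm hD
  obtain ⟨x, hx⟩ := h1 0 (Fin.last_pos.ne)
  have hcont : ∀ p : MvPolynomial (Fin (N + 1 + 1)) ℂ, Continuous fun v => eval v p :=
    fun p => MvPolynomial.continuous_eval p
  have hev : ∀ᶠ v in 𝓝 τ, eval v (pderiv 0 P) ≠ 0 ∧ eval v (coeffD D P) ≠ 0 ∧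
      ∀ i, IsRegPt e0 e1 (v i) :=
    ((hcont _).continuousAt.eventually_ne h3).and (((hcont _).continuousAt.eventually_ne h5).and
      (eventually_all.2 fun i => (continuous_apply i).continuousAt.eventually (h6 i).eventually))
  obtain ⟨ε, hε, hball⟩ := Metric.eventually_nhds_iff.1 hev
  obtain ⟨v, hv, hvτ, hv0, hvd, hvs⟩ := exists_tailPt h.hj h.crit h1 h6 h2 h4 N (by omega) ε hε
  rw [Nat.add_sub_cancel_left] at hvτ hv0 hvd
  obtain ⟨u, hu, rfl⟩ := j_surj h.hj v
  have hpt : ∀ w, tailPt j τ 1 (j w) = jetPt j (τ 0) w := by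
    intro w
    funext i
    unfold tailPt jetPt
    rcases Fin.eq_zero_or_eq_succ i with rfl | ⟨i, rfl⟩
    · simp
    · rw [if_neg (by simp), if_neg (Fin.succ_ne_zero i), ← jIt_succ']
      simp
  obtain ⟨h7, h8, h9⟩ := hball (y := tailPt j τ 1 (j u))
    ((dist_pi_lt_iff hε).2 fun i => by rw [dist_eq_norm]; exact hvτ i)
  rw [hpt] at h7 h8 h9 hv0
  have hun : u ∈ HHn j (N + 1) := mem_HHn_succ.2 ⟨hu, hv⟩
  have hreg : ∀ i, 1 ≤ i → i ≤ N + 1 → IsRegPt e0 e1 (jIt j i u) := by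
    intro i hi1 hi2
    have := h9 ⟨i, by omega⟩
    rwa [jetPt, if_neg (by rw [Fin.ext_iff]; simp; omega)] at this
  have hju : deriv j u ≠ 0 := (h.crit u hu).2 ⟨(hreg 1 le_rfl (by omega)).ne0,
    (hreg 1 le_rfl (by omega)).ne1⟩
  refine ⟨x, u, hu, ?_⟩
  rw [← hx]
  refine ⟨hun, hv0, h7, h8, ?_, hreg, fun a b ha hab hb => ?_⟩
  · have h10 := (differentiableAt_of_deriv_ne_zero hvd).hasDerivAt.comp u
      (analyticAt_j h.hj hu).differentiableAt.hasDerivAt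
    have h11 : (fun w => eval (jetPt j (τ 0) w) P) = (fun v => eval (tailPt j τ 1 v) P) ∘ j := by
      funext w
      rw [Function.comp, hpt]
    rw [h11, h10.deriv]
    exact mul_ne_zero hvd hju
  · obtain ⟨a, rfl⟩ : ∃ a', a = a' + 1 := ⟨a - 1, by omega⟩
    obtain ⟨b, rfl⟩ : ∃ b', b = b' + 1 := ⟨b - 1, by omega⟩
    rw [schwSum_succ_succ h.hj (HHn_anti (by omega) hun)]
    exact mul_ne_zero (pow_ne_zero _ hju) (hvs a b (by omega) (by omega))

end BasePoint

section ImplicitBranch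

open MvPolynomial Filter Topology

variable {n : ℕ} {j : ℂ → ℂ} {D : Derivation ℚ ℂ ℂ} {e0 e1 : ℂ}
  {P : MvPolynomial (Fin (n + 1)) ℂ} {x u : ℂ}

lemma analyticAt_jetPt (hj : IsModularJ j) (hu : u ∈ HHn j n) (Q : MvPolynomial (Fin (n + 1)) ℂ) :
    AnalyticAt ℂ (fun q : ℂ × ℂ => eval (jetPt j q.1 q.2) Q) (x, u) := by
  refine analyticAt_eval (fun i => ?_) Q
  unfold jetPt
  split_ifs
  · exact analyticAt_fst
  · exact AnalyticAt.fun_comp (f := fun q : ℂ × ℂ => q.2)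
      (analyticAt_jIt hj (HHn_anti (Nat.lt_succ_iff.1 i.2) hu)) analyticAt_snd

lemma IsBasePt.exists_branch (hj : IsModularJ j) (h : IsBasePt j D e0 e1 P x u) (hu : u ∈ HH) :
    ∃ U : ℂ → ℂ, AnalyticAt ℂ U x ∧ U x = u ∧ ∀ᶠ t in 𝓝 x, AnalyticAt ℂ U t ∧
      U t ∈ HH ∧ U t ∈ HHn j n ∧ eval (jetPt j t (U t)) P = 0 ∧
      eval (jetPt j t (U t)) (coeffD D P) ≠ 0 ∧
      (∀ i, 1 ≤ i → i ≤ n → IsRegPt e0 e1 (jIt j i (U t))) ∧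
      ∀ a b, 1 ≤ a → a < b → b ≤ n → schwSum j e0 e1 a b (U t) ≠ 0 := by
  have hH := analyticAt_jetPt (x := x) hj h.mem P
  have h1 : fderiv ℂ (fun q : ℂ × ℂ => eval (jetPt j q.1 q.2) P) (x, u) (0, 1) ≠ 0 := by
    have h2 := hH.differentiableAt.hasFDerivAt.comp_hasDerivAt u
      ((hasDerivAt_const u x).prodMk (hasDerivAt_id u))
    rw [← h2.deriv]
    exact h.deriv_ne
  obtain ⟨U, hU, hUx, hU0⟩ := exists_implicit hH h.eval_eq h1
  subst hUx
  refine ⟨U, hU, rfl, ?_⟩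
  have hc := hU.continuousAt
  have hcD : ContinuousAt (fun t => eval (jetPt j t (U t)) (coeffD D P)) x :=
    ContinuousAt.comp' (f := fun t => (t, U t))
      (g := fun q : ℂ × ℂ => eval (jetPt j q.1 q.2) (coeffD D P))
      (analyticAt_jetPt hj h.mem _).continuousAt (continuousAt_id.prodMk hc)
  have hreg : ∀ᶠ t in 𝓝 x, ∀ i ∈ Finset.Icc 1 n, IsRegPt e0 e1 (jIt j i (U t)) := by
    refine (Finset.eventually_all _).2 fun i hi => ?_
    obtain ⟨h2, h3⟩ := Finset.mem_Icc.1 hi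
    exact (hc.eventually ((analyticAt_jIt hj (HHn_anti h3 h.mem)).continuousAt.eventually
      (h.reg i h2 h3).eventually))
  have hsum : ∀ᶠ t in 𝓝 x, ∀ a ∈ Finset.Icc 1 n, ∀ b ∈ Finset.Icc 1 n, a < b →
      schwSum j e0 e1 a b (U t) ≠ 0 := by
    refine (Finset.eventually_all _).2 fun a ha => (Finset.eventually_all _).2 fun b hb => ?_
    obtain ⟨h2, -⟩ := Finset.mem_Icc.1 ha
    obtain ⟨-, h3⟩ := Finset.mem_Icc.1 hb
    by_cases hab : a < b
    · have h4 := (analyticAt_schwSum hj (a := a) (HHn_anti h3 h.mem)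
        fun i hi hi' => h.reg i (by omega) (by omega)).continuousAt
      filter_upwards [hc.eventually (h4.eventually_ne (h.sum_ne a b h2 hab h3))] with t
          ht _ using ht
    · exact .of_forall fun t h => absurd h hab
  filter_upwards [hU.eventually_analyticAt, hc.eventually (isOpen_HH.eventually_mem hu),
    hc.eventually (eventually_mem_HHn hj h.mem), hU0, hcD.eventually_ne h.eval_coeffD, hreg, hsum]
    with t t1 t2 t3 t4 t5 t6 t7
  exact ⟨t1, t2, t3, t4, t5, fun i h1 h2 => t6 i (Finset.mem_Icc.2 ⟨h1, h2⟩),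
    fun a b h1 h2 h3 => t7 a (Finset.mem_Icc.2 ⟨h1, by omega⟩) b
        (Finset.mem_Icc.2 ⟨by omega, h3⟩) h2⟩

end ImplicitBranch

section SchwarzianObstruction

open MvPolynomial Filter Topology

variable {n : ℕ} {j : ℂ → ℂ} {D : Derivation ℚ ℂ ℂ} {e0 e1 : ℂ}
  {P : MvPolynomial (Fin (n + 1)) ℂ}

/-- The linear coefficient in the equation for `D u` obtained by differentiating `P = 0`. -/
def jetLin (P : MvPolynomial (Fin (n + 1)) ℂ) : JetRing n := jetTot n (rename (jetIdx n) P)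

variable (D P) in
/-- A numerator for `schw D u - D u ^ 2 * S - σ`, where `u` solves the equation `P = 0`. -/
def schwObs (ev : JetRing n →+* ℂ) (S σ c : ℂ) : ℂ :=
  ev (numQ₀ (coeffD D) (jetTot n) (jetLin P) (rename (jetIdx n) (coeffD D P)))
    + c * ev (numQ₁ (coeffD D) (jetTot n) (jetAl n) (jetLin P) (rename (jetIdx n) (coeffD D P)))
    + c ^ 2 * ev (numQ₂ (jetAl n) (jetLin P) (rename (jetIdx n) (coeffD D P)))
    - 2 * ev (rename (jetIdx n) (coeffD D P)) ^ 4 * ev (jetLin P) ^ 2 * S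
    - 2 * σ * ev (rename (jetIdx n) (coeffD D P)) ^ 2 * ev (jetLin P) ^ 4

lemma linear_eq_zero (h : IsJCtx j D e0 e1) {Z α u c : ℂ} (hu : u ∈ HHn j n)
    (hZ : D Z = α ^ 2 * D u) (hα : D α = -c * α ^ 2 * D u) (hP : eval (jetPt j Z u) P = 0) :
    eval (jetVal j Z α u) (rename (jetIdx n) (coeffD D P)) +
      eval (jetVal j Z α u) (jetLin P) * D u = 0 := by
  have h1 := map_eval_jetVal h hu hZ hα (rename (jetIdx n) P)
  rw [eval_jetVal_rename, hP, map_zero, jetAl_rename, map_zero, mul_zero, sub_zero,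
    coeffD_rename] at h1
  exact h1.symm

lemma schwObs_eq (h : IsJCtx j D e0 e1) {Z α u c : ℂ} (hu : u ∈ HHn j n) (hc : D c = 0)
    (hZ : D Z = α ^ 2 * D u) (hα : D α = -c * α ^ 2 * D u) (hP : eval (jetPt j Z u) P = 0)
    (hφ : eval (jetPt j Z u) (coeffD D P) ≠ 0) (S σ : ℂ) :
    schwObs D P (eval (jetVal j Z α u)) S σ c =
      2 * eval (jetPt j Z u) (coeffD D P) ^ 2 * eval (jetVal j Z α u) (jetLin P) ^ 4 *
        (schw D u - D u ^ 2 * S - σ) := by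
  have h1 := linear_eq_zero h hu hZ hα hP
  rw [← eval_jetVal_rename Z α u] at hφ
  have h2 := schw_expansion (cd := coeffD D) (Θ := jetTot n) (A := jetAl n)
    (map_eval_jetVal h hu hZ hα) hc (jetAl_rename _) h1 hφ
  rw [schwObs, ← h2, ← eval_jetVal_rename Z α u]
  generalize eval (jetVal j Z α u) (rename (jetIdx n) (coeffD D P)) = x at *
  generalize eval (jetVal j Z α u) (jetLin P) = y at *
  have hx : x = -(y * D u) := by linear_combination h1
  rw [hx]
  ring

lemma exists_eval_schwObs {Z u : ℂ} (hj : IsModularJ j) (hu : u ∈ HHn j n)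
    (hZ : eval (jetPt j Z u) (pderiv 0 P) ≠ 0) (hφ : eval (jetPt j Z u) (coeffD D P) ≠ 0)
    (hd : deriv (fun u => eval (jetPt j Z u) P) u ≠ 0) (S σ : ℂ) :
    ∃ T : MvPolynomial (Fin 2) ℂ, T ≠ 0 ∧ ∀ a c : ℂ,
      eval ![a, c] T = schwObs D P (eval (jetVal j Z (a - c * Z) u)) S σ c := by
  choose T hT using exists_eval_jetVal (j := j) (n := n) Z u
  set φ : JetRing n := rename (jetIdx n) (coeffD D P) with hφ'
  have key : ∀ a c : ℂ, eval ![a, c] (T (numQ₀ (coeffD D) (jetTot n) (jetLin P) φ)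
      + X 1 * T (numQ₁ (coeffD D) (jetTot n) (jetAl n) (jetLin P) φ)
      + X 1 ^ 2 * T (numQ₂ (jetAl n) (jetLin P) φ)
      - 2 * T φ ^ 4 * T (jetLin P) ^ 2 * C S - 2 * C σ * T φ ^ 2 * T (jetLin P) ^ 4) =
      schwObs D P (eval (jetVal j Z (a - c * Z) u)) S σ c := by
    intro a c
    simp only [map_add, map_sub, map_mul, map_pow, hT, eval_C, eval_X, map_ofNat, schwObs]
    simp [hφ']
  refine ⟨_, fun h0 => ?_, key⟩
  rw [h0] at key
  have h1 : ∀ c : ℂ, schwObs D P (eval (jetVal j Z 1 u)) S σ c = 0 := by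
    intro c
    have h2 := key (1 + c * Z) c
    rw [map_zero, add_sub_cancel_right] at h2
    exact h2.symm
  have h2 : eval (jetVal j Z 1 u) (numQ₂ (jetAl n) (jetLin P) φ) = 0 := by
    have a0 := h1 0
    have a1 := h1 1
    have a2 := h1 (-1)
    simp only [schwObs] at a0 a1 a2
    linear_combination (a1 + a2) / 2 - a0
  rw [jetLin, numQ₂_jet] at h2
  simp only [map_mul, map_pow, eval_X, eval_jetVal_rename] at h2
  have h3 : eval (jetVal j Z 1 u) (jetShift n (rename (jetIdx n) P)) ≠ 0 := by
    have h4 := hasDerivAt_eval_jetVal hj (Z := Z) (α := 1) hu (rename (jetIdx n) P)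
    simp only [eval_jetVal_rename] at h4
    rwa [← h4.deriv]
  refine mul_ne_zero (mul_ne_zero (mul_ne_zero (mul_ne_zero ?_ ?_) (pow_ne_zero 4 hφ)) hZ) h3 h2
  · simp [map_ofNat]
  · simp [jetVal]

lemma analyticAt_schwObs (hj : IsModularJ j) {U S : ℂ → ℂ} {t : ℂ} (hU : AnalyticAt ℂ U t)
    (hUt : U t ∈ HHn j n) (hS : AnalyticAt ℂ S t) (a c σ : ℂ) :
    AnalyticAt ℂ (fun t => schwObs D P (eval (jetVal j t (a - c * t) (U t))) (S t) σ c) t := by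
  have h := analyticAt_eval_jetVal hj hU hUt a c
  unfold schwObs
  have h1 := h (rename (jetIdx n) (coeffD D P))
  have h2 := h (jetLin P)
  exact ((((h _).add (analyticAt_const.mul (h _))).add (analyticAt_const.mul (h _))).sub
    (((analyticAt_const.mul (h1.pow 4)).mul (h2.pow 2)).mul hS)).sub
    ((analyticAt_const.mul (h1.pow 2)).mul (h2.pow 4))

end SchwarzianObstruction

section Ladder

variable {n : ℕ} {j : ℂ → ℂ} {D : Derivation ℚ ℂ ℂ} {e0 e1 : ℂ}

/-- The Schwarzian derivatives of the iterates along a `j`-orbit. -/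
lemma IsJCtx.orbit (h : IsJCtx j D e0 e1) {Z u : ℂ} (hZ : Z ∈ HHn j n) (hu : u ∈ HHn j n)
    (hZu : j Z = j u) (hDZ : D Z ≠ 0) (hs : schw D Z = schw D u)
    (hreg : ∀ i, 1 ≤ i → i < n → IsRegPt e0 e1 (jIt j i u)) {k : ℕ} (hk : k < n) :
    D (jIt j k Z) ≠ 0 ∧ schw D (jIt j k Z) = schw D u - D u ^ 2 * schwSum j e0 e1 1 (k + 1) u := by
  have hmem : ∀ i < n, jIt j i Z ∈ HH := mem_HHn.1 hZ
  induction k with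
  | zero => exact ⟨hDZ, by simpa [schwSum, jIt] using hs⟩
  | succ k ih =>
    obtain ⟨ih1, ih2⟩ := ih (by lia)
    have hkZ := hmem k (by lia)
    have e : jIt j (k + 1) Z = jIt j (k + 1) u := by rw [jIt_succ', hZu, ← jIt_succ']
    have hne : deriv j (jIt j k Z) ≠ 0 := by
      rw [h.crit _ hkZ, ← jIt_succ (j := j) k, e]
      have := hreg (k + 1) (by lia) hk
      exact ⟨this.ne0, this.ne1⟩
    refine ⟨?_, ?_⟩
    · rw [jIt_succ, h.map_j hkZ]
      exact mul_ne_zero hne ih1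
    · have h1 : schw D (jIt j k Z) = schw D (jIt j (k + 1) Z) +
          schwR e0 e1 (jIt j (k + 1) Z) * D (jIt j (k + 1) Z) ^ 2 :=
        (h.isDatum hkZ ih1).schw_z
      have h2 : D (jIt j (k + 1) Z) = deriv (jIt j (k + 1)) u * D u := by
        rw [e, (jetAt_jIt h (HHn_anti hk.le hu)).map]
      have h3 : schwSum j e0 e1 1 (k + 1 + 1) u = schwSum j e0 e1 1 (k + 1) u +
          schwR e0 e1 (jIt j (k + 1) u) * deriv (jIt j (k + 1)) u ^ 2 :=
        Finset.sum_Ico_succ_top (by lia) _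
      rw [h2, ih2, e] at h1
      rw [h3, e]
      linear_combination -h1

end Ladder

section Solutions

open MvPolynomial Filter Topology

variable {n : ℕ} {j : ℂ → ℂ} {D : Derivation ℚ ℂ ℂ} {e0 e1 : ℂ}
  {P : MvPolynomial (Fin (n + 1)) ℂ}

/-- On a branch of `P = 0` over a neighbourhood of `x` there is a point, related to its branch value
by a unimodular Möbius transformation, at which finitely many obstructions do not vanish. -/
lemma exists_moeb_branch {U : ℂ → ℂ} {x : ℝ} {Q : ℂ → Prop}
    (hQ : ∀ᶠ t in 𝓝 (x : ℂ), Q t) (hU : ∀ t, Q t → AnalyticAt ℂ U t ∧ U t ∈ HH)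
    {I : Type*} [Finite I] (Φ : I → ℂ → ℂ → ℂ → ℂ)
    (hΦ : ∀ i a c t, Q t → AnalyticAt ℂ (Φ i a c) t)
    (T : I → MvPolynomial (Fin 2) ℂ) (hT0 : ∀ i, T i ≠ 0)
    (hT : ∀ i a c, eval ![a, c] (T i) = Φ i a c x) :
    ∃ (a b c d : ℤ) (t : ℂ), a * d - b * c = 1 ∧ Q t ∧ t = (a * U t + b) / (c * U t + d) ∧
      ∀ i, Φ i a c t ≠ 0 := by
  have := Fintype.ofFinite I
  obtain ⟨ε, hε, hball⟩ := Metric.eventually_nhds_iff_ball.1 hQ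
  obtain ⟨a, b, c, d, hc, hdet, hlt, hne⟩ := exists_coprime_eval_ne_zero
    (Finset.prod_ne_zero_iff.2 fun i (_ : i ∈ Finset.univ) => hT0 i) x hε
  rw [map_prod, Finset.prod_ne_zero_iff] at hne
  set r : ℂ := a / c with hr
  have hrx : r ∈ Metric.ball (x : ℂ) ε := by
    have : r - x = ((a / c - x : ℝ) : ℂ) := by push_cast; rfl
    rw [Metric.mem_ball, dist_eq_norm, this, Complex.norm_real]
    exact hlt
  have hev : ∀ i, ∀ᶠ t in 𝓝[≠] r, Φ i a c t ≠ 0 := by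
    intro i
    by_contra hcon
    rw [not_eventually] at hcon
    have han : AnalyticOnNhd ℂ (Φ i a c) (Metric.ball x ε) := fun t ht => hΦ i a c t (hball t ht)
    have h0 := han.eqOn_zero_of_preconnected_of_frequently_eq_zero
      (convex_ball (x : ℂ) ε).isPreconnected hrx (hcon.mono fun t ht => not_not.1 ht)
      (Metric.mem_ball_self hε)
    exact hne i (Finset.mem_univ i) ((hT i a c).trans h0)
  obtain ⟨Z, hZ, -, hZev⟩ := exists_moeb_seq hc hdet (hU r (hball r hrx)).1 (hU r (hball r hrx)).2
  have hZ' : Tendsto Z atTop (𝓝[≠] r) :=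
    tendsto_nhdsWithin_iff.2 ⟨hZ, hZev.mono fun k hk => hk.1⟩
  obtain ⟨k, hk1, hk2, hk3⟩ := ((hZ'.eventually (eventually_all.2 hev)).and
    (hZev.and (hZ.eventually (Metric.isOpen_ball.mem_nhds hrx)))).exists
  exact ⟨a, b + k * a, c, d + k * c, Z k, by linear_combination hdet, hball _ hk3, hk2.2.2, hk1⟩

/-- The equation `P(z, j z, …, jₙ z) = 0` has solutions whose Schwarzian derivatives are pairwise
distinct and avoid a given finite set. -/
theorem exists_solution (h : IsJCtx j D e0 e1) (hn : 0 < n) (hP : Irreducible P)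
    (h0 : pderiv 0 P ≠ 0) (hl : pderiv (Fin.last n) P ≠ 0) {m : Fin (n + 1) →₀ ℕ}
    (hm : coeff m P = 1) (hD : coeffD D P ≠ 0) (Bad : Finset ℂ) :
    ∃ z ∈ HHn j n, eval (fun k : Fin (n + 1) => jIt j k z) P = 0 ∧
      (∀ k < n, D (jIt j k z) ≠ 0 ∧ schw D (jIt j k z) ∉ Bad) ∧
      ∀ k < n, ∀ l < k, schw D (jIt j k z) ≠ schw D (jIt j l z) := by
  have hj := h.hj
  obtain ⟨x, u, hu, hb⟩ := exists_isBasePt hn h hP h0 hl hm hD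
  obtain ⟨U, -, hUx, hev⟩ := hb.exists_branch hj hu
  have hx := hev.self_of_nhds
  have hS : ∀ (k : Fin n) t, U t ∈ HHn j n →
      (∀ i, 1 ≤ i → i ≤ n → IsRegPt e0 e1 (jIt j i (U t))) →
      AnalyticAt ℂ (schwSum j e0 e1 1 (k + 1)) (U t) := fun k t ht hr =>
    analyticAt_schwSum hj (HHn_anti k.2 ht) fun i hi hi' => hr i hi (by have := k.2; lia)
  choose T hT0 hT using fun i : Fin n × Bad => exists_eval_schwObs hj hb.mem hb.eval_pderiv
    hb.eval_coeffD hb.deriv_ne (schwSum j e0 e1 1 (i.1 + 1) u) i.2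
  obtain ⟨a, b, c, d, t, hdet, ⟨hUt, hUH, hUn, hP0, hφ, hreg, hsum⟩, ht, hΦ⟩ :=
    exists_moeb_branch hev (fun t ht => ⟨ht.1, ht.2.1⟩)
      (fun (i : Fin n × Bad) a c t => schwObs D P (eval (jetVal j t (a - c * t) (U t)))
        (schwSum j e0 e1 1 (i.1 + 1) (U t)) i.2 c)
      (fun i a c t ht => analyticAt_schwObs hj ht.1 ht.2.2.1
        ((hS i.1 t ht.2.2.1 ht.2.2.2.2.2.1).fun_comp ht.1) a c i.2) T hT0
      (fun i a c => by rw [hT, hUx])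
  have hden : (c : ℂ) * U t + d ≠ 0 := denom_ne_zero' hdet hUH
  have h_integral : ∀ a : ℤ, D (a : ℂ) = 0 := fun a => D.map_intCast a
  obtain ⟨hα0, hDt, hDα⟩ := cocycle_of_moeb (h_integral a) (h_integral b) (h_integral c)
      (h_integral d)
    (by exact_mod_cast hdet) hden ht
  have hjt : j t = j (U t) := by
    conv_lhs => rw [ht]
    exact j_moeb hj hdet hUH
  have htH : t ∈ HH := by
    rw [ht]
    exact moeb_mem hdet hUH
  have htn : t ∈ HHn j n := by
    obtain ⟨m, rfl⟩ : ∃ m, n = m + 1 := ⟨n - 1, by lia⟩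
    rw [mem_HHn_succ, hjt]
    exact ⟨htH, (mem_HHn_succ.1 hUn).2⟩
  have hlin := linear_eq_zero h hUn hDt hDα hP0
  rw [eval_jetVal_rename] at hlin
  have hDu : D (U t) ≠ 0 := fun h0 => hφ (by simpa [h0] using hlin)
  have hDt0 : D t ≠ 0 := by
    rw [hDt]
    exact mul_ne_zero (pow_ne_zero 2 hα0) hDu
  have horb := fun k (hk : k < n) => h.orbit htn hUn hjt hDt0
    (schw_of_cocycle (h_integral c) hα0 hDu hDt hDα) (fun i hi hi' => hreg i hi hi'.le) hk
  refine ⟨t, htn, ?_, fun k hk => ⟨(horb k hk).1, fun hbad => ?_⟩, fun k hk l hlk heq => ?_⟩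
  · refine (congrArg (fun v => eval v P) (funext fun i => ?_)).trans hP0
    unfold jetPt
    split_ifs with hi
    · simp [hi, jIt]
    · obtain ⟨k, hk⟩ : ∃ k, (i : ℕ) = k + 1 :=
        Nat.exists_eq_succ_of_ne_zero fun hi0 => hi (Fin.ext hi0)
      rw [hk, jIt_succ', hjt, ← jIt_succ']
  · refine hΦ (⟨k, hk⟩, ⟨_, hbad⟩) ?_
    rw [schwObs_eq h hUn (h_integral c) hDt hDα hP0 hφ]
    simp only [(horb k hk).2, sub_self, mul_zero]
  · rw [(horb k hk).2, (horb l (hlk.trans hk)).2] at heq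
    refine hsum (l + 1) (k + 1) (by lia) (by lia) (by lia) ?_
    have h1 : schwSum j e0 e1 1 (l + 1) (U t) + schwSum j e0 e1 (l + 1) (k + 1) (U t) =
        schwSum j e0 e1 1 (k + 1) (U t) :=
      Finset.sum_Ico_consecutive _ (by lia) (by lia)
    have h2 : D (U t) ^ 2 * schwSum j e0 e1 (l + 1) (k + 1) (U t) = 0 := by
      linear_combination D (U t) ^ 2 * h1 - heq
    exact (mul_eq_zero.1 h2).resolve_left (pow_ne_zero 2 hDu)

end Solutions

section HypersurfaceDimension

open MvPolynomial

variable {σ : Type*} [Finite σ]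

lemma aeval_eq_eval' {σ : Type*} (x : σ → ℂ) (p : MvPolynomial σ ℂ) : aeval x p = eval x p := by
  rw [← coe_aeval_eq_eval]
  rfl

lemma ringKrullDim_mvPolynomial_complex (n : ℕ) :
    ringKrullDim (MvPolynomial (Fin n) ℂ) = n := by
  simp

/-- The ring automorphism of translation by `a`. -/
def translateEquiv (a : σ → ℂ) : MvPolynomial σ ℂ ≃ₐ[ℂ] MvPolynomial σ ℂ :=
  AlgEquiv.ofAlgHom (aeval fun i => X i + C (a i)) (aeval fun i => X i - C (a i))
    (by ext i; simp [← algebraMap_eq]) (by ext i; simp [← algebraMap_eq])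

lemma eval_translateEquiv (a x : σ → ℂ) (p : MvPolynomial σ ℂ) :
    eval x (translateEquiv a p) = eval (fun i => x i + a i) p := by
  change eval x (bind₁ (fun i => X i + C (a i)) p) = _
  rw [eval_bind₁]
  simp

lemma height_vanishingIdeal_singleton {n : ℕ} (b : Fin n → ℂ) :
    ((vanishingIdeal ℂ {b} : Ideal (MvPolynomial (Fin n) ℂ)).height : WithBot ℕ∞) =
      ringKrullDim (MvPolynomial (Fin n) ℂ) := by
  have hle : ∀ b : Fin n → ℂ, ((vanishingIdeal ℂ {b} : Ideal (MvPolynomial (Fin n) ℂ)).height :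
      WithBot ℕ∞) ≤ ringKrullDim (MvPolynomial (Fin n) ℂ) := fun b =>
    Ideal.height_le_ringKrullDim_of_ne_top
      (isMaximal_iff_eq_vanishingIdeal_singleton.2 ⟨b, rfl⟩).ne_top
  refine (hle b).antisymm ?_
  rw [ringKrullDim_le_iff_isMaximal_height_le]
  intro M hM
  obtain ⟨a, rfl⟩ := isMaximal_iff_eq_vanishingIdeal_singleton.1 hM
  have h1 : (vanishingIdeal ℂ {a} : Ideal (MvPolynomial (Fin n) ℂ)) =
      (vanishingIdeal ℂ {b}).comap (translateEquiv fun i => a i - b i).toRingEquiv := by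
    ext p
    rw [Ideal.mem_comap, mem_vanishingIdeal_singleton_iff, mem_vanishingIdeal_singleton_iff,
      aeval_eq_eval', aeval_eq_eval']
    change _ ↔ eval b (translateEquiv (fun i => a i - b i) p) = 0
    rw [eval_translateEquiv]
    simp
  rw [h1, RingEquiv.height_comap]

lemma isAlgSet_iff {V : Set (σ → ℂ)} :
    IsAlgSet V ↔ ∃ I : Ideal (MvPolynomial σ ℂ), V = zeroLocus ℂ I := by
  constructor
  · rintro ⟨P, rfl⟩
    refine ⟨Ideal.span P, ?_⟩
    rw [zeroLocus_span]
    simp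
  · rintro ⟨I, rfl⟩
    exact ⟨I, by ext; simp⟩

lemma IsAlgSet.zeroLocus_vanishingIdeal {V : Set (σ → ℂ)} (h : IsAlgSet V) :
    zeroLocus ℂ (vanishingIdeal ℂ V) = V := by
  obtain ⟨I, rfl⟩ := isAlgSet_iff.1 h
  refine (zeroLocus_anti_mono (le_vanishingIdeal_zeroLocus I)).antisymm ?_
  exact zeroLocus_vanishingIdeal_le _

lemma isIrr_iff_isPrime {V : Set (σ → ℂ)} :
    IsIrr V ↔ (vanishingIdeal ℂ V : Ideal (MvPolynomial σ ℂ)).IsPrime := by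
  constructor
  · rintro ⟨⟨x, hx⟩, h⟩
    refine ⟨fun h1 => ?_, fun {p q} hpq => ?_⟩
    · have h2 : (1 : MvPolynomial σ ℂ) ∈ vanishingIdeal ℂ V := h1 ▸ Submodule.mem_top
      simpa using mem_vanishingIdeal_iff.1 h2 x hx
    · have := h {x | eval x p = 0} {x | eval x q = 0} ⟨{p}, by simp⟩ ⟨{q}, by simp⟩ (fun x hx => by
        simpa using mem_vanishingIdeal_iff.1 hpq x hx)
      refine this.imp (fun h x hx => ?_) (fun h x hx => ?_)
      · simpa using h hx
      · simpa using h hx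
  · intro h
    refine ⟨Set.nonempty_iff_ne_empty.2 fun h0 => h.ne_top (h0 ▸ vanishingIdeal_empty),
      fun A B hA hB hAB => ?_⟩
    rw [or_iff_not_imp_left]
    intro hA' x hx
    obtain ⟨P, rfl⟩ := hA
    obtain ⟨Q, rfl⟩ := hB
    obtain ⟨y, hy, hy'⟩ := Set.not_subset.1 hA'
    simp only [Set.mem_ofPred_eq, not_forall] at hy'
    obtain ⟨p, hp, hpy⟩ := hy'
    intro q hq
    have hpq : p * q ∈ vanishingIdeal ℂ V := by
      refine mem_vanishingIdeal_iff.2 fun z hz => ?_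
      rw [aeval_eq_eval', map_mul]
      rcases hAB hz with h1 | h1
      · rw [h1 p hp, zero_mul]
      · rw [h1 q hq, mul_zero]
    rcases h.mem_or_mem hpq with h1 | h1
    · exact absurd (by simpa using mem_vanishingIdeal_iff.1 h1 y hy) hpy
    · simpa using mem_vanishingIdeal_iff.1 h1 x hx

lemma IsAlgSet.zcl_eq {V : Set (σ → ℂ)} (h : IsAlgSet V) : zcl V = V :=

  Set.Subset.antisymm (Set.sInter_subset_of_mem (t := V) (And.intro h subset_rfl))
    (Set.subset_sInter fun _ hT => hT.2)

/-- A chain of irreducible algebraic subsets of `V` gives a chain of prime ideals. -/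
lemma exists_ltSeries_of_chain {V : Set (σ → ℂ)} {k : ℕ} {c : Fin (k + 1) → Set (σ → ℂ)}
    (hc : StrictMono c) (h : ∀ i, IsAlgSet (c i) ∧ IsIrr (c i) ∧ c i ⊆ V) :
    ∃ s : LTSeries (PrimeSpectrum (MvPolynomial σ ℂ)), s.length = k ∧
      vanishingIdeal ℂ V ≤ s.head.asIdeal := by
  let f : Fin (k + 1) → PrimeSpectrum (MvPolynomial σ ℂ) := fun i =>
    ⟨vanishingIdeal ℂ (c i.rev), isIrr_iff_isPrime.1 (h _).2.1⟩
  have hf : StrictMono f := by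
    intro a b hab
    have h1 : c b.rev < c a.rev := hc (Fin.rev_lt_rev.2 hab)
    refine lt_of_le_of_ne (vanishingIdeal_anti_mono h1.le) fun h2 => h1.ne ?_
    have h3 : vanishingIdeal ℂ (c a.rev) = vanishingIdeal ℂ (c b.rev) :=
      congrArg PrimeSpectrum.asIdeal h2
    rw [← (h a.rev).1.zeroLocus_vanishingIdeal, h3, (h b.rev).1.zeroLocus_vanishingIdeal]
  exact ⟨LTSeries.mk k f hf, rfl, vanishingIdeal_anti_mono (h _).2.2⟩

theorem adim_hypersurface {n : ℕ} {p : MvPolynomial (Fin (n + 1)) ℂ} (hp0 : p ≠ 0)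
    {b : Fin (n + 1) → ℂ} (hb : eval b p = 0) : adim {x | eval x p = 0} = n := by
  have halg : IsAlgSet {x | eval x p = 0} := ⟨{p}, by simp⟩
  have hdim := ringKrullDim_mvPolynomial_complex (n + 1)
  have hmem : n ∈ {k : ℕ | ∃ c : Fin (k + 1) → Set (Fin (n + 1) → ℂ), StrictMono c ∧
      ∀ i, IsAlgSet (c i) ∧ IsIrr (c i) ∧ c i ⊆ zcl {x | eval x p = 0}} := by
    have hprime : (vanishingIdeal ℂ {b} : Ideal (MvPolynomial (Fin (n + 1)) ℂ)).IsPrime :=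
      (isMaximal_iff_eq_vanishingIdeal_singleton.2 ⟨b, rfl⟩).isPrime
    have h1 := Module.ringKrullDim_quotient_add_one_of_mem_nonZeroDivisors
      (mem_nonZeroDivisors_of_ne_zero hp0) (height_vanishingIdeal_singleton b)
      ((mem_vanishingIdeal_singleton_iff b p).2 (by simpa using hb))
    rw [hdim] at h1
    have h2 : (n : WithBot ℕ∞) ≤ ringKrullDim (MvPolynomial (Fin (n + 1)) ℂ ⧸ Ideal.span {p}) := by
      have h3 : ((n : ℕ) : WithBot ℕ∞) + 1 ≤ ringKrullDim (MvPolynomial (Fin (n + 1)) ℂ ⧸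
          Ideal.span {p}) + 1 := by
        rw [h1]
        push_cast
        exact le_rfl
      exact ENat.WithBot.add_le_add_one_right_iff.1 h3
    obtain ⟨s, hs⟩ := Order.le_krullDim_iff.1 h2
    obtain ⟨f, hf⟩ : ∃ f : Fin (n + 1) → PrimeSpectrum (MvPolynomial (Fin (n + 1)) ℂ ⧸
        Ideal.span {p}), StrictMono f :=
      ⟨fun i => s (i.cast (by rw [hs])), fun a b hab => s.strictMono (by simpa using hab)⟩
    let I : Fin (n + 1) → Ideal (MvPolynomial (Fin (n + 1)) ℂ) := fun i =>
      (f i).asIdeal.comap (Ideal.Quotient.mk _)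
    have hI : ∀ i, (I i).IsPrime := fun i => Ideal.comap_isPrime _ _
    refine ⟨fun i => zeroLocus ℂ (I i.rev), fun i k hik => ?_, fun i =>
        ⟨isAlgSet_iff.2 ⟨_, rfl⟩, ?_,
      ?_⟩⟩
    · have h3 : f k.rev < f i.rev := hf (Fin.rev_lt_rev.2 hik)
      refine lt_of_le_of_ne (zeroLocus_anti_mono (Ideal.comap_mono h3.le)) fun h4 => h3.ne ?_
      have h5 : I i.rev = I k.rev := by
        rw [← IsPrime.vanishingIdeal_zeroLocus (K := ℂ) (I i.rev),
          ← IsPrime.vanishingIdeal_zeroLocus (K := ℂ) (I k.rev)]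
        exact congrArg _ h4
      exact PrimeSpectrum.ext
        (Ideal.comap_injective_of_surjective _ Ideal.Quotient.mk_surjective h5.symm)
    · rw [isIrr_iff_isPrime, IsPrime.vanishingIdeal_zeroLocus]
      exact hI _
    · rw [halg.zcl_eq]
      intro x hx
      have : p ∈ I i.rev := by
        rw [Ideal.mem_comap, Ideal.Quotient.eq_zero_iff_mem.2 (Ideal.mem_span_singleton_self p)]
        exact Ideal.zero_mem _
      simpa using hx p this
  refine IsGreatest.csSup_eq ⟨hmem, ?_⟩
  rintro k ⟨c, hc, h⟩
  rw [halg.zcl_eq] at h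
  obtain ⟨s, rfl, hs⟩ := exists_ltSeries_of_chain hc h
  have hp : p ∈ s.head.asIdeal := hs (mem_vanishingIdeal_iff.2 fun x hx => by simpa using hx)
  have hlt : (⊥ : PrimeSpectrum (MvPolynomial (Fin (n + 1)) ℂ)) < s.head := by
    refine bot_lt_iff_ne_bot.2 fun h0 => hp0 ?_
    rw [h0] at hp
    simpa using hp
  have h1 := Order.LTSeries.length_le_krullDim (s.cons ⊥ hlt)
  change _ ≤ ringKrullDim _ at h1
  rw [hdim] at h1
  simp only [RelSeries.cons_length] at h1
  have h2 : s.length + 1 ≤ n + 1 := by exact_mod_cast h1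
  lia

end HypersurfaceDimension

section TranscendenceDegree

open MvPolynomial

variable {ι : Type*} [Finite ι] (K : Subfield ℂ) (v : ι → ℂ)

lemma exists_card_eq_trdegF : ∃ t : Finset ι, t.card = trdegF K v ∧
    ∀ i, IsAlgebraic (Algebra.adjoin K (v '' t)) (v i) := by
  have := Fintype.ofFinite ι
  have hbdd : BddAbove {k : ℕ | ∃ t : Finset ι, t.card = k ∧
      AlgebraicIndependent K (fun i : t => v i.1)} :=
    ⟨Fintype.card ι, by rintro _ ⟨t, rfl, -⟩; exact t.card_le_univ⟩
  obtain ⟨t, ht, hi⟩ := Nat.sSup_mem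
    (s := {k : ℕ | ∃ t : Finset ι, t.card = k ∧ AlgebraicIndependent K (fun i : t => v i.1)})
    ⟨0, ∅, rfl, algebraicIndependent_empty_type_iff.2 (algebraMap K ℂ).injective⟩ hbdd
  refine ⟨t, ht, fun i => ?_⟩
  by_cases hit : i ∈ t
  · exact isAlgebraic_algebraMap
      (⟨v i, Algebra.subset_adjoin ⟨i, hit, rfl⟩⟩ : Algebra.adjoin K (v '' t))
  · by_contra htr
    classical
    have h1 : AlgebraicIndepOn K v (insert i (t : Set ι)) :=
      (AlgebraicIndepOn.insert_iff (by simpa using hit)).2 ⟨hi, htr⟩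
    have h2 := le_csSup hbdd ⟨insert i t, rfl, by rw [← Finset.coe_insert] at h1; exact h1⟩
    rw [Finset.card_insert_of_notMem hit, ht] at h2
    lia

lemma trdegF_le {K : Subfield ℂ} {n : ℕ} {v : Fin (n + 1) → ℂ} {Z : Set (Fin (n + 1) → ℂ)}
    (hZ : IsAlgSetOver (K : Set ℂ) Z) (hne : Z ≠ Set.univ) (hv : v ∈ Z) : trdegF K v ≤ n := by
  refine csSup_le' ?_
  rintro _ ⟨t, rfl, ht⟩
  by_contra! hcard
  obtain rfl : t = Finset.univ := Finset.eq_univ_of_card t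
    (le_antisymm t.card_le_univ (by simpa using hcard))
  obtain ⟨P, hPK, rfl⟩ := hZ
  refine hne (Set.eq_univ_of_forall fun x p hp => ?_)
  obtain ⟨q, rfl⟩ : p ∈ Set.range (map (algebraMap K ℂ)) := by
    rw [mem_range_map_iff_coeffs_subset]
    intro c hc
    obtain ⟨m, -, rfl⟩ := mem_coeffs_iff.1 hc
    exact ⟨⟨_, hPK p hp m⟩, rfl⟩
  have h1 : AlgebraicIndependent K v :=
    ht.comp (fun i => ⟨i, Finset.mem_univ i⟩) fun _ _ h => congrArg Subtype.val h
  have h2 : aeval v q = 0 := by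
    rw [← hv _ hp]
    simp [eval_map, aeval_def]
  rw [h1.eq_zero_of_aeval_eq_zero q h2]
  simp

variable {k E : Type*} [Field k] [Field E] [Algebra k E] [CharZero E]

lemma derivation_eq_zero_of_isAlgebraic_subfield {δ : Derivation k E E} {K : Subfield E}
    (hK : ∀ x ∈ K, δ x = 0) {S : Set E} (hS : ∀ x ∈ S, δ x = 0) {x : E}
    (hx : IsAlgebraic (Algebra.adjoin K S) x) : δ x = 0 := by
  let δ' : Derivation K E E := Derivation.mk'
    { toFun := δ
      map_add' := δ.map_add
      map_smul' := fun c y => by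
        rw [RingHom.id_apply, Subfield.smul_def, Subfield.smul_def, smul_eq_mul, Derivation.leibniz,
          hK c c.2, smul_zero, add_zero] } δ.leibniz
  exact derivation_eq_zero_of_isAlgebraic_adjoin (δ := δ') hS
    (IntermediateField.isAlgebraic_adjoin_iff.2 hx)

lemma derivation_eq_zero_of_mem_closure {δ : Derivation k E E} {S : Set E}
    (hS : ∀ x ∈ S, δ x = 0) {x : E} (hx : x ∈ Subfield.closure S) : δ x = 0 :=
  (Subfield.closure_le (t := (constField δ).toSubfield)).2 hS hx

end TranscendenceDegree

section Counting

open MvPolynomial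

variable {j : ℂ → ℂ} {D : Derivation ℚ ℂ ℂ} {e0 e1 : ℂ}

lemma finrank_le_card_of_separating {C V W B : Type*} [Field C] [AddCommGroup V] [Module C V]
    [AddCommGroup W] [Module C W] [FiniteDimensional C W] [Fintype B] {f : V →ₗ[C] W}
    (hf : Function.Surjective f) (g : V →ₗ[C] (B → C)) (h : ∀ x, g x = 0 → f x = 0) :
    Module.finrank C W ≤ Fintype.card B := by
  obtain ⟨s, hs⟩ := f.exists_rightInverse_of_surjective (LinearMap.range_eq_top.2 hf)
  have hinj : Function.Injective (g ∘ₗ s) := by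
    refine (injective_iff_map_eq_zero _).2 fun w hw => ?_
    have := h _ hw
    rwa [← LinearMap.comp_apply, hs] at this
  simpa using LinearMap.finrank_le_finrank_of_injective hinj

/-- A solution set whose Schwarzians avoid every finite set has a point of maximal transcendence
degree over a finitely generated field. -/
theorem IsJCtx.exists_trdegF_eq (h : IsJCtx j D e0 e1) {n : ℕ} {K : Subfield ℂ} (hK : FGField K)
    {Sol : Set ℂ} (hmem : ∀ z ∈ Sol, z ∈ HHn j n) (hD : ∀ z ∈ Sol, ∀ k < n, D (jIt j k z) ≠ 0)
    (hinj : ∀ z ∈ Sol, Function.Injective fun k : Fin n => schw D (jIt j k z))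
    (hbad : ∀ Bad : Finset ℂ, ∃ z ∈ Sol, ∀ k < n, schw D (jIt j k z) ∉ Bad)
    (hle : ∀ z ∈ Sol, trdegF K (fun k : Fin (n + 1) => jIt j k z) ≤ n) :
    ∃ z ∈ Sol, trdegF K (fun k : Fin (n + 1) => jIt j k z) = n := by
  classical
  obtain ⟨s, rfl⟩ := hK
  by_contra! hne
  obtain ⟨g, hg, hgg⟩ := exists_seq_of_forall_finset_exists (· ∈ Sol)
    (fun x y => ∀ k l : Fin n, schw D (jIt j k x) ≠ schw D (jIt j l y)) fun S _ => by
      obtain ⟨z, hz, hz'⟩ := hbad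
        ((S ×ˢ Finset.univ).image fun q : ℂ × Fin n => schw D (jIt j q.2 q.1))
      exact ⟨z, hz, fun x hx k l heq => hz' l l.2 (Finset.mem_image.2
        ⟨(x, k), by simpa using hx, heq⟩)⟩
  choose t htc hta using fun i : Fin (s.card + 1) =>
    exists_card_eq_trdegF (Subfield.closure s) (fun k : Fin (n + 1) => jIt j k (g i))
  let I := Fin (s.card + 1) × Fin n
  let c0 : constField D := ⟨e0, h.map_e0⟩
  let c1 : constField D := ⟨e1, h.map_e1⟩
  let a : I → Datum ℂ := fun q => jDatum j (jIt j q.2 (g q.1))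
  have hH : ∀ q : I, jIt j q.2 (g q.1) ∈ HH := fun q => mem_HHn.1 (hmem _ (hg _)) _ q.2.2
  have hD0 : ∀ q : I, D (jIt j q.2 (g q.1)) ≠ 0 := fun q => hD _ (hg _) _ q.2.2
  have hs : Function.Injective fun q : I => schw D (a q).z := by
    rintro ⟨i, k⟩ ⟨i', k'⟩ heq
    rcases lt_trichotomy i i' with hlt | rfl | hlt
    · exact absurd heq (hgg _ _ hlt k k')
    · exact congrArg (Prod.mk i) (hinj _ (hg i) heq)
    · exact absurd heq.symm (hgg _ _ hlt k' k)
  have : IsAlgClosed (constField D) := isAlgClosed_constField D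
  have hsurj := exists_derivation_v_pi (c0 := c0) (c1 := c1)
    (fun h01 => h.ne (congrArg Subtype.val h01)) (D := overConst D)
    (fun x hx δ => δ.map_algebraMap (⟨x, hx⟩ : constField D)) a
    (fun q => ⟨(h.isDatum (hH q) (hD0 q)).dw, (h.isDatum (hH q) (hD0 q)).dw1,
      (h.isDatum (hH q) (hD0 q)).dw2, hD0 q, (h.isDatum (hH q) (hD0 q)).w1_ne,
      (h.isDatum (hH q) (hD0 q)).w_ne0, (h.isDatum (hH q) (hD0 q)).w_ne1⟩)
    (fun q => h.algebraicIndependent (hH q) (hD0 q)) hs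
  let b : s ⊕ (Σ i, t i) ⊕ I × Fin 2 → ℂ := Sum.elim (fun x => x) <|
    Sum.elim (fun q => jIt j q.2 (g q.1)) fun q =>
      ![deriv j (jIt j q.1.2 (g q.1.1)), deriv (deriv j) (jIt j q.1.2 (g q.1.1))] q.2
  let ev : Derivation (constField D) ℂ ℂ →ₗ[ℂ] (s ⊕ (Σ i, t i) ⊕ I × Fin 2 → ℂ) :=
    { toFun := fun δ x => δ (b x)
      map_add' := fun _ _ => rfl
      map_smul' := fun _ _ => rfl }
  have hcard := finrank_le_card_of_separating
    (f := LinearMap.pi fun q => (a q).v (algebraMap (constField D) ℂ c0)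
      (algebraMap (constField D) ℂ c1))
    (fun c => by
      obtain ⟨δ, hδ⟩ := hsurj c
      exact ⟨δ, funext hδ⟩) ev fun δ hδ => by
    have h0 : ∀ x, δ (b x) = 0 := fun x => congrFun hδ x
    have hjt : ∀ (i : Fin (s.card + 1)) (k : Fin (n + 1)), δ (jIt j k (g i)) = 0 := fun i k =>
      derivation_eq_zero_of_isAlgebraic_subfield
        (fun x hx => derivation_eq_zero_of_mem_closure
          (fun y hy => h0 (Sum.inl ⟨y, hy⟩)) hx)
        (by
          rintro _ ⟨l, hl, rfl⟩
          exact h0 (Sum.inr (Sum.inl ⟨i, l, hl⟩))) (hta i k)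
    refine funext fun q => (Datum.v_unique (e := 0) (p := 0)
      (h.isDatum (hH q) (hD0 q)).w1_ne ?_ ?_ ?_ ?_).2
    · have := hjt q.1 q.2.succ
      rw [Fin.val_succ, jIt_succ] at this
      simpa [a, jDatum] using this
    · simpa [a, jDatum] using hjt q.1 q.2.castSucc
    · simpa [a, b, jDatum] using h0 (Sum.inr (Sum.inr (q, 0)))
    · simpa [a, b, jDatum] using h0 (Sum.inr (Sum.inr (q, 1)))
  have hsum : ∑ i, (t i).card ≤ (s.card + 1) * (n - 1) := by
    refine (Finset.sum_le_card_nsmul _ _ (n - 1) fun i _ => ?_).trans (by simp)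
    rw [htc]
    exact Nat.le_sub_one_of_lt ((hle _ (hg i)).lt_of_ne (hne _ (hg i)))
  obtain ⟨m, rfl⟩ : ∃ m, n = m + 1 := Nat.exists_eq_succ_of_ne_zero fun hn =>
    hne _ (hg 0) (by have := hle _ (hg 0); lia)
  simp only [Module.finrank_pi_fintype, Module.finrank_self, Finset.sum_const, Finset.card_univ,
    Fintype.card_fin, smul_eq_mul, mul_one, Fintype.card_sum, Fintype.card_coe, Fintype.card_sigma,
    Fintype.card_prod, I] at hcard
  rw [Nat.add_sub_cancel] at hsum
  nlinarith

end Counting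

open MvPolynomial in
/-- A polynomial whose zero set is not defined over `L` has a coefficient outside `L`. -/
lemma exists_coeff_notMem {ι : Type*} {L : Set ℂ} {p : MvPolynomial ι ℂ}
    (h : ¬IsAlgSetOver L {x | eval x p = 0}) : ∃ m, coeff m p ∉ L := by
  by_contra! hc
  exact h ⟨{p}, by simpa using hc, by simp⟩

open MvPolynomial in
/-- An irreducible polynomial can be scaled to have a coefficient equal to one. -/
lemma exists_normalized {ι : Type*} {p : MvPolynomial ι ℂ} (hp : Irreducible p) :
    ∃ (c : ℂ) (m : ι →₀ ℕ), c ≠ 0 ∧ Irreducible (C c * p) ∧ coeff m (C c * p) = 1 := by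
  obtain ⟨m, hm⟩ := ne_zero_iff.1 hp.ne_zero
  refine ⟨(coeff m p)⁻¹, m, inv_ne_zero hm, ?_, by simp [coeff_C_mul, hm]⟩
  rwa [irreducible_isUnit_mul ((inv_ne_zero hm).isUnit.map C)]

/-- (Unconditional.) For an irreducible hypersurface
`Z = {p = 0} ⊂ ℂ^{n+1}` with `∂p/∂X ≠ 0`, `∂p/∂Yₙ ≠ 0`, which is not definable over
`C_j`, and any finitely generated field `K` over which `Z` is defined, there is
`z ∈ ℍₙ` such that `(z, j(z), j₂(z), …, jₙ(z)) ∈ Z` is generic in `Z` over `K`. -/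
theorem generic_iterates_unconditional
    (j : ℂ → ℂ) (hj : IsModularJ j)
    (n : ℕ) (hn : 0 < n)
    (p : MvPolynomial (Fin (n + 1)) ℂ) (hirr : Irreducible p)
    (hdX : MvPolynomial.pderiv (0 : Fin (n + 1)) p ≠ 0)
    (hdYn : MvPolynomial.pderiv (Fin.last n) p ≠ 0)
    (Z : Set (Fin (n + 1) → ℂ)) (hZ : Z = {x | MvPolynomial.eval x p = 0})
    (hnotCj : ¬ IsAlgSetOver (Cj j) Z)
    (K : Subfield ℂ) (hK : FGField K) (hZdef : IsAlgSetOver (K : Set ℂ) Z) :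
    ∃ z ∈ HHn j n,
      (fun k : Fin (n + 1) => jIt j (k : ℕ) z) ∈ Z ∧
      trdegF K (fun k : Fin (n + 1) => jIt j (k : ℕ) z) = adim Z := by
  open MvPolynomial in
  obtain ⟨c, m, hc, hP, hm⟩ := exists_normalized hirr
  have hC : (C c : MvPolynomial (Fin (n + 1)) ℂ) ≠ 0 := by simpa using hc
  have hZP : Z = {x | eval x (C c * p) = 0} := by simp [hZ, hc]
  have h0 : pderiv 0 (C c * p) ≠ 0 := by
    rw [pderiv_C_mul]
    exact mul_ne_zero hC hdX
  have hl : pderiv (Fin.last n) (C c * p) ≠ 0 := by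
    rw [pderiv_C_mul]
    exact mul_ne_zero hC hdYn
  generalize C c * p = P at *
  subst hZP
  obtain ⟨i, hi⟩ := exists_coeff_notMem hnotCj
  obtain ⟨D', hD', hDi⟩ : ∃ D', IsJDeriv j D' ∧ D' (coeff i P) ≠ 0 := by
    by_contra! hall
    exact hi fun D' hD' _ => hall D' hD'
  obtain ⟨D, e0, e1, h, hDD⟩ := exists_isJCtx hj hD'
  have hDP : coeffD D P ≠ 0 := fun hzero => hDi (by
    rw [← hDD, ← coeff_coeffD, hzero, coeff_zero])
  have hsol := exists_solution h hn hP h0 hl hm hDP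
  have hne : {x | eval x P = 0} ≠ Set.univ := fun huniv => hP.ne_zero
    (MvPolynomial.funext fun x => by simpa using huniv.ge (Set.mem_univ x))
  obtain ⟨z, ⟨hz, hzP, -⟩, hzt⟩ := h.exists_trdegF_eq hK
    (Sol := {z | z ∈ HHn j n ∧ eval (fun k : Fin (n + 1) => jIt j k z) P = 0 ∧
      (∀ k < n, D (jIt j k z) ≠ 0) ∧ ∀ k < n, ∀ l < k, schw D (jIt j k z) ≠ schw D (jIt j l z)})
    (fun z hz => hz.1) (fun z hz => hz.2.2.1)
    (fun z hz k l hkl => by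
      rcases lt_trichotomy k l with hlt | rfl | hlt
      · exact absurd hkl.symm (hz.2.2.2 l l.2 k hlt)
      · rfl
      · exact absurd hkl (hz.2.2.2 k k.2 l hlt))
    (fun Bad => by
      obtain ⟨z, hz, hzP, hzD, hzs⟩ := hsol Bad
      exact ⟨z, ⟨hz, hzP, fun k hk => (hzD k hk).1, hzs⟩, fun k hk => (hzD k hk).2⟩)
    (fun z hz => trdegF_le hZdef hne hz.2.1)
  exact ⟨z, hz, hzP, hzt.trans (adim_hypersurface hP.ne_zero hzP).symm⟩

end ModularJPaper
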